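/- Let N ≥ 3, 0 < R₁ < R₂, 1 < p < (N+2)/(N−2) and λ > 0. Then there exists a function v_λ ∈ C²(D) ∩ C¹(D̄) with v_λ > 0 in D and v_λ = 0 on ∂D, solving −Δv_λ = (v_λ^p − λ v_λ)/(2|z|) in D, which belongs to the Nehari set N_λ and satisfies J_λ(v_λ) ≤ J_λ(w) for every w ∈ N_λ. -/

import Mathlib

noncomputable section
open Real MeasureTheory Filter

/-- The Euclidean Laplacian on `ℝ^N`. -/
def lapE {N : ℕ} (f : EuclideanSpace ℝ (Fin N) → ℝ) (z : EuclideanSpace ℝ (Fin N)) : ℝ :=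
  ∑ i : Fin N,
    fderiv ℝ (fun y => fderiv ℝ f y (EuclideanSpace.single i (1 : ℝ))) z
      (EuclideanSpace.single i (1 : ℝ))

/-- The annulus `D = {R₁ < |z| < R₂}` in `ℝ^N`. -/
def DSet (N : ℕ) (R₁ R₂ : ℝ) : Set (EuclideanSpace ℝ (Fin N)) := {z | R₁ < ‖z‖ ∧ ‖z‖ < R₂}

/-- The energy functional
`J_λ(v) = ∫_D ( |∇v|²/2 + λ v²/(4|z|) − |v|^{p+1}/(2(p+1)|z|) ) dz`. -/
def Jfun (N : ℕ) (R₁ R₂ lam p : ℝ) (v : EuclideanSpace ℝ (Fin N) → ℝ) : ℝ :=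
  ∫ z in DSet N R₁ R₂,
    (‖fderiv ℝ v z‖ ^ 2 / 2 + lam * v z ^ 2 / (4 * ‖z‖)
      - |v z| ^ (p + 1) / (2 * (p + 1) * ‖z‖))

/-- The Nehari identity `∫_D |∇w|² dz + λ ∫_D w²/(2|z|) dz = ∫_D |w|^{p+1}/(2|z|) dz`. -/
def NehariId (N : ℕ) (R₁ R₂ lam p : ℝ) (w : EuclideanSpace ℝ (Fin N) → ℝ) : Prop :=
  (∫ z in DSet N R₁ R₂, ‖fderiv ℝ w z‖ ^ 2)
      + lam * ∫ z in DSet N R₁ R₂, w z ^ 2 / (2 * ‖z‖)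
    = ∫ z in DSet N R₁ R₂, |w z| ^ (p + 1) / (2 * ‖z‖)

/-- The Nehari set: Lipschitz functions on `D̄` vanishing on `∂D`, not identically zero,
satisfying the Nehari identity. -/
def Nehari (N : ℕ) (R₁ R₂ lam p : ℝ) : Set (EuclideanSpace ℝ (Fin N) → ℝ) :=
  {v | (∃ K, LipschitzOnWith K v (closure (DSet N R₁ R₂))) ∧
    (∀ z ∈ frontier (DSet N R₁ R₂), v z = 0) ∧
    (∃ z ∈ closure (DSet N R₁ R₂), v z ≠ 0) ∧ NehariId N R₁ R₂ lam p v}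

/-- The nodal Nehari set: Lipschitz functions on `D̄` vanishing on `∂D` whose positive and
negative parts are both nontrivial and both satisfy the Nehari identity. -/
def NodalNehari (N : ℕ) (R₁ R₂ lam p : ℝ) : Set (EuclideanSpace ℝ (Fin N) → ℝ) :=
  {v | (∃ K, LipschitzOnWith K v (closure (DSet N R₁ R₂))) ∧
    (∀ z ∈ frontier (DSet N R₁ R₂), v z = 0) ∧
    (∃ z ∈ closure (DSet N R₁ R₂), 0 < v z) ∧
    (∃ z ∈ closure (DSet N R₁ R₂), v z < 0) ∧
    NehariId N R₁ R₂ lam p (fun z => max (v z) 0) ∧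
    NehariId N R₁ R₂ lam p (fun z => max (-v z) 0)}

open scoped Topology InnerProductSpace ENNReal NNReal

section M1
variable {N : ℕ}
local notation "𝔼" => EuclideanSpace ℝ (Fin N)

lemma par_C1 {P : Type*} [MeasurableSpace P] {μ : Measure P} {U : Set 𝔼} (hU : IsOpen U)
    {F : 𝔼 → P → ℝ} {F' : 𝔼 → P → (𝔼 →L[ℝ] ℝ)} {b : P → ℝ}
    (hm : ∀ x ∈ U, AEStronglyMeasurable (F x) μ) (hm' : ∀ x ∈ U, AEStronglyMeasurable (F' x) μ)
    (hi : ∀ x ∈ U, Integrable (F x) μ) (hb : ∀ᵐ p ∂μ, ∀ x ∈ U, ‖F' x p‖ ≤ b p)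
    (ib : Integrable b μ) (hd : ∀ᵐ p ∂μ, ∀ x ∈ U, HasFDerivAt (F · p) (F' x p) x)
    (hc : ∀ᵐ p ∂μ, ContinuousOn (F' · p) U) :
    (∀ x ∈ U, HasFDerivAt (fun x => ∫ p, F x p ∂μ) (∫ p, F' x p ∂μ) x) ∧
      ContDiffOn ℝ 1 (fun x => ∫ p, F x p ∂μ) U := by
  have h1 : ∀ x ∈ U, HasFDerivAt (fun x => ∫ p, F x p ∂μ) (∫ p, F' x p ∂μ) x := by
    intro x hx
    refine hasFDerivAt_integral_of_dominated_of_fderiv_le (hU.mem_nhds hx) ?_ (hi x hx) (hm' x hx)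
      hb ib hd
    filter_upwards [hU.mem_nhds hx] with y hy using hm y hy
  refine ⟨h1, ?_⟩
  have h2 : ContinuousOn (fun x => ∫ p, F' x p ∂μ) U := by
    refine continuousOn_of_dominated hm' ?_ ib hc
    intro x hx
    filter_upwards [hb] with p hp using hp x hx
  rw [show (1 : WithTop ℕ∞) = 0 + 1 from rfl, contDiffOn_succ_iff_fderiv_of_isOpen hU]
  refine ⟨fun x hx => (h1 x hx).differentiableAt.differentiableWithinAt, by simp, ?_⟩
  rw [contDiffOn_zero]
  exact h2.congr fun x hx => (h1 x hx).fderiv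

/-- the quadratic form -/
def QF (α β : ℝ) (y x : 𝔼) : ℝ := α * ‖x‖ ^ 2 - 2 * ⟪x, y⟫_ℝ + β

/-- derivative of the quadratic form -/
def QL (α : ℝ) (y x : 𝔼) : 𝔼 →L[ℝ] ℝ := (2 * α) • innerSL ℝ x - (2 : ℝ) • innerSL ℝ y

lemma QF_hasFDerivAt (α β : ℝ) (y x : 𝔼) : HasFDerivAt (QF α β y) (QL α y x) x := by
  have h1 : HasFDerivAt (fun x : 𝔼 => ‖x‖ ^ 2) (2 • innerSL ℝ x) x :=
    (hasStrictFDerivAt_norm_sq x).hasFDerivAt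
  have h2 : HasFDerivAt (fun x : 𝔼 => ⟪x, y⟫_ℝ) (innerSL ℝ y) x := by
    have := (innerSL ℝ y).hasFDerivAt (x := x)
    refine this.congr_of_eventuallyEq (Eventually.of_forall fun z => ?_)
    simp [real_inner_comm]
  have := ((h1.const_mul α).sub (h2.const_mul 2)).add_const β
  refine this.congr_fderiv ?_
  ext z
  simp [QL]
  ring

lemma QF_continuous (α β : ℝ) (y : 𝔼) : Continuous (QF α β y) := by
  unfold QF; fun_prop

lemma QL_continuous (α : ℝ) (y : 𝔼) : Continuous (QL α y) := by
  unfold QL; fun_prop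

lemma QL_norm_le (α : ℝ) (y x : 𝔼) : ‖QL α y x‖ ≤ 2 * (|α| * ‖x‖ + ‖y‖) := by
  unfold QL
  refine (norm_sub_le _ _).trans ?_
  rw [norm_smul, norm_smul, innerSL_apply_norm, innerSL_apply_norm]
  simp [abs_mul]
  linarith

lemma QL_single (α : ℝ) (y x : 𝔼) (i : Fin N) :
    QL α y x (EuclideanSpace.single i 1) = 2 * α * x i - 2 * y i := by
  simp [QL, EuclideanSpace.inner_single_right]

/-- coordinate functional -/
def prj (i : Fin N) : 𝔼 →L[ℝ] ℝ := EuclideanSpace.proj i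

lemma rest_lemma {P : Type*} [MeasurableSpace P] {μ : Measure P} {U : Set 𝔼} (hU : IsOpen U)
    {X A s : ℝ} (hX : ∀ x ∈ U, ‖x‖ ≤ X) (hs : 0 < s) (hA : 0 ≤ A)
    {c α β θ : P → ℝ} {y : P → 𝔼} (hcm : Measurable c) (hαm : Measurable α) (hβm : Measurable β)
    (hym : Measurable y)
    (H : ∀ᵐ p ∂μ, c p ≠ 0 → 0 < θ p ∧ |α p| ≤ A * θ p ∧ ‖y p‖ ≤ A * θ p ∧
      ∀ x ∈ U, θ p ≤ QF (α p) (β p) (y p) x)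
    (hIntg : Integrable (fun p => |c p| * θ p ^ (-s)) μ) :
    ContDiffOn ℝ 2 (fun x => ∫ p, c p * QF (α p) (β p) (y p) x ^ (-s) ∂μ) U ∧
    (∀ x ∈ U, Integrable (fun p => (c p * (-s * QF (α p) (β p) (y p) x ^ (-s - 1))) • QL (α p) (y p) x) μ) ∧
    (∀ x ∈ U, HasFDerivAt (fun x => ∫ p, c p * QF (α p) (β p) (y p) x ^ (-s) ∂μ)
      (∫ p, (c p * (-s * QF (α p) (β p) (y p) x ^ (-s - 1))) • QL (α p) (y p) x ∂μ) x) ∧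
    ((∀ᵐ p ∂μ, c p ≠ 0 → α p * β p = ‖y p‖ ^ 2) → s = ((N : ℝ) - 2) / 2 →
      ∀ x ∈ U, lapE (fun x => ∫ p, c p * QF (α p) (β p) (y p) x ^ (-s) ∂μ) x = 0) := by
  have hQm : ∀ x, Measurable (fun p => QF (α p) (β p) (y p) x) := by
    intro x; unfold QF; fun_prop
  have hLm : ∀ x, AEStronglyMeasurable (fun p => QL (α p) (y p) x) μ := by
    intro x; unfold QL
    apply AEStronglyMeasurable.sub
    · exact (hαm.const_mul 2).aestronglyMeasurable.smul aestronglyMeasurable_const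
    · exact (((innerSL ℝ).continuous.measurable.comp hym).aestronglyMeasurable).const_smul (2:ℝ)
  -- pointwise bounds
  have key : ∀ᵐ p ∂μ, c p ≠ 0 → ∀ x ∈ U, 0 < θ p ∧ |α p| ≤ A * θ p ∧ ‖QL (α p) (y p) x‖ ≤ 2 * A * (X + 1) * θ p ∧
      ‖y p‖ ≤ A * θ p ∧ 0 < QF (α p) (β p) (y p) x ∧
      QF (α p) (β p) (y p) x ^ (-s) ≤ θ p ^ (-s) ∧
      QF (α p) (β p) (y p) x ^ (-s - 1) * θ p ≤ θ p ^ (-s) ∧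
      QF (α p) (β p) (y p) x ^ (-s - 2) * θ p * θ p ≤ θ p ^ (-s) := by
    filter_upwards [H] with p hp hc x hx
    obtain ⟨h1, h2, h3, h4⟩ := hp hc
    have h4 := h4 x hx
    have hX0 := hX x hx
    have e1 : θ p ^ (-s - 1) * θ p = θ p ^ (-s) := by
      rw [← Real.rpow_add_one h1.ne']; ring_nf
    have e2 : θ p ^ (-s - 2) * θ p * θ p = θ p ^ (-s) := by
      rw [← Real.rpow_add_one h1.ne', ← Real.rpow_add_one h1.ne']; ring_nf
    refine ⟨h1, h2, ?_, h3, h1.trans_le h4, ?_, ?_, ?_⟩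
    · refine (QL_norm_le _ _ _).trans ?_
      have : |α p| * ‖x‖ ≤ A * θ p * X :=
        mul_le_mul h2 hX0 (norm_nonneg _) (by positivity)
      nlinarith
    · exact Real.rpow_le_rpow_of_nonpos h1 h4 (by linarith)
    · rw [← e1]
      exact mul_le_mul_of_nonneg_right (Real.rpow_le_rpow_of_nonpos h1 h4 (by linarith)) h1.le
    · rw [← e2]
      exact mul_le_mul_of_nonneg_right (mul_le_mul_of_nonneg_right
        (Real.rpow_le_rpow_of_nonpos h1 h4 (by linarith)) h1.le) h1.le
  set F1 : 𝔼 → P → (𝔼 →L[ℝ] ℝ) :=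
    fun x p => (c p * (-s * QF (α p) (β p) (y p) x ^ (-s - 1))) • QL (α p) (y p) x with hF1
  have hF1m : ∀ x, AEStronglyMeasurable (F1 x) μ := by
    intro x
    exact ((hcm.mul (((hQm x).pow_const _).const_mul _)).aestronglyMeasurable).smul (hLm x)
  have hF1b : ∀ᵐ p ∂μ, ∀ x ∈ U, ‖F1 x p‖ ≤ (s * (2 * A * (X + 1))) * (|c p| * θ p ^ (-s)) := by
    filter_upwards [key] with p hp x hx
    by_cases hc : c p = 0
    · simp [hF1, hc]
    obtain ⟨h1, h2, h3, h4, h5, h6, h7, h8⟩ := hp hc x hx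
    simp only [hF1]
    rw [norm_smul, Real.norm_eq_abs, abs_mul, abs_mul, abs_neg, abs_of_pos hs,
      abs_of_pos (Real.rpow_pos_of_pos h5 _)]
    have hX' : 0 ≤ X + 1 := by linarith [hX x hx, norm_nonneg x]
    calc |c p| * (s * QF (α p) (β p) (y p) x ^ (-s - 1)) * ‖QL (α p) (y p) x‖
        ≤ |c p| * (s * QF (α p) (β p) (y p) x ^ (-s - 1)) * (2 * A * (X + 1) * θ p) := by gcongr
      _ = (s * (2 * A * (X + 1))) * (|c p| * (QF (α p) (β p) (y p) x ^ (-s - 1) * θ p)) := by ring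
      _ ≤ _ := by gcongr
  have ib1 : Integrable (fun p => (s * (2 * A * (X + 1))) * (|c p| * θ p ^ (-s))) μ :=
    hIntg.const_mul _
  have hi1 : ∀ x ∈ U, Integrable (F1 x) μ := by
    intro x hx
    refine ib1.mono' (hF1m x) ?_
    filter_upwards [hF1b] with p hp using hp x hx
  have hd1 : ∀ᵐ p ∂μ, ∀ x ∈ U,
      HasFDerivAt (fun x => c p * QF (α p) (β p) (y p) x ^ (-s)) (F1 x p) x := by
    filter_upwards [key] with p hp x hx
    by_cases hc : c p = 0
    · simpa [hF1, hc] using hasFDerivAt_const (0 : ℝ) x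
    obtain ⟨h1, h2, h3, h4, h5, h6, h7, h8⟩ := hp hc x hx
    have := ((QF_hasFDerivAt (α p) (β p) (y p) x).rpow_const (p := -s) (Or.inl h5.ne')).const_mul (c p)
    refine this.congr_fderiv ?_
    simp only [hF1, smul_smul]
  have hcQ : ∀ᵐ p ∂μ, c p ≠ 0 → ∀ r : ℝ, ContinuousOn (fun x => QF (α p) (β p) (y p) x ^ r) U := by
    filter_upwards [key] with p hp hc r
    exact (QF_continuous _ _ _).continuousOn.rpow_const fun x hx => Or.inl (hp hc x hx).2.2.2.2.1.ne'
  have hc1 : ∀ᵐ p ∂μ, ContinuousOn (F1 · p) U := by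
    filter_upwards [hcQ] with p hp
    by_cases hc : c p = 0
    · simp only [hF1, hc]; simpa using continuousOn_const
    exact (continuousOn_const.mul (continuousOn_const.mul (hp hc _))).smul (QL_continuous _ _).continuousOn
  obtain ⟨D1, C1⟩ := par_C1 hU (F := fun x p => c p * QF (α p) (β p) (y p) x ^ (-s)) (F' := F1)
    (μ := μ)
    (fun x _ => (hcm.mul ((hQm x).pow_const _)).aestronglyMeasurable) (fun x _ => hF1m x)
    (by
      intro x hx
      refine hIntg.mono' (hcm.mul ((hQm x).pow_const _)).aestronglyMeasurable ?_
      filter_upwards [key] with p hp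
      by_cases hc : c p = 0
      · simp [hc]
      obtain ⟨h1, h2, h3, h4, h5, h6, h7, h8⟩ := hp hc x hx
      rw [Real.norm_eq_abs, abs_mul, abs_of_pos (Real.rpow_pos_of_pos h5 _)]
      gcongr) hF1b ib1 hd1 hc1
  -- second derivatives
  set F2 : Fin N → 𝔼 → P → (𝔼 →L[ℝ] ℝ) := fun i x p =>
    (c p * -s) • ((QF (α p) (β p) (y p) x ^ (-s - 1)) • ((2 * α p) • prj i) +
      ((2 * α p * x i - 2 * y p i) * ((-s - 1) * QF (α p) (β p) (y p) x ^ (-s - 2))) • QL (α p) (y p) x)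
    with hF2
  set f2 : Fin N → 𝔼 → P → ℝ := fun i x p =>
    (c p * -s) * ((2 * α p * x i - 2 * y p i) * QF (α p) (β p) (y p) x ^ (-s - 1)) with hf2
  have hyi : ∀ i, Measurable (fun p => y p i) := fun i =>
    (EuclideanSpace.proj (𝕜 := ℝ) i).continuous.measurable.comp hym
  have hF2m : ∀ i x, AEStronglyMeasurable (F2 i x) μ := by
    intro i x
    refine AEStronglyMeasurable.fun_smul (hcm.mul_const _).aestronglyMeasurable (AEStronglyMeasurable.fun_add ?_ ?_)
    · refine ((hQm x).pow_const _).aestronglyMeasurable.fun_smul (AEStronglyMeasurable.fun_smul ?_ aestronglyMeasurable_const)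
      exact (hαm.const_mul _).aestronglyMeasurable
    · refine AEStronglyMeasurable.fun_smul (Measurable.aestronglyMeasurable ?_) (hLm x)
      have := hyi i
      have := (hQm x).pow_const (-s - 2)
      fun_prop
  have hf2m : ∀ i x, AEStronglyMeasurable (f2 i x) μ := by
    intro i x
    refine Measurable.aestronglyMeasurable ?_
    have := hyi i
    have := (hQm x).pow_const (-s - 1)
    simp only [hf2]
    fun_prop
  have hxi : ∀ (i : Fin N) (x : 𝔼), |x i| ≤ ‖x‖ := fun i x => by
    simpa using PiLp.norm_apply_le x i
  have hprj : ∀ i : Fin N, ‖(prj i : 𝔼 →L[ℝ] ℝ)‖ ≤ 1 := by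
    intro i
    refine ContinuousLinearMap.opNorm_le_bound _ zero_le_one fun x => ?_
    simpa [prj] using hxi i x
  have hQLi : ∀ (i : Fin N) (a : ℝ) (z x : 𝔼), |2 * a * x i - 2 * z i| ≤ ‖QL a z x‖ := by
    intro i a z x
    rw [← QL_single]
    simpa using (QL a z x).le_opNorm (EuclideanSpace.single i 1)
  have hF2b : ∀ i, ∀ᵐ p ∂μ, ∀ x ∈ U, ‖F2 i x p‖ ≤
      (s * (2 * A) + s * ((2 * A * (X + 1)) * (s + 1) * (2 * A * (X + 1)))) * (|c p| * θ p ^ (-s)) := by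
    intro i
    filter_upwards [key] with p hp x hx
    by_cases hc : c p = 0
    · simp [hF2, hc]
    obtain ⟨h1, h2, h3, h4, h5, h6, h7, h8⟩ := hp hc x hx
    have hX' : 0 ≤ X + 1 := by linarith [hX x hx, norm_nonneg x]
    have hq1 := Real.rpow_pos_of_pos h5 (-s - 1)
    have hq2 := Real.rpow_pos_of_pos h5 (-s - 2)
    simp only [hF2]
    rw [norm_smul, Real.norm_eq_abs, abs_mul, abs_neg, abs_of_pos hs]
    have b1 : ‖(QF (α p) (β p) (y p) x ^ (-s - 1)) • ((2 * α p) • prj i)‖ ≤ 2 * A * θ p ^ (-s) := by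
      rw [norm_smul, norm_smul, Real.norm_eq_abs, Real.norm_eq_abs, abs_of_pos hq1, abs_mul, abs_two]
      calc _ ≤ QF (α p) (β p) (y p) x ^ (-s - 1) * (2 * (A * θ p) * 1) := by
            gcongr; exact hprj i
        _ = 2 * A * (QF (α p) (β p) (y p) x ^ (-s - 1) * θ p) := by ring
        _ ≤ _ := by gcongr
    have b2 : ‖((2 * α p * x i - 2 * y p i) * ((-s - 1) * QF (α p) (β p) (y p) x ^ (-s - 2))) • QL (α p) (y p) x‖ ≤
        (2 * A * (X + 1)) * (s + 1) * (2 * A * (X + 1)) * θ p ^ (-s) := by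
      rw [norm_smul, Real.norm_eq_abs, abs_mul, abs_mul, abs_of_pos hq2,
        show |(-s - 1)| = s + 1 by rw [abs_of_neg (by linarith)]; ring]
      calc _ ≤ (2 * A * (X + 1) * θ p) * ((s + 1) * QF (α p) (β p) (y p) x ^ (-s - 2)) * (2 * A * (X + 1) * θ p) := by
            gcongr; exact (hQLi _ _ _ _).trans h3
        _ = (2 * A * (X + 1)) * (s + 1) * (2 * A * (X + 1)) * (QF (α p) (β p) (y p) x ^ (-s - 2) * θ p * θ p) := by ring
        _ ≤ _ := by gcongr
    calc _ ≤ |c p| * s * (2 * A * θ p ^ (-s) + (2 * A * (X + 1)) * (s + 1) * (2 * A * (X + 1)) * θ p ^ (-s)) := by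
          gcongr
          exact (norm_add_le _ _).trans (add_le_add b1 b2)
      _ = _ := by ring
  have hi2 : ∀ i, ∀ x ∈ U, Integrable (F2 i x) μ := by
    intro i x hx
    refine (hIntg.const_mul (s * (2 * A) + s * ((2 * A * (X + 1)) * (s + 1) * (2 * A * (X + 1))))).mono' (hF2m i x) ?_
    filter_upwards [hF2b i] with p hp using hp x hx
  have hd2 : ∀ i, ∀ᵐ p ∂μ, ∀ x ∈ U, HasFDerivAt (f2 i · p) (F2 i x p) x := by
    intro i
    filter_upwards [key] with p hp x hx
    by_cases hc : c p = 0
    · simpa [hF2, hf2, hc] using hasFDerivAt_const (0 : ℝ) x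
    obtain ⟨h1, h2, h3, h4, h5, h6, h7, h8⟩ := hp hc x hx
    have e1 := (QF_hasFDerivAt (α p) (β p) (y p) x).rpow_const (p := -s - 1) (Or.inl h5.ne')
    have e2 : HasFDerivAt (fun x : 𝔼 => 2 * α p * x i - 2 * y p i) ((2 * α p) • prj i) x :=
      (((prj i).hasFDerivAt (x := x)).const_mul (2 * α p)).sub_const _
    have := (e2.mul e1).const_mul (c p * -s)
    refine this.congr_fderiv ?_
    simp only [hF2, smul_smul]
    rw [show -s - 1 - 1 = -s - 2 by ring]
    congr 1
    rw [add_comm]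
  have hc2 : ∀ i, ∀ᵐ p ∂μ, ContinuousOn (F2 i · p) U := by
    intro i
    filter_upwards [hcQ] with p hp
    by_cases hc : c p = 0
    · simp only [hF2, hc]; simpa using continuousOn_const
    have := hp hc (-s - 1)
    have h' := hp hc (-s - 2)
    have hxi : Continuous (fun x : 𝔼 => x i) := (prj i).continuous
    have h3 : ContinuousOn (fun x : 𝔼 => (QF (α p) (β p) (y p) x ^ (-s - 1)) • ((2 * α p) • (prj i : 𝔼 →L[ℝ] ℝ))) U :=
      this.smul continuousOn_const
    refine ContinuousOn.const_smul (h3.add ?_) (c p * -s)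
    exact (((continuous_const.mul hxi).sub continuous_const).continuousOn.mul
      (continuousOn_const.mul h')).smul (QL_continuous _ _).continuousOn
  have S2 : ∀ i, _ := fun i => par_C1 hU (μ := μ) (F := f2 i) (F' := F2 i) (fun x _ => hf2m i x) (fun x _ => hF2m i x)
    (by
      intro x hx
      have := (hi1 x hx).apply_continuousLinearMap (EuclideanSpace.single i 1)
      refine this.congr (Eventually.of_forall fun p => ?_)
      simp only [hF1, hf2, ContinuousLinearMap.smul_apply, QL_single, smul_eq_mul]
      ring) (hF2b i) (hIntg.const_mul _) (hd2 i) (hc2 i)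
  have hpart : ∀ i, ∀ x ∈ U, fderiv ℝ (fun x => ∫ p, c p * QF (α p) (β p) (y p) x ^ (-s) ∂μ) x
      (EuclideanSpace.single i 1) = ∫ p, f2 i x p ∂μ := by
    intro i x hx
    rw [(D1 x hx).fderiv, ContinuousLinearMap.integral_apply (hi1 x hx)]
    refine integral_congr_ae (Eventually.of_forall fun p => ?_)
    simp only [hF1, hf2, ContinuousLinearMap.smul_apply, QL_single, smul_eq_mul]
    ring
  refine ⟨?_, hi1, D1, ?_⟩
  · rw [show (2 : WithTop ℕ∞) = 1 + 1 from (one_add_one_eq_two).symm, contDiffOn_succ_iff_fderiv_of_isOpen hU]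
    refine ⟨fun x hx => (D1 x hx).differentiableAt.differentiableWithinAt, by simp, ?_⟩
    have : ContDiffOn ℝ 1 (fun x => ∑ i, (∫ p, f2 i x p ∂μ) • (prj i : 𝔼 →L[ℝ] ℝ)) U :=
      ContDiffOn.sum fun i _ => (S2 i).2.smul contDiffOn_const
    refine this.congr fun x hx => ?_
    ext z
    simp only [ContinuousLinearMap.sum_apply, ContinuousLinearMap.smul_apply, smul_eq_mul]
    conv_lhs => rw [← (EuclideanSpace.basisFun (Fin N) ℝ).sum_repr z]
    rw [map_sum]
    refine Finset.sum_congr rfl fun i _ => ?_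
    rw [map_smul, ← hpart i x hx]
    simp [prj, mul_comm]
  · intro hab hsN x hx
    unfold lapE
    have : ∀ i, fderiv ℝ (fun z => fderiv ℝ (fun x => ∫ p, c p * QF (α p) (β p) (y p) x ^ (-s) ∂μ) z
      (EuclideanSpace.single i 1)) x (EuclideanSpace.single i 1) =
      ∫ p, F2 i x p (EuclideanSpace.single i 1) ∂μ := by
      intro i
      have he : (fun z => fderiv ℝ (fun x => ∫ p, c p * QF (α p) (β p) (y p) x ^ (-s) ∂μ) z
        (EuclideanSpace.single i 1)) =ᶠ[𝓝 x] fun z => ∫ p, f2 i z p ∂μ := by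
        filter_upwards [hU.mem_nhds hx] with z hz using hpart i z hz
      rw [he.fderiv_eq, ((S2 i).1 x hx).fderiv, ContinuousLinearMap.integral_apply (hi2 i x hx)]
    simp_rw [this]
    rw [← integral_finset_sum _ fun i _ => (hi2 i x hx).apply_continuousLinearMap _]
    refine integral_eq_zero_of_ae ?_
    filter_upwards [key, hab] with p hp hab
    by_cases hc : c p = 0
    · simp [hF2, hc]
    obtain ⟨h1, h2, h3, h4, h5, h6, h7, h8⟩ := hp hc x hx
    have hab := hab hc
    simp only [hF2, ContinuousLinearMap.smul_apply, ContinuousLinearMap.add_apply, QL_single, smul_eq_mul,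
      Pi.zero_apply]
    have hpr : ∀ i : Fin N, (prj i : 𝔼 →L[ℝ] ℝ) (EuclideanSpace.single i 1) = 1 := by
      intro i; simp [prj]
    simp_rw [hpr]
    rw [← Finset.mul_sum, Finset.sum_add_distrib]
    have e1 : QF (α p) (β p) (y p) x ^ (-s - 1) = QF (α p) (β p) (y p) x ^ (-s - 2) * QF (α p) (β p) (y p) x := by
      rw [← Real.rpow_add_one h5.ne']; ring_nf
    have e2 : ∑ i, (2 * α p * x i - 2 * y p i) ^ 2 = 4 * α p * QF (α p) (β p) (y p) x := by
      have n1 : ‖x‖ ^ 2 = ∑ i, x i ^ 2 := by simp [EuclideanSpace.norm_sq_eq]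
      have n2 : ‖y p‖ ^ 2 = ∑ i, y p i ^ 2 := by simp [EuclideanSpace.norm_sq_eq]
      have n3 : ⟪x, y p⟫_ℝ = ∑ i, x i * y p i := by
        simp [PiLp.inner_apply, mul_comm]
      have : ∑ i, (2 * α p * x i - 2 * y p i) ^ 2 = 4 * α p ^ 2 * ∑ i, x i ^ 2 - 8 * α p * ∑ i, x i * y p i
          + 4 * ∑ i, y p i ^ 2 := by
        rw [Finset.mul_sum, Finset.mul_sum, Finset.mul_sum, ← Finset.sum_sub_distrib, ← Finset.sum_add_distrib]
        exact Finset.sum_congr rfl fun i _ => by ring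
      rw [this, ← n1, ← n2, ← n3, ← hab, QF]; ring
    have e3 : ∑ i, (2 * α p * x i - 2 * y p i) * ((-s - 1) * QF (α p) (β p) (y p) x ^ (-s - 2)) *
        (2 * α p * x i - 2 * y p i) = ((-s - 1) * QF (α p) (β p) (y p) x ^ (-s - 2)) * (4 * α p * QF (α p) (β p) (y p) x) := by
      rw [← e2, Finset.mul_sum]
      exact Finset.sum_congr rfl fun i _ => by ring
    rw [e3, e1]
    simp only [Finset.sum_const, Finset.card_univ, Fintype.card_fin, nsmul_eq_mul]
    rw [hsN]; ring

end M1

section M2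
variable {N : ℕ}
local notation "𝔼" => EuclideanSpace ℝ (Fin N)

lemma exists_cutoff {K U : Set 𝔼} (hK : IsCompact K) (hU : IsOpen U) (hKU : K ⊆ U) :
    ∃ χ : 𝔼 → ℝ, ContDiff ℝ 2 χ ∧ HasCompactSupport χ ∧ tsupport χ ⊆ U ∧
      (∀ᶠ x in 𝓝ˢ K, χ x = 1) ∧ ∀ x, χ x ∈ Set.Icc (0 : ℝ) 1 := by
  obtain ⟨K', hK', h1, h2⟩ := exists_compact_between hK hU hKU
  obtain ⟨f, hf0, hf1, hf⟩ := exists_contMDiffMap_zero_one_nhds_of_isClosed (n := 2)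
    (modelWithCornersSelf ℝ 𝔼) (s := (interior K')ᶜ) (t := K) isOpen_interior.isClosed_compl hK.isClosed
    (by rw [Set.disjoint_left]; intro x hx hx'; exact hx (h1 hx'))
  have hs : tsupport f ⊆ K' := by
    refine closure_minimal (fun x hx => ?_) hK'.isClosed
    by_contra hx'
    exact hx ((hf0.self_of_nhdsSet) x (fun h => hx' (interior_subset h)))
  exact ⟨f, f.contMDiff.contDiff, HasCompactSupport.of_support_subset_isCompact hK'
    ((subset_tsupport _).trans hs), hs.trans h2, hf1, hf⟩

lemma contDiff_mul_cutoff {χ F : 𝔼 → ℝ} {U : Set 𝔼} {n : WithTop ℕ∞} (hχ : ContDiff ℝ n χ) (hU : IsOpen U)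
    (hs : tsupport χ ⊆ U) (hF : ContDiffOn ℝ n F U) : ContDiff ℝ n (fun x => χ x * F x) := by
  rw [contDiff_iff_contDiffAt]
  intro x
  by_cases hx : x ∈ U
  · exact hχ.contDiffAt.mul (hF.contDiffAt (hU.mem_nhds hx))
  · have : (fun x => χ x * F x) =ᶠ[𝓝 x] fun _ => 0 := by
      have h : χ =ᶠ[𝓝 x] 0 := notMem_tsupport_iff_eventuallyEq.1 fun h => hx (hs h)
      filter_upwards [h] with y hy
      simp [hy]
    exact contDiffAt_const.congr_of_eventuallyEq this

/-- integration by parts -/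
lemma ibp1 {w F : 𝔼 → ℝ} {K : ℝ≥0} {U : Set 𝔼} (hw : LipschitzWith K w) (hc : HasCompactSupport w)
    (hU : IsOpen U) (hs : tsupport w ⊆ U) (hF : ContDiffOn ℝ 1 F U) (e : 𝔼) :
    ∫ x, fderiv ℝ w x e * F x = - ∫ x, w x * fderiv ℝ F x e := by
  obtain ⟨χ, h1, h2, h3, h4, h5⟩ := exists_cutoff hc hU hs
  have hG := contDiff_mul_cutoff (h1.of_le one_le_two) hU h3 hF
  have hGc : HasCompactSupport (fun x => χ x * F x) := h2.mul_right
  obtain ⟨K', hL⟩ := ContDiff.lipschitzWith_of_hasCompactSupport hGc hG one_ne_zero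
  have := LipschitzWith.integral_lineDeriv_mul_eq (μ := volume) hw hL hGc e
  have e1 : ∫ x, fderiv ℝ w x e * F x = ∫ x, lineDeriv ℝ w x e * (χ x * F x) := by
    refine integral_congr_ae ?_
    filter_upwards [hw.ae_differentiableAt (μ := volume)] with x hx
    by_cases hxw : x ∈ tsupport w
    · simp only [hx.lineDeriv_eq_fderiv, (h4.self_of_nhdsSet) x hxw, one_mul]
    · have : fderiv ℝ w x = 0 := by
        by_contra h
        exact hxw (support_fderiv_subset ℝ h)
      simp only [hx.lineDeriv_eq_fderiv, this]; simp
  rw [e1, this, ← integral_neg]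
  refine integral_congr_ae (Eventually.of_forall fun x => ?_)
  by_cases hxw : x ∈ tsupport w
  · have hh : (fun x => χ x * F x) =ᶠ[𝓝 x] F := by
      have := (eventually_nhdsSet_iff_forall.1 h4) x hxw
      filter_upwards [this] with y hy
      simp [hy]
    simp only [(hG.differentiable one_ne_zero).differentiableAt.lineDeriv_eq_fderiv, hh.fderiv_eq]
    simp; ring
  · simp [image_eq_zero_of_notMem_tsupport hxw]

lemma ibp2 {w φ : 𝔼 → ℝ} {K : ℝ≥0} {U : Set 𝔼} (hw : LipschitzWith K w) (hc : HasCompactSupport w)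
    (hU : IsOpen U) (hs : tsupport w ⊆ U) (hF : ContDiffOn ℝ 2 φ U) :
    ∫ x, ∑ i, fderiv ℝ w x (EuclideanSpace.single i 1) * fderiv ℝ φ x (EuclideanSpace.single i 1) =
      - ∫ x, w x * lapE φ x := by
  have hd : ContDiffOn ℝ 1 (fderiv ℝ φ) U := hF.fderiv_of_isOpen hU (by norm_num)
  have hdi : ∀ i : Fin N, ContDiffOn ℝ 1 (fun x => fderiv ℝ φ x (EuclideanSpace.single i 1)) U :=
    fun i => hd.clm_apply contDiffOn_const
  have hddi : ∀ i : Fin N, ContinuousOn (fun x => fderiv ℝ (fun x => fderiv ℝ φ x (EuclideanSpace.single i 1)) x (EuclideanSpace.single i 1)) U :=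
    fun i => ((hdi i).continuousOn_fderiv_of_isOpen hU le_rfl).clm_apply continuousOn_const
  have hwd : ∀ x, x ∉ tsupport w → fderiv ℝ w x = 0 := fun x hxw => by
    by_contra h
    exact hxw (support_fderiv_subset ℝ h)
  have hsupp : ∀ f : 𝔼 → ℝ, IntegrableOn f (tsupport w) → (∀ x, x ∉ tsupport w → f x = 0) → Integrable f := by
    intro f hf h0
    rw [← integrableOn_iff_integrable_of_support_subset (s := tsupport w)]
    · exact hf
    · intro x hx; by_contra h; exact hx (h0 x h)
  rw [integral_finset_sum]
  · simp_rw [fun i => ibp1 hw hc hU hs (hdi i) (EuclideanSpace.single i 1)]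
    unfold lapE
    simp_rw [Finset.mul_sum]
    rw [integral_finset_sum, ← Finset.sum_neg_distrib]
    intro i _
    refine hsupp _ ?_ ?_
    · exact ContinuousOn.integrableOn_compact hc (hw.continuous.continuousOn.mul ((hddi i).mono hs))
    · intro x hx; simp [image_eq_zero_of_notMem_tsupport hx]
  · intro i _
    refine hsupp _ ?_ ?_
    · have hcont : ContinuousOn (fun x => fderiv ℝ φ x (EuclideanSpace.single i 1)) (tsupport w) :=
        (hdi i).continuousOn.mono hs
      refine Integrable.bdd_mul (c := K * ‖(EuclideanSpace.single i (1:ℝ) : 𝔼)‖) (hcont.integrableOn_compact hc) ?_ ?_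
      · exact (measurable_fderiv_apply_const ℝ w _).aestronglyMeasurable
      · refine Eventually.of_forall fun x => ?_
        exact ((fderiv ℝ w x).le_opNorm _).trans (mul_le_mul_of_nonneg_right (norm_fderiv_le_of_lipschitz ℝ hw) (norm_nonneg _))
    · intro x hx; simp [hwd x hx]

end M2

section M3
variable {N : ℕ}
local notation "𝔼" => EuclideanSpace ℝ (Fin N)

lemma ker_meas (a : ℝ) : Measurable (fun z : 𝔼 => ‖z‖ ^ (-a)) := by fun_prop

lemma ker_int0 (hN : 1 ≤ N) {a : ℝ} (ha : a < N) (r : ℝ) :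
    IntegrableOn (fun z : 𝔼 => ‖z‖ ^ (-a)) (Metric.ball 0 r) := by
  refine integrableOn_ball_of_norm_le_rpow (C := 1) (α := a) (by simpa using hN) (by simpa using ha) ?_
    (ker_meas a).aestronglyMeasurable
  refine Eventually.of_forall fun x => ?_
  rw [Real.norm_eq_abs, abs_of_nonneg (by positivity), one_mul]

lemma ball_pre (x : 𝔼) (r : ℝ) : (fun y => x - y) ⁻¹' (Metric.ball 0 r) = Metric.ball x r := by
  ext y; simp [dist_eq_norm, norm_sub_rev]

lemma ker_int (hN : 1 ≤ N) {a : ℝ} (ha : a < N) (x : 𝔼) (r : ℝ) :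
    IntegrableOn (fun y : 𝔼 => ‖x - y‖ ^ (-a)) (Metric.ball x r) := by
  have := ((Measure.measurePreserving_sub_left (volume : Measure 𝔼) x).integrableOn_comp_preimage
    (MeasurableEquiv.subLeft x).measurableEmbedding).2 (ker_int0 hN ha r)
  rw [ball_pre] at this
  exact this

lemma ker_lint (f : 𝔼 → ℝ≥0∞) (x : 𝔼) (r : ℝ) :
    ∫⁻ y in Metric.ball x r, f (x - y) = ∫⁻ z in Metric.ball 0 r, f z := by
  have := (Measure.measurePreserving_sub_left (volume : Measure 𝔼) x).setLIntegral_comp_preimage_emb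
    (MeasurableEquiv.subLeft x).measurableEmbedding f (Metric.ball 0 r)
  rw [ball_pre] at this
  exact this

lemma ker_int_bdd (hN : 1 ≤ N) {a : ℝ} (ha : a < N) (x : 𝔼) {S : Set 𝔼} (hS : Bornology.IsBounded S) :
    IntegrableOn (fun y : 𝔼 => ‖x - y‖ ^ (-a)) S := by
  obtain ⟨r, hr⟩ := (Metric.isBounded_iff_subset_ball x).1 hS
  exact (ker_int hN ha x r).mono_set hr

/-- regularized gradient kernel -/
def kk (e : ℝ) (z : 𝔼) : 𝔼 := ((‖z‖ ^ 2 + e) ^ (-(N : ℝ) / 2)) • z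

lemma kk_meas (e : ℝ) : Measurable (kk e : 𝔼 → 𝔼) := by unfold kk; fun_prop

lemma sq_rpow_half (x : ℝ) (hx : 0 ≤ x) (a : ℝ) : (x ^ 2) ^ (a / 2) = x ^ a := by
  rw [← Real.rpow_natCast, ← Real.rpow_mul hx]; congr 1; push_cast; ring

lemma kk_norm_le {e : ℝ} (he : 0 ≤ e) (z : 𝔼) : ‖kk e z‖ ≤ ‖z‖ ^ (-((N : ℝ) - 1)) := by
  unfold kk
  by_cases hz : z = 0
  · subst hz; simp; positivity
  have hz' : 0 < ‖z‖ := norm_pos_iff.2 hz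
  rw [norm_smul, Real.norm_eq_abs, abs_of_nonneg (by positivity)]
  calc _ ≤ (‖z‖ ^ 2) ^ (-(N:ℝ) / 2) * ‖z‖ := by
        gcongr ?_ * _
        refine Real.rpow_le_rpow_of_nonpos (by positivity) (by linarith) ?_
        have : (0:ℝ) ≤ N := by positivity
        linarith
    _ = _ := by
      rw [sq_rpow_half _ hz'.le, ← Real.rpow_add_one hz'.ne']; congr 1; ring

lemma kk_tendsto (z : 𝔼) : Tendsto (fun ε : ℝ => kk (ε ^ 2) z) (𝓝[>] 0) (𝓝 (kk 0 z)) := by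
  by_cases hz : z = 0
  · subst hz; simp [kk]
  have hz' : 0 < ‖z‖ := norm_pos_iff.2 hz
  have : ContinuousAt (fun ε : ℝ => kk (ε ^ 2) z) 0 := by
    unfold kk
    refine ContinuousAt.smul (ContinuousAt.rpow_const ?_ (Or.inl ?_)) continuousAt_const
    · fun_prop
    · positivity
  have h := this.tendsto.mono_left (nhdsWithin_le_nhds (s := Set.Ioi 0))
  simpa using h

/-- normalising constant -/
def kp (N : ℕ) : ℝ := N * ∫ z : EuclideanSpace ℝ (Fin N), (1 + ‖z‖ ^ 2) ^ (-((N : ℝ) + 2) / 2)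

lemma kp_int : Integrable (fun z : 𝔼 => (1 + ‖z‖ ^ 2) ^ (-((N : ℝ) + 2) / 2)) :=
  integrable_rpow_neg_one_add_norm_sq (by simp)

lemma kp_pos (hN : 1 ≤ N) : 0 < kp N := by
  unfold kp
  have : (0:ℝ) < N := by exact_mod_cast hN
  refine mul_pos this ?_
  rw [integral_pos_iff_support_of_nonneg (fun z => by positivity) kp_int]
  have : Function.support (fun z : 𝔼 => (1 + ‖z‖ ^ 2) ^ (-((N : ℝ) + 2) / 2)) = Set.univ := by
    ext z; simp; positivity
  rw [this]
  exact isOpen_univ.measure_pos volume Set.univ_nonempty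

lemma eta_approx {g : 𝔼 → ℝ} (hg : Continuous g) (hc : HasCompactSupport g) (x : 𝔼) :
    Tendsto (fun ε : ℝ => ∫ y, g y * (N * ε ^ 2 * (‖x - y‖ ^ 2 + ε ^ 2) ^ (-((N : ℝ) + 2) / 2))) (𝓝[>] 0)
      (𝓝 (kp N * g x)) := by
  obtain ⟨B, hB⟩ := hc.exists_bound_of_continuous hg
  have key : ∀ ε : ℝ, 0 < ε → ∫ y, g y * (N * ε ^ 2 * (‖x - y‖ ^ 2 + ε ^ 2) ^ (-((N : ℝ) + 2) / 2)) =
      ∫ z : 𝔼, g (x - ε • z) * (N * (1 + ‖z‖ ^ 2) ^ (-((N : ℝ) + 2) / 2)) := by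
    intro ε hε
    have h1 := Measure.integral_comp_smul (volume : Measure 𝔼)
      (fun z : 𝔼 => g (x - z) * (N * ε ^ 2 * (‖z‖ ^ 2 + ε ^ 2) ^ (-((N : ℝ) + 2) / 2))) ε
    have h2 := integral_sub_left_eq_self (fun z : 𝔼 => g (x - z) * (N * ε ^ 2 * (‖z‖ ^ 2 + ε ^ 2) ^ (-((N : ℝ) + 2) / 2))) volume x
    simp only [sub_sub_cancel] at h2
    rw [h2]
    rw [← inv_smul_eq_iff₀ (by simp [hε.ne'])] at h1
    rw [← h1, ← integral_smul]
    refine integral_congr_ae (Eventually.of_forall fun z => ?_)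
    simp only [smul_eq_mul]
    have e1 : ‖ε • z‖ ^ 2 + ε ^ 2 = ε ^ 2 * (1 + ‖z‖ ^ 2) := by
      rw [norm_smul, Real.norm_eq_abs, mul_pow, sq_abs]; ring
    rw [e1, Real.mul_rpow (by positivity) (by positivity), sq_rpow_half _ hε.le]
    have e2 : |(ε ^ Module.finrank ℝ 𝔼)⁻¹|⁻¹ * ε ^ 2 * ε ^ (-((N : ℝ) + 2)) = 1 := by
      rw [abs_of_pos (by positivity), inv_inv]
      simp only [finrank_euclideanSpace, Fintype.card_fin]
      rw [← pow_add, Real.rpow_neg hε.le, ← Real.rpow_natCast]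
      push_cast
      exact mul_inv_cancel₀ (by positivity)
    linear_combination (g (x - ε • z) * N * (1 + ‖z‖ ^ 2) ^ (-((N : ℝ) + 2) / 2)) * e2
  have h3 : Tendsto (fun ε : ℝ => ∫ z : 𝔼, g (x - ε • z) * (N * (1 + ‖z‖ ^ 2) ^ (-((N : ℝ) + 2) / 2))) (𝓝[>] 0)
      (𝓝 (∫ z : 𝔼, g x * (N * (1 + ‖z‖ ^ 2) ^ (-((N : ℝ) + 2) / 2)))) := by
    refine tendsto_integral_filter_of_dominated_convergence
      (fun z => B * (N * (1 + ‖z‖ ^ 2) ^ (-((N : ℝ) + 2) / 2))) ?_ ?_ ?_ ?_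
    · refine Eventually.of_forall fun ε => Measurable.aestronglyMeasurable ?_
      have := hg.measurable
      fun_prop
    · refine Eventually.of_forall fun ε => Eventually.of_forall fun z => ?_
      rw [norm_mul, Real.norm_of_nonneg (show 0 ≤ N * (1 + ‖z‖ ^ 2) ^ (-((N : ℝ) + 2) / 2) by positivity)]
      gcongr
      exact hB _
    · exact (kp_int.const_mul _).const_mul _
    · refine Eventually.of_forall fun z => Tendsto.mul_const _ ?_
      have : Continuous fun ε : ℝ => g (x - ε • z) := by fun_prop
      have := this.tendsto 0
      simp only [zero_smul, sub_zero] at this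
      exact this.mono_left nhdsWithin_le_nhds
  have e4 : ∫ z : 𝔼, g x * (N * (1 + ‖z‖ ^ 2) ^ (-((N : ℝ) + 2) / 2)) = kp N * g x := by
    rw [integral_const_mul, integral_const_mul, kp]; ring
  rw [e4] at h3
  refine h3.congr' ?_
  filter_upwards [self_mem_nhdsWithin] with ε hε
  exact (key ε hε).symm

lemma sum_single (z : 𝔼) : z = ∑ i, z i • EuclideanSpace.single i (1:ℝ) := by
  conv_lhs => rw [← (EuclideanSpace.basisFun (Fin N) ℝ).sum_repr z]
  simp

lemma fderiv_sum_single {f : 𝔼 →L[ℝ] ℝ} (z : 𝔼) : f z = ∑ i, f (EuclideanSpace.single i 1) * z i := by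
  conv_lhs => rw [sum_single z, map_sum]
  refine Finset.sum_congr rfl fun i _ => ?_
  rw [map_smul, smul_eq_mul, mul_comm]

lemma rep_eps {g : 𝔼 → ℝ} {K : ℝ≥0} (hg : LipschitzWith K g) (hc : HasCompactSupport g) (x : 𝔼)
    {e : ℝ} (he : 0 < e) :
    ∫ y, fderiv ℝ g y (kk e (x - y)) = ∫ y, g y * (N * e * (‖x - y‖ ^ 2 + e) ^ (-((N : ℝ) + 2) / 2)) := by
  set F : Fin N → 𝔼 → ℝ := fun i y => (‖x - y‖ ^ 2 + e) ^ (-(N : ℝ) / 2) * (x i - y i) with hF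
  have hpos : ∀ y : 𝔼, 0 < ‖x - y‖ ^ 2 + e := fun y => by positivity
  have hFc : ∀ i, ContDiff ℝ 1 (F i) := by
    intro i
    have h1 : ContDiff ℝ 1 (fun y : 𝔼 => ‖x - y‖ ^ 2 + e) :=
      ((contDiff_const.sub contDiff_id).norm_sq ℝ).add contDiff_const
    have h2 : ContDiff ℝ 1 (fun y : 𝔼 => y i) := (prj i).contDiff
    exact (h1.rpow_const_of_ne fun y => (hpos y).ne').mul (contDiff_const.sub h2)
  have hFd : ∀ i y, fderiv ℝ (F i) y (EuclideanSpace.single i 1) =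
      N * (‖x - y‖ ^ 2 + e) ^ (-((N : ℝ) + 2) / 2) * (x i - y i) ^ 2 - (‖x - y‖ ^ 2 + e) ^ (-(N : ℝ) / 2) := by
    intro i y
    have h1 := (QF_hasFDerivAt 1 (‖x‖ ^ 2 + e) x y)
    have hq : QF 1 (‖x‖ ^ 2 + e) x = fun y => ‖x - y‖ ^ 2 + e := by
      funext y; rw [QF, norm_sub_sq_real, real_inner_comm]; ring
    rw [hq] at h1
    have h2 := h1.rpow_const (p := -(N:ℝ)/2) (Or.inl (hpos y).ne')
    have h3 : HasFDerivAt (fun y : 𝔼 => x i - y i) (-(prj i)) y := ((prj i).hasFDerivAt (x := y)).const_sub _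
    have h4 := h2.mul h3
    have h5 : fderiv ℝ (F i) y = _ := h4.fderiv
    rw [h5]
    simp only [ContinuousLinearMap.add_apply, ContinuousLinearMap.smul_apply, ContinuousLinearMap.neg_apply, QL_single, smul_eq_mul]
    have : (prj i : 𝔼 →L[ℝ] ℝ) (EuclideanSpace.single i 1) = 1 := by simp [prj]
    rw [this, show -(N:ℝ)/2 - 1 = -((N : ℝ) + 2) / 2 by ring]
    ring
  have hwd : ∀ y, y ∉ tsupport g → fderiv ℝ g y = 0 := fun x hxw => by
    by_contra h
    exact hxw (support_fderiv_subset ℝ h)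
  have hI1 : ∀ i, Integrable (fun y => fderiv ℝ g y (EuclideanSpace.single i 1) * F i y) := by
    intro i
    rw [← integrableOn_iff_integrable_of_support_subset (s := tsupport g)]
    · refine Integrable.bdd_mul (c := K * ‖(EuclideanSpace.single i (1:ℝ) : 𝔼)‖) ((hFc i).continuous.continuousOn.integrableOn_compact hc) ?_ ?_
      · exact (measurable_fderiv_apply_const ℝ g _).aestronglyMeasurable
      · refine Eventually.of_forall fun x => ?_
        exact ((fderiv ℝ g x).le_opNorm _).trans (mul_le_mul_of_nonneg_right (norm_fderiv_le_of_lipschitz ℝ hg) (norm_nonneg _))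
    · intro y hy; by_contra h; exact hy (by simp [hwd y h])
  have hI2 : ∀ i, Integrable (fun y => g y * fderiv ℝ (F i) y (EuclideanSpace.single i 1)) := by
    intro i
    refine Continuous.integrable_of_hasCompactSupport ?_ hc.mul_right
    exact hg.continuous.mul (((hFc i).continuous_fderiv one_ne_zero).clm_apply continuous_const)
  have e1 : ∀ y, fderiv ℝ g y (kk e (x - y)) = ∑ i, fderiv ℝ g y (EuclideanSpace.single i 1) * F i y := by
    intro y
    rw [fderiv_sum_single]
    refine Finset.sum_congr rfl fun i _ => ?_
    simp [kk, hF]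
  simp_rw [e1]
  rw [integral_finset_sum _ fun i _ => hI1 i]
  simp_rw [fun i => ibp1 hg hc isOpen_univ (Set.subset_univ _) (hFc i).contDiffOn (EuclideanSpace.single i 1)]
  rw [Finset.sum_neg_distrib, ← integral_finset_sum _ fun i _ => hI2 i, ← integral_neg]
  refine integral_congr_ae (Eventually.of_forall fun y => ?_)
  simp only [hFd]
  rw [← Finset.mul_sum, Finset.sum_sub_distrib, ← Finset.mul_sum]
  have n1 : ∑ i, (x i - y i) ^ 2 = ‖x - y‖ ^ 2 := by simp [EuclideanSpace.norm_sq_eq]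
  rw [n1]
  simp only [Finset.sum_const, Finset.card_univ, Fintype.card_fin, nsmul_eq_mul]
  have : (‖x - y‖ ^ 2 + e) ^ (-(N : ℝ) / 2) = (‖x - y‖ ^ 2 + e) ^ (-((N : ℝ) + 2) / 2) * (‖x - y‖ ^ 2 + e) := by
    rw [← Real.rpow_add_one (hpos y).ne']; congr 1; ring
  rw [this]; ring

lemma lip_kk_le {g : 𝔼 → ℝ} {K : ℝ≥0} (hg : LipschitzWith K g) (x y : 𝔼) {e : ℝ} (he : 0 ≤ e) :
    ‖fderiv ℝ g y (kk e (x - y))‖ ≤ (tsupport g).indicator (fun y => K * ‖x - y‖ ^ (-((N : ℝ) - 1))) y := by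
  by_cases h : y ∈ tsupport g
  · rw [Set.indicator_of_mem h]
    refine ((fderiv ℝ g y).le_opNorm _).trans ?_
    exact mul_le_mul (norm_fderiv_le_of_lipschitz ℝ hg) (kk_norm_le he _) (norm_nonneg _) (by positivity)
  · rw [Set.indicator_of_notMem h]
    have : fderiv ℝ g y = 0 := by
      by_contra h'
      exact h (support_fderiv_subset ℝ h')
    simp [this]

lemma fderiv_kk_meas (g : 𝔼 → ℝ) (e : ℝ) (x : 𝔼) : Measurable (fun y => fderiv ℝ g y (kk e (x - y))) := by
  have h2 : Measurable (fun y : 𝔼 => kk e (x - y)) := (kk_meas e).comp (measurable_const.sub measurable_id)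
  simp_rw [fun y => fderiv_sum_single (f := fderiv ℝ g y) (kk e (x - y))]
  refine Finset.measurable_fun_sum _ fun i _ => (measurable_fderiv_apply_const ℝ g _).mul ?_
  exact (prj i).measurable.comp h2

lemma rep {g : 𝔼 → ℝ} {K : ℝ≥0} (hN : 1 ≤ N) (hg : LipschitzWith K g) (hc : HasCompactSupport g) (x : 𝔼) :
    ∫ y, fderiv ℝ g y (kk 0 (x - y)) = kp N * g x := by
  have h1 := eta_approx hg.continuous hc x
  have h2 : Tendsto (fun ε : ℝ => ∫ y, fderiv ℝ g y (kk (ε ^ 2) (x - y))) (𝓝[>] 0)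
      (𝓝 (∫ y, fderiv ℝ g y (kk 0 (x - y)))) := by
    refine tendsto_integral_filter_of_dominated_convergence
      ((tsupport g).indicator (fun y => K * ‖x - y‖ ^ (-((N : ℝ) - 1)))) ?_ ?_ ?_ ?_
    · exact Eventually.of_forall fun ε => (fderiv_kk_meas g _ x).aestronglyMeasurable
    · refine Eventually.of_forall fun ε => Eventually.of_forall fun y => lip_kk_le hg x y (sq_nonneg ε)
    · rw [integrable_indicator_iff (isClosed_tsupport g).measurableSet]
      exact (ker_int_bdd hN (by linarith) x hc.isBounded).const_mul _
    · refine Eventually.of_forall fun y => ?_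
      exact ((fderiv ℝ g y).continuous.tendsto _).comp (kk_tendsto _)
  refine tendsto_nhds_unique h2 (h1.congr' ?_)
  filter_upwards [self_mem_nhdsWithin] with ε hε
  have : 0 < ε := hε
  exact (rep_eps hg hc x (by positivity)).symm

end M3

section M4
variable {N : ℕ}
local notation "𝔼" => EuclideanSpace ℝ (Fin N)

/-- Newton potential -/
def newt (g : 𝔼 → ℝ) (x : 𝔼) : ℝ := ∫ y, g y * ‖x - y‖ ^ (-((N : ℝ) - 2))

lemma kk_norm_le' (hN : 1 ≤ N) {e : ℝ} (he : 0 < e) (z : 𝔼) : ‖kk e z‖ ≤ e ^ ((1 - (N : ℝ)) / 2) := by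
  unfold kk
  have hN' : (1:ℝ) ≤ N := by exact_mod_cast hN
  rw [norm_smul, Real.norm_eq_abs, abs_of_nonneg (by positivity)]
  have h1 : ‖z‖ ≤ (‖z‖ ^ 2 + e) ^ ((1:ℝ) / 2) := by
    rw [← Real.sqrt_eq_rpow]; exact Real.le_sqrt_of_sq_le (by linarith)
  calc _ ≤ (‖z‖ ^ 2 + e) ^ (-(N : ℝ) / 2) * (‖z‖ ^ 2 + e) ^ ((1:ℝ) / 2) := by gcongr
    _ = (‖z‖ ^ 2 + e) ^ ((1 - (N : ℝ)) / 2) := by rw [← Real.rpow_add (by positivity)]; congr 1; ring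
    _ ≤ _ := Real.rpow_le_rpow_of_nonpos he (by nlinarith [sq_nonneg ‖z‖]) (by linarith)

lemma pw_hasFDerivAt {e : ℝ} (he : 0 < e) (y x : 𝔼) :
    HasFDerivAt (fun x => (‖x - y‖ ^ 2 + e) ^ (-((N : ℝ) - 2) / 2))
      ((-((N : ℝ) - 2)) • innerSL ℝ (kk e (x - y))) x := by
  have h1 : HasFDerivAt (fun x : 𝔼 => ‖x - y‖ ^ 2 + e) (2 • innerSL ℝ (x - y)) x := by
    have := (hasStrictFDerivAt_norm_sq (x - y)).hasFDerivAt.comp x ((hasFDerivAt_id x).sub_const y)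
    exact this.add_const e
  have h2 := h1.rpow_const (p := -((N : ℝ) - 2) / 2) (Or.inl (by positivity))
  refine h2.congr_fderiv ?_
  ext w
  simp only [kk, ContinuousLinearMap.smul_apply, innerSL_apply_apply, smul_eq_mul, inner_smul_left, nsmul_eq_mul]
  rw [show -((N : ℝ) - 2) / 2 - 1 = -(N:ℝ) / 2 by ring]
  simp; ring

lemma innerSL_kk_meas (e : ℝ) (x : 𝔼) : Measurable (fun y : 𝔼 => innerSL ℝ (kk e (x - y))) :=
  (innerSL ℝ).continuous.measurable.comp ((kk_meas e).comp (measurable_const.sub measurable_id))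

/-- standing hypotheses for densities -/
structure Dens (g : 𝔼 → ℝ) (B ρ : ℝ) : Prop where
  meas : Measurable g
  bd : ∀ y, |g y| ≤ B
  supp : ∀ y, ρ ≤ ‖y‖ → g y = 0

lemma Dens.nonneg {g : 𝔼 → ℝ} {B ρ : ℝ} (h : Dens g B ρ) : 0 ≤ B := (abs_nonneg _).trans (h.bd 0)

lemma Dens.le_ind {g : 𝔼 → ℝ} {B ρ : ℝ} (h : Dens g B ρ) (y : 𝔼) : |g y| ≤ (Metric.ball (0:𝔼) ρ).indicator (fun _ => B) y := by
  by_cases hy : y ∈ Metric.ball (0:𝔼) ρ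
  · rw [Set.indicator_of_mem hy]; exact h.bd y
  · rw [Set.indicator_of_notMem hy, h.supp y (by simpa using hy)]; simp

lemma Dens.int_mul {g : 𝔼 → ℝ} {B ρ : ℝ} (h : Dens g B ρ) {F : Type*} [NormedAddCommGroup F] [NormedSpace ℝ F]
    {f : 𝔼 → F} (hf : IntegrableOn f (Metric.ball 0 ρ)) : Integrable (fun y => g y • f y) := by
  rw [← integrableOn_iff_integrable_of_support_subset (s := Metric.ball 0 ρ)]
  · exact Integrable.bdd_smul (C := B) hf h.meas.aestronglyMeasurable (Eventually.of_forall h.bd)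
  · intro y hy
    by_contra hh
    exact hy (by simp only [h.supp y (by simpa using hh), zero_smul])

lemma kk_int (hN : 1 ≤ N) {e : ℝ} (he : 0 ≤ e) (x : 𝔼) {S : Set 𝔼} (hS : Bornology.IsBounded S) :
    IntegrableOn (fun y => innerSL ℝ (kk e (x - y))) S := by
  refine Integrable.mono' (ker_int_bdd hN (a := (N:ℝ) - 1) (by linarith) x hS)
    (innerSL_kk_meas e x).aestronglyMeasurable (Eventually.of_forall fun y => ?_)
  rw [innerSL_apply_norm]; exact kk_norm_le he _

lemma kk_int' (hN : 1 ≤ N) {e : ℝ} (he : 0 ≤ e) (x : 𝔼) {S : Set 𝔼} (hS : Bornology.IsBounded S) {c : ℝ} :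
    IntegrableOn (fun y => c • innerSL ℝ (kk e (x - y))) S :=
  Integrable.smul c (kk_int hN he x hS)

lemma kk_diff_tendsto (hN : 1 ≤ N) (r : ℝ) :
    Tendsto (fun n : ℕ => ∫ z in Metric.ball (0 : 𝔼) r, ‖kk ((1 / ((n:ℝ) + 1)) ^ 2) z - kk 0 z‖) atTop (𝓝 0) := by
  have : Tendsto (fun n : ℕ => ∫ z in Metric.ball (0 : 𝔼) r, ‖kk ((1 / ((n:ℝ) + 1)) ^ 2) z - kk 0 z‖) atTop
      (𝓝 (∫ z in Metric.ball (0 : 𝔼) r, (0 : ℝ))) := by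
    refine tendsto_integral_of_dominated_convergence (fun z => 2 * ‖z‖ ^ (-((N:ℝ) - 1))) ?_ ?_ ?_ ?_
    · exact fun n => ((kk_meas _).sub (kk_meas _)).norm.aestronglyMeasurable
    · exact (ker_int0 hN (by linarith) r).const_mul 2
    · intro n
      refine Eventually.of_forall fun z => ?_
      rw [norm_norm]
      refine (norm_sub_le _ _).trans ?_
      linarith [kk_norm_le (sq_nonneg (1 / ((n:ℝ) + 1))) z, kk_norm_le le_rfl z]
    · refine Eventually.of_forall fun z => ?_
      have h1 : Tendsto (fun n : ℕ => 1 / ((n:ℝ) + 1)) atTop (𝓝[>] 0) := by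
        rw [tendsto_nhdsWithin_iff]
        exact ⟨tendsto_one_div_add_atTop_nhds_zero_nat, Eventually.of_forall fun n => by simp; positivity⟩
      have := ((kk_tendsto z).comp h1).sub_const (kk 0 z)
      simpa using this.norm
  simpa using this

lemma newt_C1 (hN : 3 ≤ N) {g : 𝔼 → ℝ} {B ρ : ℝ} (h : Dens g B ρ) :
    (∀ x, HasFDerivAt (newt g) (∫ y, g y • ((-((N : ℝ) - 2)) • innerSL ℝ (kk 0 (x - y)))) x) ∧
      ContDiff ℝ 1 (newt g) := by
  have hN1 : 1 ≤ N := by omega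
  have hN3 : (3:ℝ) ≤ N := by exact_mod_cast hN
  set e : ℕ → ℝ := fun n => (1 / ((n:ℝ) + 1)) ^ 2 with he
  have hepos : ∀ n, 0 < e n := fun n => by positivity
  set f : ℕ → 𝔼 → ℝ := fun n x => ∫ y, g y * (‖x - y‖ ^ 2 + e n) ^ (-((N : ℝ) - 2) / 2) with hf
  set f' : ℕ → 𝔼 → (𝔼 →L[ℝ] ℝ) := fun n x => ∫ y, g y • ((-((N : ℝ) - 2)) • innerSL ℝ (kk (e n) (x - y))) with hf'
  set F' : 𝔼 → (𝔼 →L[ℝ] ℝ) := fun x => ∫ y, g y • ((-((N : ℝ) - 2)) • innerSL ℝ (kk 0 (x - y))) with hF'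
  have hbint : ∀ c : ℝ, Integrable ((Metric.ball (0:𝔼) ρ).indicator (fun _ => c)) := by
    intro c
    rw [integrable_indicator_iff measurableSet_ball]
    exact integrableOn_const measure_ball_lt_top.ne
  have hfm : ∀ n x, AEStronglyMeasurable (fun y => g y * (‖x - y‖ ^ 2 + e n) ^ (-((N : ℝ) - 2) / 2)) (volume : Measure 𝔼) := by
    intro n x
    have := h.meas
    exact Measurable.aestronglyMeasurable (by fun_prop)
  have hpw : ∀ n, (∀ x, HasFDerivAt (f n) (f' n x) x) ∧ ContDiff ℝ 1 (f n) := by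
    intro n
    have := par_C1 (μ := (volume : Measure 𝔼)) (U := Set.univ) isOpen_univ
      (F := fun x y => g y * (‖x - y‖ ^ 2 + e n) ^ (-((N : ℝ) - 2) / 2))
      (F' := fun x y => g y • ((-((N : ℝ) - 2)) • innerSL ℝ (kk (e n) (x - y))))
      (b := (Metric.ball (0:𝔼) ρ).indicator (fun _ => B * (((N : ℝ) - 2) * e n ^ ((1 - (N : ℝ)) / 2))))
      (fun x _ => hfm n x)
      (fun x _ => h.meas.aestronglyMeasurable.fun_smul ((innerSL_kk_meas _ x).aestronglyMeasurable.fun_const_smul _))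
      ?_ ?_ (hbint _) ?_ ?_
    · exact ⟨fun x => this.1 x trivial, contDiffOn_univ.1 this.2⟩
    · intro x _
      refine Integrable.mono' (hbint (B * (e n) ^ (-((N : ℝ) - 2) / 2))) (hfm n x) (Eventually.of_forall fun y => ?_)
      by_cases hy : y ∈ Metric.ball (0:𝔼) ρ
      · rw [Set.indicator_of_mem hy, norm_mul, Real.norm_eq_abs, Real.norm_of_nonneg (by positivity)]
        have hB := h.nonneg
        refine mul_le_mul (h.bd y) ?_ (by positivity) hB
        exact Real.rpow_le_rpow_of_nonpos (hepos n) (by nlinarith [sq_nonneg ‖x - y‖]) (by linarith)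
      · rw [Set.indicator_of_notMem hy, h.supp y (by simpa using hy)]; simp
    · refine Eventually.of_forall fun y x _ => ?_
      by_cases hy : y ∈ Metric.ball (0:𝔼) ρ
      · rw [Set.indicator_of_mem hy, norm_smul, norm_smul, innerSL_apply_norm, norm_neg, Real.norm_eq_abs, Real.norm_of_nonneg (show (0:ℝ) ≤ N - 2 by linarith)]
        have hB := h.nonneg
        refine mul_le_mul (h.bd y) ?_ (by have : (0:ℝ) ≤ N - 2 := by linarith
                                          positivity) hB
        refine mul_le_mul_of_nonneg_left (kk_norm_le' hN1 (hepos n) _) (by linarith)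
      · rw [Set.indicator_of_notMem hy, h.supp y (by simpa using hy)]; simp
    · refine Eventually.of_forall fun y x _ => ?_
      exact (pw_hasFDerivAt (hepos n) y x).const_mul (g y)
    · refine Eventually.of_forall fun y => Continuous.continuousOn ?_
      have hk : Continuous (fun x : 𝔼 => kk (e n) (x - y)) := ?_
      · have h2 : Continuous (fun x : 𝔼 => innerSL ℝ (kk (e n) (x - y))) := (innerSL ℝ (E := 𝔼)).continuous.comp hk
        exact (h2.const_smul (-((N : ℝ) - 2))).const_smul (g y)
      unfold kk
      refine Continuous.smul (Continuous.rpow_const (by fun_prop) fun x => Or.inl ?_) (by fun_prop)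
      have := hepos n
      positivity
  have hunif : ∀ R : ℝ, TendstoUniformlyOn f' F' atTop (Metric.ball 0 R) := by
    intro R
    rw [Metric.tendstoUniformlyOn_iff]
    intro δ hδ
    have hB := h.nonneg
    have hC : 0 < B * ((N:ℝ) - 2) + 1 := by have : (0:ℝ) ≤ N - 2 := by linarith
                                            positivity
    have := (kk_diff_tendsto hN1 (N := N) (R + ρ)).eventually (gt_mem_nhds (show 0 < δ / (B * ((N:ℝ) - 2) + 1) by positivity))
    filter_upwards [this] with n hn x hx
    rw [dist_comm, dist_eq_norm]
    simp only [hf', hF']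
    rw [← integral_sub]
    rotate_left
    · exact h.int_mul (kk_int' hN1 (hepos n).le x Metric.isBounded_ball)
    · exact h.int_mul (kk_int' hN1 le_rfl x Metric.isBounded_ball)
    have hdi : IntegrableOn (fun z : 𝔼 => ‖kk (e n) z - kk 0 z‖) (Metric.ball 0 (R + ρ)) := by
      refine Integrable.mono' ((ker_int0 (N := N) hN1 (a := (N:ℝ) - 1) (by linarith) (R+ρ)).const_mul 2) ((kk_meas _).sub (kk_meas _)).norm.aestronglyMeasurable
        (Eventually.of_forall fun z => ?_)
      rw [norm_norm]
      refine (norm_sub_le _ _).trans ?_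
      linarith [kk_norm_le (hepos n).le z, kk_norm_le le_rfl z]
    have hdi' : IntegrableOn (fun y : 𝔼 => ‖kk (e n) (x - y) - kk 0 (x - y)‖) (Metric.ball x (R + ρ)) := by
      have := ((Measure.measurePreserving_sub_left (volume : Measure 𝔼) x).integrableOn_comp_preimage
        (MeasurableEquiv.subLeft x).measurableEmbedding).2 hdi
      rw [ball_pre] at this
      exact this
    have heq : ∫ y in Metric.ball x (R + ρ), ‖kk (e n) (x - y) - kk 0 (x - y)‖ = ∫ z in Metric.ball (0:𝔼) (R+ρ), ‖kk (e n) z - kk 0 z‖ := by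
      have := (Measure.measurePreserving_sub_left (volume : Measure 𝔼) x).setIntegral_preimage_emb
        (MeasurableEquiv.subLeft x).measurableEmbedding (fun z => ‖kk (e n) z - kk 0 z‖) (Metric.ball 0 (R + ρ))
      rw [ball_pre] at this
      exact this
    calc _ ≤ ∫ y, (Metric.ball x (R + ρ)).indicator (fun y => (B * ((N:ℝ) - 2)) * ‖kk (e n) (x - y) - kk 0 (x - y)‖) y := by
          refine norm_integral_le_of_norm_le ?_ (Eventually.of_forall fun y => ?_)
          · rw [integrable_indicator_iff measurableSet_ball]
            exact hdi'.const_mul _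
          · have hsub : g y • (-((N : ℝ) - 2)) • innerSL ℝ (kk (e n) (x - y)) - g y • (-((N : ℝ) - 2)) • innerSL ℝ (kk 0 (x - y))
                = g y • (-((N : ℝ) - 2)) • innerSL ℝ (kk (e n) (x - y) - kk 0 (x - y)) := by
              rw [map_sub]; ext w; simp; ring
            rw [hsub, norm_smul, norm_smul, innerSL_apply_norm, norm_neg, Real.norm_eq_abs, Real.norm_of_nonneg (show (0:ℝ) ≤ N - 2 by linarith)]
            by_cases hy : ρ ≤ ‖y‖
            · rw [h.supp y hy]
              simp only [abs_zero, zero_mul]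
              refine Set.indicator_nonneg (fun y _ => ?_) y
              have : (0:ℝ) ≤ N - 2 := by linarith
              positivity
            · rw [Set.indicator_of_mem, ← mul_assoc]
              · have := h.bd y
                have : (0:ℝ) ≤ N - 2 := by linarith
                gcongr
              · rw [Metric.mem_ball, dist_eq_norm]
                have : ‖x‖ < R := by simpa using hx
                refine (norm_sub_le _ _).trans_lt ?_
                push Not at hy
                linarith
      _ = (B * ((N:ℝ) - 2)) * ∫ z in Metric.ball (0:𝔼) (R+ρ), ‖kk (e n) z - kk 0 z‖ := by
          rw [integral_indicator measurableSet_ball, integral_const_mul, heq]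
      _ ≤ (B * ((N:ℝ) - 2) + 1) * ∫ z in Metric.ball (0:𝔼) (R+ρ), ‖kk (e n) z - kk 0 z‖ := by
          refine mul_le_mul_of_nonneg_right (by linarith) ?_
          exact integral_nonneg fun z => norm_nonneg _
      _ < δ := by
          rw [lt_div_iff₀ hC] at hn
          rw [mul_comm]; exact hn
  have hlim : ∀ x, Tendsto (fun n => f n x) atTop (𝓝 (newt g x)) := by
    intro x
    refine tendsto_integral_of_dominated_convergence (fun y => |g y| * ‖x - y‖ ^ (-((N : ℝ) - 2))) (fun n => hfm n x) ?_ ?_ ?_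
    · have := (h.int_mul (ker_int_bdd hN1 (a := (N:ℝ) - 2) (by linarith) x Metric.isBounded_ball)).norm
      refine this.congr (Eventually.of_forall fun y => ?_)
      simp only [smul_eq_mul, norm_mul, Real.norm_eq_abs]
      rw [abs_of_nonneg (a := ‖x - y‖ ^ (-((N : ℝ) - 2))) (by positivity)]
    · intro n
      have hae : ∀ᵐ y : 𝔼, y ≠ x := by
        have hnt : Nontrivial 𝔼 := by
          have : Nonempty (Fin N) := ⟨⟨0, by omega⟩⟩
          infer_instance
        exact compl_mem_ae_iff.2 (measure_singleton x)
      filter_upwards [hae] with y hy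
      have : 0 < ‖x - y‖ := norm_pos_iff.2 (sub_ne_zero.2 hy.symm)
      rw [norm_mul, Real.norm_eq_abs, Real.norm_of_nonneg (by have := hepos n; positivity)]
      refine mul_le_mul_of_nonneg_left ?_ (abs_nonneg _)
      rw [← sq_rpow_half _ this.le]
      exact Real.rpow_le_rpow_of_nonpos (by positivity) (by linarith [hepos n]) (by linarith)
    · have hae : ∀ᵐ y : 𝔼, y ≠ x := by
        have hnt : Nontrivial 𝔼 := by
          have : Nonempty (Fin N) := ⟨⟨0, by omega⟩⟩
          infer_instance
        exact compl_mem_ae_iff.2 (measure_singleton x)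
      filter_upwards [hae] with y hy
      have : 0 < ‖x - y‖ := norm_pos_iff.2 (sub_ne_zero.2 hy.symm)
      refine Tendsto.const_mul _ ?_
      rw [← sq_rpow_half _ this.le]
      have h0 : Tendsto e atTop (𝓝 0) := by
        have := (tendsto_one_div_add_atTop_nhds_zero_nat (𝕜 := ℝ)).pow 2
        simpa [he] using this
      have h1 := (h0.const_add (‖x - y‖ ^ 2)).rpow_const (p := -((N : ℝ) - 2) / 2) (Or.inl (by positivity))
      simpa using h1
  have hD : ∀ x, HasFDerivAt (newt g) (F' x) x := by
    intro x
    have hx : x ∈ Metric.ball (0:𝔼) (‖x‖ + 1) := by simp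
    exact hasFDerivAt_of_tendstoUniformlyOn Metric.isOpen_ball (hunif _)
      (fun n x _ => (hpw n).1 x) (fun x _ => hlim x) hx
  refine ⟨hD, ?_⟩
  rw [contDiff_one_iff_fderiv]
  refine ⟨fun x => (hD x).differentiableAt, ?_⟩
  have : fderiv ℝ (newt g) = F' := funext fun x => (hD x).fderiv
  rw [this]
  rw [continuous_iff_continuousAt]
  intro x
  have hx : x ∈ Metric.ball (0:𝔼) (‖x‖ + 1) := by simp
  refine ((hunif (‖x‖ + 1)).continuousOn ?_).continuousAt (Metric.isOpen_ball.mem_nhds hx)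
  refine (Eventually.of_forall fun n => ?_).frequently
  have : fderiv ℝ (f n) = f' n := funext fun x => ((hpw n).1 x).fderiv
  rw [← this]
  exact ((hpw n).2.continuous_fderiv one_ne_zero).continuousOn

lemma newt_C2 (hN : 3 ≤ N) {g : 𝔼 → ℝ} (hg : ContDiff ℝ 1 g) (hc : HasCompactSupport g) :
    ContDiff ℝ 2 (newt g) ∧ ∀ x, lapE (newt g) x = -(((N:ℝ) - 2) * kp N) * g x := by
  have hN1 : 1 ≤ N := by omega
  have hN3 : (3:ℝ) ≤ N := by exact_mod_cast hN
  obtain ⟨ρ, hρ0, hρ⟩ := hc.isBounded.exists_pos_norm_lt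
  obtain ⟨B, hB⟩ := hc.exists_bound_of_continuous hg.continuous
  have hd := hg.continuous_fderiv one_ne_zero
  have hsd : ∀ y, ρ ≤ ‖y‖ → fderiv ℝ g y = 0 := fun y hy => by
    by_contra h
    exact absurd (hρ y (support_fderiv_subset ℝ h)) (not_lt.2 hy)
  obtain ⟨B', hB'⟩ := (hc.fderiv ℝ).exists_bound_of_continuous hd
  have hB'0 : 0 ≤ B' := (norm_nonneg _).trans (hB' 0)
  have h0 : Dens g B ρ := ⟨hg.continuous.measurable, hB, fun y hy => by
    by_contra h; exact absurd (hρ y (subset_tsupport _ h)) (not_lt.2 hy)⟩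
  have h1 : ∀ i : Fin N, Dens (fun y => fderiv ℝ g y (EuclideanSpace.single i 1)) B' ρ := by
    intro i
    refine ⟨(hd.clm_apply continuous_const).measurable, fun y => ?_, fun y hy => by simp [hsd y hy]⟩
    have := (fderiv ℝ g y).le_opNorm (EuclideanSpace.single i 1)
    simp only [PiLp.norm_single, norm_one, mul_one] at this
    exact this.trans (hB' y)
  have hconv : ∀ f : 𝔼 → ℝ, newt f = fun x => ∫ z, f (x - z) * ‖z‖ ^ (-((N:ℝ) - 2)) := by
    intro f; funext x
    have := integral_sub_left_eq_self (fun z : 𝔼 => f (x - z) * ‖z‖ ^ (-((N:ℝ) - 2))) volume x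
    simp only [sub_sub_cancel] at this
    rw [← this]; rfl
  have hpart : ∀ x (i : Fin N), fderiv ℝ (newt g) x (EuclideanSpace.single i 1) =
      newt (fun y => fderiv ℝ g y (EuclideanSpace.single i 1)) x := by
    intro x i
    set R := ‖x‖ + 1 with hR
    have hmem : ∀ x' ∈ Metric.ball (0:𝔼) R, ∀ z, R + ρ ≤ ‖z‖ → ρ ≤ ‖x' - z‖ := by
      intro x' hx' z hz
      have h1 : ‖x'‖ < R := by simpa using hx'
      have := norm_sub_norm_le z x'
      rw [norm_sub_rev] at this
      linarith
    have hki := ker_int0 (N := N) hN1 (a := (N:ℝ) - 2) (by linarith) (R + ρ)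
    have hm : ∀ x', AEStronglyMeasurable (fun z : 𝔼 => g (x' - z) * ‖z‖ ^ (-((N:ℝ) - 2))) volume := by
      intro x'
      have := hg.continuous.measurable
      exact Measurable.aestronglyMeasurable (by fun_prop)
    have hm' : ∀ x', AEStronglyMeasurable (fun z : 𝔼 => (‖z‖ ^ (-((N:ℝ) - 2))) • fderiv ℝ g (x' - z)) volume := by
      intro x'
      exact (ker_meas _).aestronglyMeasurable.fun_smul (hd.comp (continuous_const.sub continuous_id)).aestronglyMeasurable
    have hbi : ∀ c : ℝ, Integrable ((Metric.ball (0:𝔼) (R + ρ)).indicator (fun z => c * ‖z‖ ^ (-((N:ℝ) - 2)))) := by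
      intro c
      rw [integrable_indicator_iff measurableSet_ball]
      exact hki.const_mul _
    have hb : ∀ z, ∀ x' ∈ Metric.ball (0:𝔼) R, ‖(‖z‖ ^ (-((N:ℝ) - 2))) • fderiv ℝ g (x' - z)‖ ≤
        (Metric.ball (0:𝔼) (R + ρ)).indicator (fun z => B' * ‖z‖ ^ (-((N:ℝ) - 2))) z := by
      intro z x' hx'
      by_cases hz : z ∈ Metric.ball (0:𝔼) (R + ρ)
      · rw [Set.indicator_of_mem hz, norm_smul, Real.norm_of_nonneg (by positivity), mul_comm]
        gcongr; exact hB' _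
      · rw [Set.indicator_of_notMem hz, hsd _ (hmem x' hx' z (by simpa using hz))]; simp
    have hpc := par_C1 (μ := (volume : Measure 𝔼)) (U := Metric.ball 0 R) Metric.isOpen_ball
      (F := fun x z => g (x - z) * ‖z‖ ^ (-((N:ℝ) - 2)))
      (F' := fun x z => (‖z‖ ^ (-((N:ℝ) - 2))) • fderiv ℝ g (x - z))
      (b := (Metric.ball (0:𝔼) (R + ρ)).indicator (fun z => B' * ‖z‖ ^ (-((N:ℝ) - 2))))
      (fun x' _ => hm x') (fun x' _ => hm' x') ?_ (Eventually.of_forall hb) (hbi _) ?_ ?_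
    · have hx : x ∈ Metric.ball (0:𝔼) R := by simp [hR]
      have := hpc.1 x hx
      rw [← hconv] at this
      rw [this.fderiv, ContinuousLinearMap.integral_apply, hconv]
      · refine integral_congr_ae (Eventually.of_forall fun z => ?_)
        simp [mul_comm]
      · exact Integrable.mono' (hbi B') (hm' x) (Eventually.of_forall fun z => hb z x hx)
    · intro x' hx'
      refine Integrable.mono' (hbi B) (hm x') (Eventually.of_forall fun z => ?_)
      by_cases hz : z ∈ Metric.ball (0:𝔼) (R + ρ)
      · rw [Set.indicator_of_mem hz, norm_mul, Real.norm_of_nonneg (r := ‖z‖ ^ (-((N:ℝ) - 2))) (by positivity)]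
        gcongr; exact hB _
      · rw [Set.indicator_of_notMem hz, h0.supp _ (hmem x' hx' z (by simpa using hz))]; simp
    · refine Eventually.of_forall fun z x' _ => ?_
      have hgd := (hg.differentiable one_ne_zero (x' - z)).hasFDerivAt
      have := hgd.comp x' ((hasFDerivAt_id x').sub_const z)
      exact (this.mul_const (‖z‖ ^ (-((N:ℝ) - 2))))
    · refine Eventually.of_forall fun z => Continuous.continuousOn ?_
      exact (hd.comp (continuous_id.sub continuous_const)).const_smul (‖z‖ ^ (-((N:ℝ) - 2)))
  have hv := newt_C1 hN h0
  constructor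
  · rw [show (2 : WithTop ℕ∞) = 1 + 1 from (one_add_one_eq_two).symm, contDiff_succ_iff_fderiv]
    refine ⟨fun x => (hv.1 x).differentiableAt, by simp, ?_⟩
    have : fderiv ℝ (newt g) = fun x => ∑ i, (newt (fun y => fderiv ℝ g y (EuclideanSpace.single i 1)) x) • (prj i : 𝔼 →L[ℝ] ℝ) := by
      funext x
      ext z
      rw [fderiv_sum_single]
      simp only [ContinuousLinearMap.sum_apply, ContinuousLinearMap.smul_apply, smul_eq_mul]
      exact Finset.sum_congr rfl fun i _ => by rw [hpart]; rfl
    rw [this]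
    exact ContDiff.sum fun i _ => (newt_C1 hN (h1 i)).2.smul contDiff_const
  · intro x
    unfold lapE
    have : ∀ i : Fin N, (fun y => fderiv ℝ (newt g) y (EuclideanSpace.single i 1)) = newt (fun y => fderiv ℝ g y (EuclideanSpace.single i 1)) :=
      fun i => funext fun y => hpart y i
    simp_rw [this, fun i => ((newt_C1 hN (h1 i)).1 x).fderiv]
    obtain ⟨K, hK⟩ := ContDiff.lipschitzWith_of_hasCompactSupport hc hg one_ne_zero
    have hrep := rep hN1 hK hc x
    have hIntg : ∀ i : Fin N, Integrable (fun y => fderiv ℝ g y (EuclideanSpace.single i 1) • ((-((N : ℝ) - 2)) • innerSL ℝ (kk 0 (x - y)))) :=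
      fun i => (h1 i).int_mul (kk_int' hN1 le_rfl x Metric.isBounded_ball)
    simp_rw [fun i => ContinuousLinearMap.integral_apply (hIntg i) (EuclideanSpace.single i 1)]
    rw [← integral_finset_sum _ fun i _ => (hIntg i).apply_continuousLinearMap _]
    rw [show -(((N:ℝ) - 2) * kp N) * g x = -((N:ℝ) - 2) * (kp N * g x) by ring, ← hrep, ← integral_const_mul]
    refine integral_congr_ae (Eventually.of_forall fun y => ?_)
    simp only
    rw [fderiv_sum_single, Finset.mul_sum]
    refine Finset.sum_congr rfl fun i _ => ?_
    simp [EuclideanSpace.inner_single_right]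
    ring

end M4

section M5
variable {N : ℕ}
local notation "𝔼" => EuclideanSpace ℝ (Fin N)

/-- quadratic coefficient of the image charge -/
def gal (t R : ℝ) (j : Bool × ℤ) (y : 𝔼) : ℝ := if j.1 then t ^ (-2 * j.2) else t ^ (2 * j.2) * ‖y‖ ^ 2 / R ^ 2
/-- constant coefficient of the image charge -/
def gbe (t R : ℝ) (j : Bool × ℤ) (y : 𝔼) : ℝ := if j.1 then t ^ (2 * j.2) * ‖y‖ ^ 2 else R ^ 2 * t ^ (-2 * j.2)
/-- quadratic form of the image charge -/
def gq (t R : ℝ) (j : Bool × ℤ) (y x : 𝔼) : ℝ := QF (gal t R j y) (gbe t R j y) y x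
/-- sign of the image charge -/
def sg (j : Bool × ℤ) : ℝ := if j.1 then 1 else -1

lemma sg_abs (j : Bool × ℤ) : |sg j| = 1 := by unfold sg; split_ifs <;> simp

lemma gal_nonneg {t R : ℝ} (ht : 1 < t) (j : Bool × ℤ) (y : 𝔼) : 0 ≤ gal t R j y := by
  have : 0 < t := by linarith
  unfold gal; split_ifs <;> positivity

lemma gal_mul_gbe {t R : ℝ} (ht : 1 < t) (hR : 0 < R) (j : Bool × ℤ) (y : 𝔼) :
    gal t R j y * gbe t R j y = ‖y‖ ^ 2 := by
  have h0 : t ≠ 0 := by linarith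
  unfold gal gbe
  have : t ^ (-2 * j.2) * t ^ (2 * j.2) = 1 := by
    rw [← zpow_add₀ h0]; simp
  split_ifs
  · linear_combination ‖y‖ ^ 2 * this
  · field_simp
    linear_combination ‖y‖ ^ 2 * this

lemma QF_ge {a b : ℝ} (ha : 0 ≤ a) (hb : 0 ≤ b) {y : 𝔼} (hab : a * b = ‖y‖) (x : 𝔼) :
    (a * ‖x‖ - b) ^ 2 ≤ QF (a ^ 2) (b ^ 2) y x := by
  unfold QF
  have := real_inner_le_norm x y
  have h2 : (a * ‖x‖ - b) ^ 2 = a ^ 2 * ‖x‖ ^ 2 - 2 * (‖x‖ * ‖y‖) + b ^ 2 := by rw [← hab]; ring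
  rw [h2]; linarith

lemma gq_true_ge {t R : ℝ} (ht : 1 < t) (k : ℤ) (y x : 𝔼) :
    (t ^ (-k) * ‖x‖ - t ^ k * ‖y‖) ^ 2 ≤ gq t R (true, k) y x := by
  have h0 : 0 < t := by linarith
  have := QF_ge (a := t ^ (-k)) (b := t ^ k * ‖y‖) (by positivity) (by positivity) (y := y)
    (by rw [← mul_assoc, ← zpow_add₀ h0.ne']; simp) x
  refine this.trans (le_of_eq ?_)
  unfold gq gal gbe
  simp only [if_true]
  congr 1
  · rw [← zpow_natCast, ← zpow_mul]; congr 1; push_cast; ring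
  · rw [mul_pow, ← zpow_natCast, ← zpow_mul]; congr 2; push_cast; ring

lemma gq_false_ge {t R : ℝ} (ht : 1 < t) (hR : 0 < R) (k : ℤ) (y x : 𝔼) :
    (t ^ k * ‖y‖ / R * ‖x‖ - R * t ^ (-k)) ^ 2 ≤ gq t R (false, k) y x := by
  have h0 : 0 < t := by linarith
  have := QF_ge (a := t ^ k * ‖y‖ / R) (b := R * t ^ (-k)) (by positivity) (by positivity) (y := y)
    (by
      have : t ^ k * t ^ (-k) = 1 := by rw [← zpow_add₀ h0.ne']; simp
      field_simp
      linear_combination ‖y‖ * this) x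
  refine this.trans (le_of_eq ?_)
  unfold gq gal gbe
  simp only [Bool.false_eq_true, if_false]
  congr 1
  · rw [div_pow, mul_pow, ← zpow_natCast, ← zpow_mul]; congr 3; push_cast; ring
  · rw [mul_pow, ← zpow_natCast (t ^ (-k)), ← zpow_mul]; congr 2; push_cast; ring

/-- the three singular indices -/
def S1 : Finset (Bool × ℤ) := {(true, 0), (false, 0), (false, -1)}

/-- neighbourhood of the closed annulus -/
def Unb (N : ℕ) (t R : ℝ) : Set (EuclideanSpace ℝ (Fin N)) := {x | R / √t < ‖x‖ ∧ ‖x‖ < √t * (t * R)}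

lemma Unb_open (t R : ℝ) : IsOpen (Unb N t R) :=
  (isOpen_lt continuous_const continuous_norm).inter (isOpen_lt continuous_norm continuous_const)

lemma sqrt_facts {t : ℝ} (ht : 1 < t) : 1 < √t ∧ √t * √t = t := by
  refine ⟨?_, Real.mul_self_sqrt (by linarith)⟩
  rw [show (1:ℝ) = √1 by simp]; exact Real.sqrt_lt_sqrt (by norm_num) ht

lemma low1 {t R : ℝ} (ht : 1 < t) (hR : 0 < R) : ∃ c0 : ℝ, 0 < c0 ∧ ∀ j ∉ S1, ∀ x ∈ Unb N t R,
    ∀ y ∈ DSet N R (t * R), c0 * t ^ (2 * j.2.natAbs) ≤ gq t R j y x := by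
  obtain ⟨hs, hst⟩ := sqrt_facts ht
  set σ := √t with hσ
  have hs0 : 0 < σ := by linarith
  have h0 : 0 < t := by linarith
  set c := R / σ * (1 - 1 / σ) with hc
  have hc1 : 0 < 1 - 1 / σ := by rw [sub_pos, div_lt_one hs0]; exact hs
  have hcpos : 0 < c := by positivity
  refine ⟨c ^ 2, by positivity, ?_⟩
  have key : ∀ (m : ℕ) (X q : ℝ), c * t ^ m ≤ X → X ^ 2 ≤ q → c ^ 2 * t ^ (2 * m) ≤ q := by
    intro m X q h1 h2
    refine le_trans ?_ h2
    rw [mul_comm 2 m, pow_mul, ← mul_pow]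
    exact pow_le_pow_left₀ (by positivity) h1 2
  have hRs : R / σ ≤ R := div_le_self hR.le hs.le
  rintro ⟨b, k⟩ hj x ⟨hx1, hx2⟩ y ⟨hy1, hy2⟩
  simp only
  have fin1 : ∀ (m : ℕ), 1 ≤ m → R / σ * t ^ m - t ^ (-(m:ℤ)) * (t * R) ≥ c * t ^ m := by
    intro m hm
    have e1 : t ^ (-(m:ℤ)) * t ^ m = 1 := by rw [zpow_neg, zpow_natCast]; field_simp
    have e2 : t ≤ t ^ m := le_self_pow₀ ht.le (by omega)
    have e3 : t ^ (-(m:ℤ)) * t ≤ 1 := by rw [← e1]; gcongr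
    have e4 : t ^ m * R / σ / σ ≥ R := by
      rw [ge_iff_le, le_div_iff₀ hs0, le_div_iff₀ hs0]
      nlinarith
    have : c * t ^ m = R / σ * t ^ m - t ^ m * R / σ / σ := by rw [hc]; field_simp
    rw [this]
    nlinarith
  rcases Int.natAbs_eq k with hk | hk
  · set m := k.natAbs with hm
    cases b
    · -- false, k = m ≥ 1
      have hm1 : 1 ≤ m := by
        by_contra h
        have : m = 0 := by omega
        apply hj; rw [hk, this]; simp [S1]
      refine key m _ _ ?_ (gq_false_ge ht hR k y x)
      rw [hk, zpow_natCast]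
      have e1 : t ^ m * ‖y‖ / R * ‖x‖ ≥ R / σ * t ^ m := by
        have : ‖y‖ / R ≥ 1 := by rw [ge_iff_le, le_div_iff₀ hR]; linarith
        calc R / σ * t ^ m = t ^ m * 1 * (R / σ) := by ring
          _ ≤ t ^ m * (‖y‖ / R) * ‖x‖ := by gcongr
          _ = _ := by ring
      have e2 := fin1 m hm1
      have e3 : R * t ^ (-(m:ℤ)) ≤ t ^ (-(m:ℤ)) * (t * R) := by
        have : 0 < t ^ (-(m:ℤ)) * R := by positivity
        nlinarith
      linarith
    · -- true, k = m ≥ 1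
      have hm1 : 1 ≤ m := by
        by_contra h
        have : m = 0 := by omega
        apply hj; rw [hk, this]; simp [S1]
      refine key m (t ^ k * ‖y‖ - t ^ (-k) * ‖x‖) _ ?_ ((le_of_eq (by ring)).trans (gq_true_ge ht k y x))
      rw [hk, zpow_natCast]
      have e1 : t ^ m * ‖y‖ ≥ t ^ m * R := by gcongr
      have e2 : t ^ (-(m:ℤ)) * ‖x‖ ≤ t ^ (-(m:ℤ)) * (σ * (t * R)) := by gcongr
      have e3 := fin1 m hm1
      have e4 : σ * (R / σ * t ^ m) = R * t ^ m := by field_simp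
      have e5 : c * t ^ m ≤ σ * (c * t ^ m) := by
        have : 0 < c * t ^ m := by positivity
        nlinarith
      nlinarith
  · set m := k.natAbs with hm
    cases b
    · -- false, k = -m, m ≥ 2
      have hm1 : 2 ≤ m := by
        by_contra h
        have : m = 0 ∨ m = 1 := by omega
        rcases this with h | h
        · apply hj; rw [hk, h]; simp [S1]
        · apply hj; rw [hk, h]; simp [S1]
      refine key m (R * t ^ (-k) - t ^ k * ‖y‖ / R * ‖x‖) _ ?_ ((le_of_eq (by ring)).trans (gq_false_ge ht hR k y x))
      rw [hk, neg_neg, zpow_natCast]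
      have e1 : t ^ (-(m:ℤ)) * ‖y‖ / R * ‖x‖ ≤ t ^ (-(m:ℤ)) * (t * R) / R * (σ * (t * R)) := by gcongr
      have e2 : t ^ (-(m:ℤ)) * (t * R) / R * (σ * (t * R)) = t ^ (-(m:ℤ)) * t ^ 2 * (σ * R) := by field_simp
      have e3 : t ^ (-(m:ℤ)) * t ^ 2 ≤ 1 := by
        have e1 : t ^ (-(m:ℤ)) * t ^ m = 1 := by rw [zpow_neg, zpow_natCast]; field_simp
        rw [← e1]; gcongr
        · exact ht.le
      have e4 : σ * R ≤ R * t ^ m / σ := by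
        rw [le_div_iff₀ hs0]
        have : t ≤ t ^ m := le_self_pow₀ ht.le (by omega)
        nlinarith
      have e5 : c * t ^ m ≤ R * t ^ m - R * t ^ m / σ := by
        have : c * t ^ m = (R * t ^ m - R * t ^ m / σ) / σ := by rw [hc]; field_simp
        rw [this]
        refine div_le_self ?_ hs.le
        have : R * t ^ m / σ ≤ R * t ^ m := div_le_self (by positivity) hs.le
        linarith
      have e6 : t ^ (-(m:ℤ)) * t ^ 2 * (σ * R) ≤ 1 * (σ * R) := by gcongr
      linarith
    · -- true, k = -m
      have hm1 : 1 ≤ m := by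
        by_contra h
        have : m = 0 := by omega
        apply hj; rw [hk, this]; simp [S1]
      refine key m _ _ ?_ (gq_true_ge ht k y x)
      rw [hk, neg_neg, zpow_natCast]
      have e1 : t ^ m * ‖x‖ ≥ t ^ m * (R / σ) := by gcongr
      have e2 : t ^ (-(m:ℤ)) * ‖y‖ ≤ t ^ (-(m:ℤ)) * (t * R) := by gcongr
      have e3 := fin1 m hm1
      linarith

lemma low2 {t R : ℝ} (ht : 1 < t) (hR : 0 < R) {δ : ℝ} (hδ : 0 < δ) : ∃ c0 : ℝ, 0 < c0 ∧
    ∀ j ∉ ({(true, 0)} : Finset (Bool × ℤ)), ∀ x ∈ Unb N t R,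
    ∀ y ∈ DSet N R (t * R), R ^ 2 * (1 + δ) ≤ ‖x‖ * ‖y‖ → ‖x‖ * ‖y‖ ≤ (t * R) ^ 2 * (1 - δ) →
      c0 * t ^ (2 * j.2.natAbs) ≤ gq t R j y x := by
  have h0 : 0 < t := by linarith
  obtain ⟨c0, hc0, H⟩ := low1 (N := N) ht hR
  refine ⟨min c0 ((R * δ) ^ 2), by positivity, ?_⟩
  intro j hj x hx y hy h1 h2
  by_cases hj1 : j ∈ S1
  · simp only [Finset.mem_singleton] at hj
    simp only [S1, Finset.mem_insert, Finset.mem_singleton] at hj1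
    rcases hj1 with h | h | h
    · exact absurd h hj
    · subst h
      simp only [Int.natAbs_zero, mul_zero, pow_zero, mul_one]
      refine (min_le_right _ _).trans (le_trans ?_ (gq_false_ge ht hR 0 y x))
      simp only [zpow_zero, neg_zero, mul_one, one_mul]
      refine pow_le_pow_left₀ (by positivity) ?_ 2
      have : ‖y‖ / R * ‖x‖ - R - R * δ = (‖x‖ * ‖y‖ - R ^ 2 * (1 + δ)) / R := by field_simp; ring
      have h3 : 0 ≤ (‖x‖ * ‖y‖ - R ^ 2 * (1 + δ)) / R := div_nonneg (by linarith) hR.le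
      linarith
    · subst h
      simp only [Int.natAbs_neg, Int.natAbs_one, mul_one]
      refine (mul_le_mul_of_nonneg_right (min_le_right _ _) (by positivity)).trans (le_trans ?_ (gq_false_ge ht hR (-1) y x))
      rw [← mul_pow, ← neg_sub, neg_sq]
      refine pow_le_pow_left₀ (by positivity) ?_ 2
      simp only [neg_neg, zpow_one, zpow_neg]
      have : R * t - t⁻¹ * ‖y‖ / R * ‖x‖ - R * δ * t = ((t * R) ^ 2 * (1 - δ) - ‖x‖ * ‖y‖) / (t * R) := by field_simp; ring
      have h3 : 0 ≤ ((t * R) ^ 2 * (1 - δ) - ‖x‖ * ‖y‖) / (t * R) := div_nonneg (by linarith) (by positivity)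
      linarith
  · refine le_trans ?_ (H j hj1 x hx y hy)
    gcongr
    exact min_le_left _ _

end M5

section M6
variable {N : ℕ}
local notation "𝔼" => EuclideanSpace ℝ (Fin N)

/-- exponent -/
def ss (N : ℕ) : ℝ := ((N : ℝ) - 2) / 2

lemma ss_pos (hN : 3 ≤ N) : 0 < ss N := by
  have : (3:ℝ) ≤ N := by exact_mod_cast hN
  unfold ss; linarith

/-- unnormalised Green function of the annulus -/
def Gr (t R : ℝ) (x y : 𝔼) : ℝ := ∑' j : Bool × ℤ, sg j * gq t R j y x ^ (-ss N)

/-- bounded densities living in the annulus -/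
structure DD (t R : ℝ) (g : 𝔼 → ℝ) (B : ℝ) : Prop where
  meas : Measurable g
  bd : ∀ y, |g y| ≤ B
  supp : ∀ y, g y ≠ 0 → y ∈ DSet N R (t * R)

lemma wt_summable {t s : ℝ} (ht : 1 < t) (hs : 0 < s) :
    Summable (fun j : Bool × ℤ => (t ^ (2 * j.2.natAbs) : ℝ) ^ (-s)) := by
  have h0 : 0 < t := by linarith
  have hr : (t ^ 2) ^ (-s) < 1 := Real.rpow_lt_one_of_one_lt_of_neg (by nlinarith) (by linarith)
  have e : ∀ m : ℕ, (t ^ (2 * m) : ℝ) ^ (-s) = ((t ^ 2) ^ (-s)) ^ m := by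
    intro m
    rw [pow_mul, ← Real.rpow_natCast ((t^2)^(-s)), ← Real.rpow_mul (by positivity), mul_comm,
      Real.rpow_mul (by positivity), Real.rpow_natCast]
  have hg : Summable (fun m : ℕ => ((t ^ 2) ^ (-s)) ^ m) :=
    summable_geometric_of_lt_one (by positivity) hr
  have h1 : Summable (fun k : ℤ => (t ^ (2 * k.natAbs) : ℝ) ^ (-s)) := by
    apply Summable.of_nat_of_neg
    · simpa [e] using hg
    · simpa [e] using hg
  have := Summable.mul_of_nonneg (f := fun _ : Bool => (1:ℝ)) (g := fun k : ℤ => (t ^ (2 * k.natAbs) : ℝ) ^ (-s))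
    (Summable.of_finite) h1 (fun _ => zero_le_one) (fun _ => by positivity)
  simpa using this

lemma gal_le {t R : ℝ} (ht : 1 < t) (hR : 0 < R) (j : Bool × ℤ) {y : 𝔼} (hy : ‖y‖ ≤ t * R) :
    gal t R j y ≤ t ^ 2 * t ^ (2 * j.2.natAbs) := by
  have h0 : 0 < t := by linarith
  have h1 : ∀ k : ℤ, t ^ (2 * k) ≤ t ^ (2 * k.natAbs) := by
    intro k
    rw [← zpow_natCast]
    apply zpow_le_zpow_right₀ ht.le
    push_cast
    have := le_abs_self k
    omega
  unfold gal
  split_ifs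
  · have := h1 (-j.2)
    rw [Int.natAbs_neg] at this
    rw [show -2 * j.2 = 2 * -j.2 by ring]
    refine this.trans ?_
    have : (1:ℝ) ≤ t ^ 2 := by nlinarith
    exact le_mul_of_one_le_left (by positivity) this
  · rw [mul_div_assoc, mul_comm]
    gcongr
    · rw [div_le_iff₀ (by positivity), ← mul_pow]; gcongr
    · exact h1 _

lemma gq_meas (t R : ℝ) (x : 𝔼) : Measurable (fun p : (Bool × ℤ) × 𝔼 => gq t R p.1 p.2 x) := by
  apply measurable_from_prod_countable_right
  rintro ⟨b, k⟩
  unfold gq QF gal gbe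
  cases b <;> simp only [Bool.false_eq_true, if_false, if_true] <;> fun_prop

lemma gal_meas (t R : ℝ) : Measurable (fun p : (Bool × ℤ) × 𝔼 => gal t R p.1 p.2) := by
  apply measurable_from_prod_countable_right
  rintro ⟨b, k⟩
  unfold gal
  cases b <;> simp only [Bool.false_eq_true, if_false, if_true] <;> fun_prop

lemma gbe_meas (t R : ℝ) : Measurable (fun p : (Bool × ℤ) × 𝔼 => gbe t R p.1 p.2) := by
  apply measurable_from_prod_countable_right
  rintro ⟨b, k⟩
  unfold gbe
  cases b <;> simp only [Bool.false_eq_true, if_false, if_true] <;> fun_prop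

lemma D_bdd (R r : ℝ) : Bornology.IsBounded (DSet N R r) :=
  (Metric.isBounded_ball (x := (0:𝔼)) (r := r)).subset fun y hy => by
    simpa using hy.2

lemma D_open (R r : ℝ) : IsOpen (DSet N R r) :=
  (isOpen_lt continuous_const continuous_norm).inter (isOpen_lt continuous_norm continuous_const)

lemma DD.nonneg {t R : ℝ} {g : 𝔼 → ℝ} {B : ℝ} (h : DD t R g B) : 0 ≤ B := (abs_nonneg _).trans (h.bd 0)

lemma DD.int_mul {t R : ℝ} {g : 𝔼 → ℝ} {B : ℝ} (h : DD t R g B) {f : 𝔼 → ℝ}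
    (hf : IntegrableOn f (DSet N R (t * R))) : Integrable (fun y => g y * f y) := by
  have : Integrable (fun y => g y * (DSet N R (t * R)).indicator f y) := by
    refine Integrable.bdd_mul (c := B) ((integrable_indicator_iff (D_open _ _).measurableSet).2 hf)
      h.meas.aestronglyMeasurable (Eventually.of_forall fun y => h.bd y)
  refine this.congr (Eventually.of_forall fun y => ?_)
  by_cases hy : y ∈ DSet N R (t * R)
  · simp [hy]
  · have : g y = 0 := by by_contra h'; exact hy (h.supp y h')
    simp [this]

lemma DD.int {t R : ℝ} {g : 𝔼 → ℝ} {B : ℝ} (h : DD t R g B) : Integrable g := by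
  have := h.int_mul (f := fun _ => 1) (integrableOn_const (D_bdd _ _).measure_lt_top.ne)
  simpa using this

lemma green_rest (hN : 3 ≤ N) {t R : ℝ} (ht : 1 < t) (hR : 0 < R) (F : Finset (Bool × ℤ)) {U : Set 𝔼}
    (hU : IsOpen U) (hUb : U ⊆ Unb N t R) {c0 : ℝ} (hc0 : 0 < c0) {g : 𝔼 → ℝ} {B : ℝ} (hg : DD t R g B)
    (hlow : ∀ j ∉ F, ∀ x ∈ U, ∀ y, g y ≠ 0 → c0 * t ^ (2 * j.2.natAbs) ≤ gq t R j y x)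
    (hFi : ∀ j ∈ F, ∀ x ∈ U, Integrable (fun y => g y * gq t R j y x ^ (-ss N))) :
    ∃ T : 𝔼 → ℝ, ContDiffOn ℝ 2 T U ∧ (∀ x ∈ U, lapE T x = 0) ∧ ∀ x ∈ U,
      Integrable (fun y => g y * Gr t R x y) ∧
      ∫ y, g y * Gr t R x y = (∑ j ∈ F, sg j * ∫ y, g y * gq t R j y x ^ (-ss N)) + T x := by
  classical
  have h0 : 0 < t := by linarith
  have hs := ss_pos hN
  set s := ss N with hsdef
  set μ : Measure ((Bool × ℤ) × 𝔼) := (Measure.count).prod volume with hμ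
  set c : (Bool × ℤ) × 𝔼 → ℝ := fun p => (if p.1 ∈ F then 0 else sg p.1) * g p.2 with hc
  set θ : (Bool × ℤ) × 𝔼 → ℝ := fun p => c0 * t ^ (2 * p.1.2.natAbs) with hθ
  have hcm : Measurable c := by
    apply measurable_from_prod_countable_right
    intro j
    exact hg.meas.const_mul (if j ∈ F then 0 else sg j)
  have hcne : ∀ p, c p ≠ 0 → p.1 ∉ F ∧ g p.2 ≠ 0 := by
    intro p hp
    simp only [hc] at hp
    constructor
    · intro h; simp [h] at hp
    · intro h; simp [h] at hp
  have H : ∀ p, c p ≠ 0 → 0 < θ p ∧ |gal t R p.1 p.2| ≤ ((t ^ 2 + t * R) / c0) * θ p ∧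
      ‖p.2‖ ≤ ((t ^ 2 + t * R) / c0) * θ p ∧
      ∀ x ∈ U, θ p ≤ QF (gal t R p.1 p.2) (gbe t R p.1 p.2) p.2 x := by
    intro p hp
    obtain ⟨h1, h2⟩ := hcne p hp
    have hy := hg.supp _ h2
    have hw : (1:ℝ) ≤ t ^ (2 * p.1.2.natAbs) := one_le_pow₀ ht.le
    have e : ((t ^ 2 + t * R) / c0) * θ p = (t ^ 2 + t * R) * t ^ (2 * p.1.2.natAbs) := by
      simp only [hθ]; field_simp
    refine ⟨by positivity, ?_, ?_, fun x hx => hlow _ h1 x hx _ h2⟩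
    · rw [abs_of_nonneg (gal_nonneg ht _ _), e]
      refine (gal_le ht hR p.1 hy.2.le).trans ?_
      gcongr
      have : 0 < t * R := by positivity
      linarith
    · rw [e]
      have : 0 < t * R := by positivity
      have h3 := hy.2
      nlinarith [sq_nonneg t]
  have hIntg : Integrable (fun p => |c p| * θ p ^ (-s)) μ := by
    have hw := wt_summable ht hs
    have h1 : Integrable (fun j : Bool × ℤ => c0 ^ (-s) * (t ^ (2 * j.2.natAbs) : ℝ) ^ (-s)) Measure.count := by
      rw [integrable_count_iff]
      exact (hw.mul_left (c0 ^ (-s))).norm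
    have h2 := h1.mul_prod (hg.int.norm)
    refine h2.mono' ?_ (Eventually.of_forall fun p => ?_)
    · refine Measurable.aestronglyMeasurable ?_
      refine (measurable_norm.comp hcm).mul (Measurable.pow_const ?_ _)
      apply measurable_from_prod_countable_right
      intro j
      exact measurable_const (a := c0 * t ^ (2 * j.2.natAbs))
    · simp only [hθ]
      rw [Real.mul_rpow hc0.le (by positivity), norm_mul, Real.norm_eq_abs, Real.norm_eq_abs, abs_abs,
        abs_of_nonneg (a := c0 ^ (-s) * (t ^ (2 * p.1.2.natAbs)) ^ (-s)) (by positivity), mul_comm]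
      gcongr
      simp only [hc]
      split_ifs
      · simp
      · simp [abs_mul, sg_abs]
  have hX : ∀ x ∈ U, ‖x‖ ≤ √t * (t * R) := fun x hx => (hUb hx).2.le
  obtain ⟨r1, -, -, r4⟩ := rest_lemma hU hX hs (A := (t ^ 2 + t * R) / c0) (by positivity) hcm (gal_meas t R) (gbe_meas t R)
    measurable_snd (Eventually.of_forall H) hIntg
  refine ⟨_, r1, r4 (Eventually.of_forall fun p _ => gal_mul_gbe ht hR _ _) rfl, ?_⟩
  intro x hx
  have hI : Integrable (fun p : (Bool × ℤ) × 𝔼 => c p * gq t R p.1 p.2 x ^ (-s)) μ := by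
    refine hIntg.mono' (hcm.mul ((gq_meas t R x).pow_const _)).aestronglyMeasurable (Eventually.of_forall fun p => ?_)
    rw [norm_mul, Real.norm_eq_abs, Real.norm_eq_abs]
    by_cases hp : c p = 0
    · simp [hp]
    · obtain ⟨k1, -, -, k4⟩ := H p hp
      have k5 : θ p ≤ gq t R p.1 p.2 x := k4 x hx
      have k6 := Real.rpow_le_rpow_of_nonpos k1 k5 (z := -s) (by linarith)
      rw [abs_of_nonneg (a := gq t R p.1 p.2 x ^ (-s)) (Real.rpow_nonneg (k1.le.trans k5) _)]
      gcongr
  have hI2 := hI.integral_prod_right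
  have hae := hI.prod_left_ae
  have hsplit : ∀ᵐ y : 𝔼, g y * Gr t R x y = (∑ j ∈ F, sg j * (g y * gq t R j y x ^ (-s))) +
      ∫ j, c (j, y) * gq t R j y x ^ (-s) ∂Measure.count := by
    filter_upwards [hae] with y hy
    have hsum : Summable (fun j => c (j, y) * gq t R j y x ^ (-s)) :=
      (integrable_count_iff.1 hy).of_norm
    rw [integral_countable hy]
    have e1 : ∀ j, (sg j * gq t R j y x ^ (-s)) * g y =
        (if j ∈ F then sg j * (g y * gq t R j y x ^ (-s)) else 0) + c (j, y) * gq t R j y x ^ (-s) := by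
      intro j
      simp only [hc]
      split_ifs <;> ring
    unfold Gr
    rw [mul_comm, ← tsum_mul_right]
    rw [tsum_congr e1, Summable.tsum_add _ hsum]
    · congr 1
      · rw [tsum_eq_sum (s := F)]
        · exact Finset.sum_congr rfl fun j hj => by simp [hj]
        · intro j hj; simp [hj]
      · simp
    · exact summable_of_ne_finset_zero (s := F) fun j hj => by simp [hj]
  have hF1 : Integrable (fun y => ∑ j ∈ F, sg j * (g y * gq t R j y x ^ (-s))) :=
    integrable_finset_sum _ fun j hj => (hFi j hj x hx).const_mul _
  constructor
  · exact (hF1.add hI2).congr (hsplit.mono fun y hy => hy.symm)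
  · rw [integral_congr_ae hsplit, integral_add hF1 hI2, integral_finset_sum _ fun j hj => (hFi j hj x hx).const_mul _]
    congr 1
    · exact Finset.sum_congr rfl fun j hj => integral_const_mul _ _
    · exact (integral_prod_symm _ hI).symm

end M6

section M7
variable {N : ℕ}
local notation "𝔼" => EuclideanSpace ℝ (Fin N)

lemma lapE_congr {f g : 𝔼 → ℝ} {x : 𝔼} (h : f =ᶠ[𝓝 x] g) : lapE f x = lapE g x := by
  unfold lapE
  refine Finset.sum_congr rfl fun i _ => ?_
  have : (fun y => fderiv ℝ f y (EuclideanSpace.single i (1:ℝ))) =ᶠ[𝓝 x] fun y => fderiv ℝ g y (EuclideanSpace.single i (1:ℝ)) := by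
    filter_upwards [h.fderiv (𝕜 := ℝ)] with y hy
    rw [hy]
  rw [this.fderiv_eq]

lemma fderiv_apply_diff {f : 𝔼 → ℝ} {x : 𝔼} (hf : ContDiffAt ℝ 2 f x) (e : 𝔼) :
    DifferentiableAt ℝ (fun y => fderiv ℝ f y e) x := by
  have h1 : ContDiffAt ℝ 1 (fderiv ℝ f) x := hf.fderiv_right (by norm_num)
  have h2 := h1.differentiableAt (by norm_num)
  exact h2.clm_apply (differentiableAt_const e)

lemma lapE_add {f g : 𝔼 → ℝ} {x : 𝔼} (hf : ContDiffAt ℝ 2 f x) (hg : ContDiffAt ℝ 2 g x) :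
    lapE (fun y => f y + g y) x = lapE f x + lapE g x := by
  unfold lapE
  rw [← Finset.sum_add_distrib]
  refine Finset.sum_congr rfl fun i _ => ?_
  have : (fun y => fderiv ℝ (fun y => f y + g y) y (EuclideanSpace.single i (1:ℝ))) =ᶠ[𝓝 x]
      fun y => fderiv ℝ f y (EuclideanSpace.single i (1:ℝ)) + fderiv ℝ g y (EuclideanSpace.single i (1:ℝ)) := by
    filter_upwards [hf.eventually (by norm_num), hg.eventually (by norm_num)] with y h1 h2
    rw [fderiv_fun_add (h1.differentiableAt (by norm_num)) (h2.differentiableAt (by norm_num))]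
    simp
  rw [this.fderiv_eq, fderiv_fun_add (fderiv_apply_diff hf _) (fderiv_apply_diff hg _)]
  simp

lemma lapE_const_mul {f : 𝔼 → ℝ} {x : 𝔼} (c : ℝ) (hf : ContDiffAt ℝ 2 f x) :
    lapE (fun y => c * f y) x = c * lapE f x := by
  unfold lapE
  rw [Finset.mul_sum]
  refine Finset.sum_congr rfl fun i _ => ?_
  have : (fun y => fderiv ℝ (fun y => c * f y) y (EuclideanSpace.single i (1:ℝ))) =ᶠ[𝓝 x]
      fun y => c * fderiv ℝ f y (EuclideanSpace.single i (1:ℝ)) := by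
    filter_upwards [hf.eventually (by norm_num)] with y h1
    rw [fderiv_const_mul (h1.differentiableAt (by norm_num))]
    simp
  rw [this.fderiv_eq, fderiv_const_mul (fderiv_apply_diff hf _)]
  simp

lemma gq_t0 {t R : ℝ} (y x : 𝔼) : gq t R (true, 0) y x = ‖x - y‖ ^ 2 := by
  unfold gq QF gal gbe
  simp [norm_sub_sq_real]

lemma gq_f0 {t R : ℝ} (y x : 𝔼) : gq t R (false, 0) y x = ‖y‖ ^ 2 / R ^ 2 * ‖x‖ ^ 2 - 2 * ⟪x, y⟫_ℝ + R ^ 2 := by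
  unfold gq QF gal gbe
  simp

lemma gq_f1 {t R : ℝ} (ht : 1 < t) (y x : 𝔼) : gq t R (false, -1) y x =
    ‖y‖ ^ 2 / (t * R) ^ 2 * ‖x‖ ^ 2 - 2 * ⟪x, y⟫_ℝ + (t * R) ^ 2 := by
  have h0 : 0 < t := by linarith
  unfold gq QF gal gbe
  simp only [Bool.false_eq_true, if_false]
  have e1 : t ^ (2 * (-1) : ℤ) = (t ^ 2)⁻¹ := by
    rw [show (2 * (-1) : ℤ) = -(2 : ℕ) by norm_num, zpow_neg, zpow_natCast]
  have e2 : t ^ (-2 * (-1) : ℤ) = t ^ 2 := by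
    rw [show (-2 * (-1) : ℤ) = (2 : ℕ) by norm_num, zpow_natCast]
  rw [e1, e2, mul_pow]
  congr 1
  · field_simp
  · ring

lemma kelvin {ρ : ℝ} (hρ : 0 < ρ) {x : 𝔼} (hx : x ≠ 0) (y : 𝔼) :
    ‖y‖ ^ 2 / ρ ^ 2 * ‖x‖ ^ 2 - 2 * ⟪x, y⟫_ℝ + ρ ^ 2 = (‖x‖ ^ 2 / ρ ^ 2) * ‖(ρ ^ 2 / ‖x‖ ^ 2) • x - y‖ ^ 2 := by
  have : 0 < ‖x‖ := norm_pos_iff.2 hx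
  rw [norm_sub_sq_real, norm_smul, inner_smul_left]
  simp only [norm_div, norm_pow, Real.norm_eq_abs, abs_norm, conj_trivial, sq_abs]
  field_simp
  ring

lemma S1_ge {t R : ℝ} (ht : 1 < t) (hR : 0 < R) {x y : 𝔼} (hx : R ≤ ‖x‖ ∧ ‖x‖ ≤ t * R) (hy : R ≤ ‖y‖ ∧ ‖y‖ ≤ t * R)
    {j : Bool × ℤ} (hj : j ∈ S1) : ‖x - y‖ ^ 2 ≤ gq t R j y x := by
  simp only [S1, Finset.mem_insert, Finset.mem_singleton] at hj
  have h0 : 0 < t * R := by nlinarith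
  rcases hj with rfl | rfl | rfl
  · rw [gq_t0]
  · rw [gq_f0, norm_sub_sq_real]
    have : 0 ≤ (‖x‖ ^ 2 - R ^ 2) * (‖y‖ ^ 2 - R ^ 2) / R ^ 2 :=
      div_nonneg (mul_nonneg (by nlinarith) (by nlinarith)) (by positivity)
    have e : (‖x‖ ^ 2 - R ^ 2) * (‖y‖ ^ 2 - R ^ 2) / R ^ 2 = ‖y‖ ^ 2 / R ^ 2 * ‖x‖ ^ 2 - ‖x‖ ^ 2 - ‖y‖ ^ 2 + R ^ 2 := by
      field_simp; ring
    linarith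
  · rw [gq_f1 ht, norm_sub_sq_real]
    have : 0 ≤ ((t * R) ^ 2 - ‖x‖ ^ 2) * ((t * R) ^ 2 - ‖y‖ ^ 2) / (t * R) ^ 2 :=
      div_nonneg (mul_nonneg (sub_nonneg.2 (pow_le_pow_left₀ (norm_nonneg _) hx.2 2))
        (sub_nonneg.2 (pow_le_pow_left₀ (norm_nonneg _) hy.2 2))) (by positivity)
    have e : ((t * R) ^ 2 - ‖x‖ ^ 2) * ((t * R) ^ 2 - ‖y‖ ^ 2) / (t * R) ^ 2 =
      ‖y‖ ^ 2 / (t * R) ^ 2 * ‖x‖ ^ 2 - ‖x‖ ^ 2 - ‖y‖ ^ 2 + (t * R) ^ 2 := by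
      field_simp; ring
    linarith

lemma tsum_zero_of_neg (e : (Bool × ℤ) ≃ (Bool × ℤ)) {f : Bool × ℤ → ℝ} (h : ∀ j, f (e j) = - f j) : ∑' j, f j = 0 := by
  have h1 := e.tsum_eq f
  rw [tsum_congr h, tsum_neg] at h1
  linarith

/-- involution for the inner sphere -/
def eq1 : (Bool × ℤ) ≃ (Bool × ℤ) where
  toFun j := (!j.1, j.2)
  invFun j := (!j.1, j.2)
  left_inv j := by simp
  right_inv j := by simp

/-- involution for the outer sphere -/
def eq2 : (Bool × ℤ) ≃ (Bool × ℤ) where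
  toFun j := if j.1 then (false, j.2 - 1) else (true, j.2 + 1)
  invFun j := if j.1 then (false, j.2 - 1) else (true, j.2 + 1)
  left_inv := by rintro ⟨b, k⟩; cases b <;> simp
  right_inv := by rintro ⟨b, k⟩; cases b <;> simp

/-- involution for the symmetry -/
def eq3 : (Bool × ℤ) ≃ (Bool × ℤ) where
  toFun j := if j.1 then (true, -j.2) else j
  invFun j := if j.1 then (true, -j.2) else j
  left_inv := by rintro ⟨b, k⟩; cases b <;> simp
  right_inv := by rintro ⟨b, k⟩; cases b <;> simp

lemma Gr_inner {t R : ℝ} (hR : 0 < R) {x : 𝔼} (hx : ‖x‖ = R) (y : 𝔼) : Gr t R x y = 0 := by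
  refine tsum_zero_of_neg eq1 ?_
  rintro ⟨b, k⟩
  have : gq t R (true, k) y x = gq t R (false, k) y x := by
    unfold gq QF gal gbe
    simp only [if_true, Bool.false_eq_true, if_false, hx]
    field_simp
    ring
  cases b <;> simp [eq1, sg, this]

lemma Gr_outer {t R : ℝ} (ht : 1 < t) (hR : 0 < R) {x : 𝔼} (hx : ‖x‖ = t * R) (y : 𝔼) : Gr t R x y = 0 := by
  have h0 : t ≠ 0 := by linarith
  refine tsum_zero_of_neg eq2 ?_
  have : ∀ k, gq t R (true, k) y x = gq t R (false, k - 1) y x := by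
    intro k
    unfold gq QF gal gbe
    simp only [if_true, Bool.false_eq_true, if_false, hx]
    have e1 : t ^ (2 * (k - 1)) = t ^ (2 * k) / t ^ 2 := by
      rw [mul_sub, zpow_sub₀ h0]; norm_num
      try norm_cast
    have e2 : t ^ (-2 * (k - 1)) = t ^ (-2 * k) * t ^ 2 := by
      rw [mul_sub, zpow_sub₀ h0]; norm_num
      try norm_cast
    rw [e1, e2]
    field_simp
    ring
  rintro ⟨b, k⟩
  cases b
  · have := this (k + 1)
    simp only [add_sub_cancel_right] at this
    simp [eq2, sg, this]
  · simp [eq2, sg, this]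

lemma Gr_symm {t R : ℝ} (x y : 𝔼) : Gr t R x y = Gr t R y x := by
  unfold Gr
  rw [← eq3.tsum_eq]
  refine tsum_congr ?_
  rintro ⟨b, k⟩
  cases b
  · simp only [eq3, Equiv.coe_fn_mk, Bool.false_eq_true, if_false]
    congr 2
    unfold gq QF gal gbe
    simp only [Bool.false_eq_true, if_false]
    rw [real_inner_comm]; ring
  · simp only [eq3, Equiv.coe_fn_mk, if_true]
    have : gq t R (true, -k) y x = gq t R (true, k) x y := by
      unfold gq QF gal gbe
      simp only [if_true]
      rw [real_inner_comm, show -2 * -k = 2 * k by ring, show 2 * -k = -2 * k by ring]; ring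
    rw [this]; rfl

lemma Gr_eq_int {t R : ℝ} (x y : 𝔼) : Gr t R x y = ∫ j, sg j * gq t R j y x ^ (-ss N) ∂Measure.count := by
  by_cases h : Integrable (fun j => sg j * gq t R j y x ^ (-ss N)) Measure.count
  · rw [integral_countable h]; simp [Gr]
  · rw [integral_undef h]
    unfold Gr
    rw [tsum_eq_zero_of_not_summable]
    intro h'
    exact h (integrable_count_iff.2 h'.norm)

lemma Gr_meas (t R : ℝ) : Measurable (fun p : 𝔼 × 𝔼 => Gr t R p.1 p.2) := by
  have h : StronglyMeasurable (fun q : (𝔼 × 𝔼) × (Bool × ℤ) => sg q.2 * gq t R q.2 q.1.2 q.1.1 ^ (-ss N)) := by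
    apply Measurable.stronglyMeasurable
    apply measurable_from_prod_countable_left
    rintro ⟨b, k⟩
    have hq : Measurable (fun p : 𝔼 × 𝔼 => gq t R (b, k) p.2 p.1) := by
      unfold gq QF gal gbe
      cases b <;> simp only [Bool.false_eq_true, if_false, if_true] <;> fun_prop
    exact (hq.pow_const (-ss N)).const_mul (sg (b, k))
  have := (h.integral_prod_right' (ν := (Measure.count : Measure (Bool × ℤ)))).measurable
  have e : (fun p : 𝔼 × 𝔼 => Gr t R p.1 p.2) = fun p => ∫ j, sg j * gq t R j p.2 p.1 ^ (-ss N) ∂Measure.count := by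
    ext p
    exact Gr_eq_int _ _
  rw [e]; exact this

lemma Gr_bound (hN : 3 ≤ N) {t R : ℝ} (ht : 1 < t) (hR : 0 < R) : ∃ C : ℝ, 0 < C ∧ ∀ x y : 𝔼,
    R ≤ ‖x‖ → ‖x‖ ≤ t * R → y ∈ DSet N R (t * R) → x ≠ y → |Gr t R x y| ≤ C * ‖x - y‖ ^ (-((N:ℝ) - 2)) := by
  classical
  have h0 : 0 < t := by linarith
  obtain ⟨c0, hc0, hlow⟩ := low1 (N := N) ht hR
  obtain ⟨hσ1, hσ2⟩ := sqrt_facts ht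
  have hs := ss_pos hN
  have hw := wt_summable ht hs
  set W := ∑' j : Bool × ℤ, (t ^ (2 * j.2.natAbs) : ℝ) ^ (-ss N) with hW
  have hW0 : 0 ≤ W := tsum_nonneg fun j => by positivity
  have hν : (0:ℝ) < (N:ℝ) - 2 := by have := hs; unfold ss at this; linarith
  refine ⟨3 + c0 ^ (-ss N) * W * (2 * (t * R)) ^ ((N:ℝ) - 2), by positivity, ?_⟩
  intro x y hx1 hx2 hy hxy
  have hd : 0 < ‖x - y‖ := norm_pos_iff.2 (sub_ne_zero.2 hxy)
  have hxU : x ∈ Unb N t R := by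
    constructor
    · refine lt_of_lt_of_le ?_ hx1
      rw [div_lt_iff₀ (by linarith)]; nlinarith
    · have : 0 < t * R := by positivity
      nlinarith
  set K := ‖x - y‖ ^ (-((N:ℝ) - 2)) with hK
  have hK0 : 0 < K := by positivity
  have b1 : ∀ j, ‖sg j * gq t R j y x ^ (-ss N)‖ ≤ (if j ∈ S1 then K else 0) + c0 ^ (-ss N) * (t ^ (2 * j.2.natAbs) : ℝ) ^ (-ss N) := by
    intro j
    rw [norm_mul, Real.norm_eq_abs, sg_abs, one_mul]
    by_cases hj : j ∈ S1
    · have h1 := S1_ge ht hR ⟨hx1, hx2⟩ ⟨hy.1.le, hy.2.le⟩ hj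
      have h2 := Real.rpow_le_rpow_of_nonpos (by positivity) h1 (z := -ss N) (by linarith)
      have h3 : (‖x - y‖ ^ 2) ^ (-ss N) = K := by
        rw [hK, ← Real.rpow_natCast, ← Real.rpow_mul hd.le]; congr 1; unfold ss; push_cast; ring
      rw [h3] at h2
      rw [Real.norm_eq_abs, abs_of_nonneg (Real.rpow_nonneg ((sq_nonneg _).trans h1) _)]
      simp only [hj, if_true]
      have : 0 ≤ c0 ^ (-ss N) * (t ^ (2 * j.2.natAbs) : ℝ) ^ (-ss N) := by positivity
      linarith
    · have h1 := hlow j hj x hxU y hy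
      have h2 := Real.rpow_le_rpow_of_nonpos (by positivity) h1 (z := -ss N) (by linarith)
      rw [Real.norm_eq_abs, abs_of_nonneg (Real.rpow_nonneg (le_trans (by positivity) h1) _)]
      simp only [hj, if_false, zero_add]
      rwa [Real.mul_rpow hc0.le (by positivity)] at h2
  have hf : Summable (fun j : Bool × ℤ => if j ∈ S1 then K else 0) :=
    summable_of_ne_finset_zero (s := S1) fun j hj => by simp [hj]
  have hsum := hf.add (hw.mul_left (c0 ^ (-ss N)))
  have h5 := tsum_of_norm_bounded hsum.hasSum b1
  rw [hf.tsum_add (hw.mul_left _), tsum_mul_left, ← hW] at h5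
  have h6 : ∑' j : Bool × ℤ, (if j ∈ S1 then K else 0) = 3 * K := by
    rw [tsum_eq_sum (s := S1) (fun j hj => by simp [hj])]
    rw [Finset.sum_congr rfl (g := fun _ => K) (fun j hj => by simp [hj])]
    simp [S1]
  rw [h6] at h5
  have h7 : 1 ≤ (2 * (t * R)) ^ ((N:ℝ) - 2) * K := by
    rw [hK, Real.rpow_neg hd.le, ← div_eq_mul_inv, one_le_div (by positivity)]
    apply Real.rpow_le_rpow hd.le _ hν.le
    have := norm_sub_le x y
    have := hy.2
    linarith
  have h8 : c0 ^ (-ss N) * W * 1 ≤ c0 ^ (-ss N) * W * ((2 * (t * R)) ^ ((N:ℝ) - 2) * K) := by gcongr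
  calc |Gr t R x y| = ‖∑' j : Bool × ℤ, sg j * gq t R j y x ^ (-ss N)‖ := rfl
    _ ≤ 3 * K + c0 ^ (-ss N) * W := h5
    _ ≤ _ := by linarith

end M7

section M8
variable {N : ℕ}
local notation "𝔼" => EuclideanSpace ℝ (Fin N)

/-- normalising constant -/
def cN (N : ℕ) : ℝ := ((N : ℝ) - 2) * kp N

lemma cN_pos (hN : 3 ≤ N) : 0 < cN N := by
  have : (3:ℝ) ≤ N := by exact_mod_cast hN
  exact mul_pos (by linarith) (kp_pos (by omega))

/-- Green operator -/
def Kop (t R : ℝ) (g : 𝔼 → ℝ) (x : 𝔼) : ℝ := (cN N)⁻¹ * ∫ y, g y * Gr t R x y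

lemma DD.dens {t R : ℝ} {g : 𝔼 → ℝ} {B : ℝ} (h : DD t R g B) : Dens g B (t * R) where
  meas := h.meas
  bd := h.bd
  supp y hy := by
    by_contra h'
    exact absurd (h.supp y h').2 (not_lt.2 hy)

lemma sq_pow_ss (a : ℝ) (ha : 0 ≤ a) : (a ^ 2) ^ (-ss N) = a ^ (-((N:ℝ) - 2)) := by
  rw [← Real.rpow_natCast, ← Real.rpow_mul ha]; congr 1; unfold ss; push_cast; ring

lemma DD.int_newt (hN : 3 ≤ N) {t R : ℝ} {g : 𝔼 → ℝ} {B : ℝ} (h : DD t R g B) (x : 𝔼) :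
    Integrable (fun y => g y * ‖x - y‖ ^ (-((N:ℝ) - 2))) :=
  h.int_mul (ker_int_bdd (by omega) (by linarith) x (D_bdd _ _))

lemma Unb_ne {t R : ℝ} (hR : 0 < R) {x : 𝔼} (hx : x ∈ Unb N t R) : x ≠ 0 := by
  rintro rfl
  have := hx.1
  rw [norm_zero] at this
  exact absurd this (not_lt.2 (by positivity))

lemma kel_term (hN : 3 ≤ N) {t R ρ : ℝ} (hρ : 0 < ρ) {g : 𝔼 → ℝ} {B : ℝ} (h : DD t R g B) {x : 𝔼} (hx : x ≠ 0) :
    Integrable (fun y => g y * (‖y‖ ^ 2 / ρ ^ 2 * ‖x‖ ^ 2 - 2 * ⟪x, y⟫_ℝ + ρ ^ 2) ^ (-ss N)) ∧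
    ∫ y, g y * (‖y‖ ^ 2 / ρ ^ 2 * ‖x‖ ^ 2 - 2 * ⟪x, y⟫_ℝ + ρ ^ 2) ^ (-ss N) =
      (‖x‖ ^ 2 / ρ ^ 2) ^ (-ss N) * newt g ((ρ ^ 2 / ‖x‖ ^ 2) • x) := by
  have e : ∀ y, g y * (‖y‖ ^ 2 / ρ ^ 2 * ‖x‖ ^ 2 - 2 * ⟪x, y⟫_ℝ + ρ ^ 2) ^ (-ss N) =
      (‖x‖ ^ 2 / ρ ^ 2) ^ (-ss N) * (g y * ‖(ρ ^ 2 / ‖x‖ ^ 2) • x - y‖ ^ (-((N:ℝ) - 2))) := by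
    intro y
    rw [kelvin hρ hx, Real.mul_rpow (by positivity) (by positivity), sq_pow_ss _ (norm_nonneg _)]
    ring
  simp_rw [e]
  exact ⟨(h.int_newt hN _).const_mul _, integral_const_mul _ _⟩

lemma kop_rep (hN : 3 ≤ N) {t R : ℝ} (ht : 1 < t) (hR : 0 < R) {g : 𝔼 → ℝ} {B : ℝ} (hg : DD t R g B) :
    ∃ T : 𝔼 → ℝ, ContDiffOn ℝ 2 T (Unb N t R) ∧ ∀ x ∈ Unb N t R,
      Integrable (fun y => g y * Gr t R x y) ∧
      ∫ y, g y * Gr t R x y = newt g x - (‖x‖ ^ 2 / R ^ 2) ^ (-ss N) * newt g ((R ^ 2 / ‖x‖ ^ 2) • x)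
        - (‖x‖ ^ 2 / (t * R) ^ 2) ^ (-ss N) * newt g (((t * R) ^ 2 / ‖x‖ ^ 2) • x) + T x := by
  obtain ⟨c0, hc0, hlow⟩ := low1 (N := N) ht hR
  have htR : 0 < t * R := by nlinarith
  have i0 : ∀ x : 𝔼, Integrable (fun y => g y * gq t R (true, 0) y x ^ (-ss N)) := by
    intro x
    refine (hg.int_newt hN x).congr (Eventually.of_forall fun y => ?_)
    simp only [gq_t0]
    rw [sq_pow_ss _ (norm_nonneg _)]
  have i1 : ∀ x ∈ Unb N t R, Integrable (fun y => g y * gq t R (false, 0) y x ^ (-ss N)) := by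
    intro x hx
    simp only [gq_f0]
    exact (kel_term hN hR hg (Unb_ne hR hx)).1
  have i2 : ∀ x ∈ Unb N t R, Integrable (fun y => g y * gq t R (false, -1) y x ^ (-ss N)) := by
    intro x hx
    simp only [gq_f1 ht]
    exact (kel_term hN htR hg (Unb_ne hR hx)).1
  obtain ⟨T, hT1, -, hT2⟩ := green_rest hN ht hR S1 (Unb_open t R) subset_rfl hc0 hg
    (fun j hj x hx y hy => hlow j hj x hx y (hg.supp y hy)) (by
      intro j hj x hx
      simp only [S1, Finset.mem_insert, Finset.mem_singleton] at hj
      rcases hj with rfl | rfl | rfl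
      · exact i0 x
      · exact i1 x hx
      · exact i2 x hx)
  refine ⟨T, hT1, fun x hx => ⟨(hT2 x hx).1, ?_⟩⟩
  rw [(hT2 x hx).2]
  congr 1
  have e0 : ∫ y, g y * gq t R (true, 0) y x ^ (-ss N) = newt g x := by
    unfold newt
    refine integral_congr_ae (Eventually.of_forall fun y => ?_)
    simp only [gq_t0]
    rw [sq_pow_ss _ (norm_nonneg _)]
  have e1 := (kel_term hN hR hg (Unb_ne hR hx)).2
  have e2 := (kel_term hN htR hg (Unb_ne hR hx)).2
  simp only [← gq_f0 (t := t)] at e1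
  simp only [← gq_f1 ht] at e2
  unfold S1
  rw [Finset.sum_insert (by simp), Finset.sum_insert (by simp), Finset.sum_singleton, e0, e1, e2]
  simp [sg]
  ring

lemma kel_smooth {ρ : ℝ} {n : WithTop ℕ∞} (hρ : 0 < ρ) {U : Set 𝔼} (hU : ∀ x ∈ U, x ≠ 0) {f : 𝔼 → ℝ} (hf : ContDiff ℝ n f) :
    ContDiffOn ℝ n (fun x : 𝔼 => (‖x‖ ^ 2 / ρ ^ 2) ^ (-ss N) * f ((ρ ^ 2 / ‖x‖ ^ 2) • x)) U := by
  have h1 : ContDiff ℝ n (fun x : 𝔼 => ‖x‖ ^ 2) := contDiff_norm_sq ℝ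
  have h2 : ∀ x ∈ U, ‖x‖ ^ 2 ≠ 0 := fun x hx => by
    have := norm_pos_iff.2 (hU x hx); positivity
  apply ContDiffOn.mul
  · refine ContDiffOn.rpow_const_of_ne ?_ ?_
    · exact (h1.div_const _).contDiffOn
    · intro x hx
      exact div_ne_zero (h2 x hx) (by positivity)
  · refine hf.comp_contDiffOn ?_
    exact (contDiffOn_const.div h1.contDiffOn h2).smul contDiffOn_id

lemma kop_near (hN : 3 ≤ N) {t R : ℝ} (ht : 1 < t) (hR : 0 < R) {g : 𝔼 → ℝ} {B : ℝ} (hg : DD t R g B) :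
    (∀ x ∈ Unb N t R, Integrable (fun y => g y * Gr t R x y)) ∧ ContDiffOn ℝ 1 (Kop t R g) (Unb N t R) ∧
    (ContDiff ℝ 1 g → HasCompactSupport g → ContDiffOn ℝ 2 (Kop t R g) (Unb N t R)) := by
  obtain ⟨T, hT1, hT2⟩ := kop_rep hN ht hR hg
  have htR : 0 < t * R := by nlinarith
  have gen : ∀ n : WithTop ℕ∞, n ≤ 2 → ContDiff ℝ n (newt g) → ContDiffOn ℝ n (Kop t R g) (Unb N t R) := by
    intro n hn hgn
    have hne : ∀ x ∈ Unb N t R, x ≠ 0 := fun x hx => Unb_ne hR hx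
    have := ((hgn.contDiffOn.sub (kel_smooth hR hne hgn)).sub (kel_smooth htR hne hgn)).add (hT1.of_le hn)
    unfold Kop
    refine (contDiffOn_const (c := (cN N)⁻¹)).mul (this.congr fun x hx => (hT2 x hx).2)
  exact ⟨fun x hx => (hT2 x hx).1, gen 1 (by norm_num) (newt_C1 hN hg.dens).2,
    fun h1 h2 => gen 2 le_rfl (newt_C2 hN h1 h2).1⟩

lemma kop_C2 (hN : 3 ≤ N) {t R : ℝ} (ht : 1 < t) (hR : 0 < R) {g : 𝔼 → ℝ} {B : ℝ} (hg : DD t R g B)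
    (hgC : ContDiffOn ℝ 1 g (DSet N R (t * R))) :
    ContDiffOn ℝ 2 (Kop t R g) (DSet N R (t * R)) ∧ ∀ x ∈ DSet N R (t * R), -lapE (Kop t R g) x = g x := by
  have h0 : 0 < t := by linarith
  have htR : 0 < t * R := by positivity
  obtain ⟨hσ1, hσ2⟩ := sqrt_facts ht
  have hc := cN_pos hN
  have main : ∀ x ∈ DSet N R (t * R), ContDiffAt ℝ 2 (Kop t R g) x ∧ -lapE (Kop t R g) x = g x := by
    intro x0 hx0
    obtain ⟨r0, hr0, hr0D⟩ := Metric.isOpen_iff.1 (D_open R (t * R)) x0 hx0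
    -- shrink the ball
    obtain ⟨hx1, hx2⟩ := hx0
    obtain ⟨δ, hδ, hδ1, hδ2⟩ : ∃ δ > 0, R * (1 + δ) < ‖x0‖ ∧ ‖x0‖ < t * R * (1 - δ) := by
      have c1 : Tendsto (fun δ : ℝ => R * (1 + δ)) (𝓝[>] 0) (𝓝 (R * (1 + 0))) :=
        ((by fun_prop : Continuous (fun δ : ℝ => R * (1 + δ))).tendsto 0).mono_left nhdsWithin_le_nhds
      have c2 : Tendsto (fun δ : ℝ => t * R * (1 - δ)) (𝓝[>] 0) (𝓝 (t * R * (1 - 0))) :=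
        ((by fun_prop : Continuous (fun δ : ℝ => t * R * (1 - δ))).tendsto 0).mono_left nhdsWithin_le_nhds
      have c3 := c1.eventually (gt_mem_nhds (by simpa using hx1))
      have c4 := c2.eventually (lt_mem_nhds (by simpa using hx2))
      obtain ⟨δ, a1, a2, a3⟩ := (c3.and (c4.and self_mem_nhdsWithin)).exists
      exact ⟨δ, a3, a1, a2⟩
    have hVo : IsOpen ({x : 𝔼 | R * (1 + δ) < ‖x‖ ∧ ‖x‖ < t * R * (1 - δ)}) :=
      (isOpen_lt continuous_const continuous_norm).inter (isOpen_lt continuous_norm continuous_const)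
    obtain ⟨r1, hr1, hr1V⟩ := Metric.isOpen_iff.1 hVo x0 ⟨hδ1, hδ2⟩
    set r := min r0 r1 / 2 with hr
    have hrp : 0 < r := by positivity
    have hrr0 : r < r0 := by have := min_le_left r0 r1; rw [hr]; linarith
    have hrr1 : r < r1 := by have := min_le_right r0 r1; rw [hr]; linarith
    have hKD : Metric.closedBall x0 r ⊆ DSet N R (t * R) := (Metric.closedBall_subset_ball hrr0).trans hr0D
    obtain ⟨χ, χ1, χ2, χ3, χ4, χ5⟩ := exists_cutoff (isCompact_closedBall x0 r) (D_open R (t * R)) hKD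
    have χ6 : ∀ x ∈ Metric.closedBall x0 r, χ x = 1 := fun x hx => χ4.self_of_nhdsSet x hx
    set U := Metric.ball x0 (r / 2) with hU
    have hUD : U ⊆ DSet N R (t * R) := (Metric.ball_subset_closedBall.trans (Metric.closedBall_subset_closedBall (by linarith))).trans hKD
    have hUb : U ⊆ Unb N t R := by
      intro x hx
      obtain ⟨a1, a2⟩ := hUD hx
      constructor
      · refine lt_trans ?_ a1
        rw [div_lt_iff₀ (by linarith)]; nlinarith
      · nlinarith
    have hUV : ∀ x ∈ U, R * (1 + δ) < ‖x‖ ∧ ‖x‖ < t * R * (1 - δ) := by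
      intro x hx
      exact hr1V (Metric.ball_subset_ball (by linarith) hx)
    have hx0U : x0 ∈ U := Metric.mem_ball_self (by positivity)
    obtain ⟨c0, hc0, hlow⟩ := low2 (N := N) ht hR hδ
    have i0 : ∀ x : 𝔼, Integrable (fun y => g y * gq t R (true, 0) y x ^ (-ss N)) := by
      intro x
      refine (hg.int_newt hN x).congr (Eventually.of_forall fun y => ?_)
      simp only [gq_t0]
      rw [sq_pow_ss _ (norm_nonneg _)]
    obtain ⟨T, hT1, hT2, hT3⟩ := green_rest hN ht hR {(true, 0)} Metric.isOpen_ball hUb hc0 hg (by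
      intro j hj x hx y hy
      obtain ⟨b1, b2⟩ := hg.supp y hy
      obtain ⟨b3, b4⟩ := hUV x hx
      have q1 : R * (1 + δ) * R ≤ ‖x‖ * ‖y‖ := by gcongr
      have q2 : ‖x‖ * ‖y‖ ≤ t * R * (1 - δ) * (t * R) := by
        have : 0 ≤ t * R * (1 - δ) := (norm_nonneg x).trans b4.le
        gcongr
      exact hlow j hj x (hUb hx) y (hg.supp y hy) (by nlinarith) (by nlinarith)) (by
      intro j hj x hx
      simp only [Finset.mem_singleton] at hj
      subst hj
      exact i0 x)
    -- densities
    set g1 : 𝔼 → ℝ := fun y => χ y * g y with hg1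
    set g2 : 𝔼 → ℝ := fun y => (1 - χ y) * g y with hg2
    have hB := hg.nonneg
    have g1c : ContDiff ℝ 1 g1 := contDiff_mul_cutoff (χ1.of_le (by norm_num)) (D_open _ _) χ3 hgC
    have g1s : HasCompactSupport g1 := χ2.mul_right
    have d1 : DD t R g1 B := by
      refine ⟨χ1.continuous.measurable.mul hg.meas, fun y => ?_, fun y hy => hg.supp y (right_ne_zero_of_mul hy)⟩
      rw [hg1, abs_mul, abs_of_nonneg (χ5 y).1]
      exact (mul_le_mul (χ5 y).2 (hg.bd y) (abs_nonneg _) zero_le_one).trans (by simp)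
    have d2 : DD t R g2 B := by
      refine ⟨(measurable_const.sub χ1.continuous.measurable).mul hg.meas, fun y => ?_, fun y hy => hg.supp y (right_ne_zero_of_mul hy)⟩
      rw [hg2, abs_mul, abs_of_nonneg (by linarith [(χ5 y).2])]
      exact (mul_le_mul (by linarith [(χ5 y).1]) (hg.bd y) (abs_nonneg _) zero_le_one).trans (by simp)
    have hrest := rest_lemma (μ := (volume : Measure 𝔼)) (Metric.isOpen_ball (x := x0) (ε := r / 2)) (X := t * R)
      (fun x hx => (hUD hx).2.le)
      (ss_pos hN) (A := (1 + t * R) / (r / 2) ^ 2) (by positivity) (c := g2) (α := fun _ => 1) (β := fun y => ‖y‖ ^ 2)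
      (θ := fun _ => (r / 2) ^ 2) (y := fun y => y) d2.meas measurable_const (by fun_prop) measurable_id
      (Eventually.of_forall fun y hy => by
        have e1 : (1 + t * R) / (r / 2) ^ 2 * (r / 2) ^ 2 = 1 + t * R := by field_simp
        refine ⟨by positivity, ?_, ?_, ?_⟩
        · rw [e1]; simp; exact htR.le
        · rw [e1]; linarith [(d2.supp y hy).2]
        · intro x hx
          have : QF 1 (‖y‖ ^ 2) y x = ‖x - y‖ ^ 2 := by unfold QF; rw [norm_sub_sq_real]; ring
          rw [this]
          have hy' : r < dist y x0 := by
            by_contra hh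
            push Not at hh
            apply hy
            simp [hg2, χ6 y hh]
          have hx' : dist x x0 < r / 2 := hx
          have := dist_triangle y x x0
          rw [dist_comm y x, dist_eq_norm x y] at this
          exact pow_le_pow_left₀ (by positivity) (by linarith) 2)
      (by
        refine Integrable.mul_const (d2.int.abs) _)
    have hn2 : ∀ x, ∫ y, g2 y * QF 1 (‖y‖ ^ 2) y x ^ (-ss N) = newt g2 x := by
      intro x
      unfold newt
      refine integral_congr_ae (Eventually.of_forall fun y => ?_)
      simp only
      have : QF 1 (‖y‖ ^ 2) y x = ‖x - y‖ ^ 2 := by unfold QF; rw [norm_sub_sq_real]; ring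
      rw [this, sq_pow_ss _ (norm_nonneg _)]
    have hn2' : (fun x => ∫ y, g2 y * QF 1 (‖y‖ ^ 2) y x ^ (-ss N)) = newt g2 := funext hn2
    obtain ⟨p1, -, -, p4⟩ := hrest
    rw [hn2'] at p1 p4
    have p4 := p4 (Eventually.of_forall fun y _ => by simp) rfl
    obtain ⟨q1, q2⟩ := newt_C2 hN g1c g1s
    have hn : ∀ x, newt g x = newt g1 x + newt g2 x := by
      intro x
      unfold newt
      rw [← integral_add (d1.int_newt hN x) (d2.int_newt hN x)]
      refine integral_congr_ae (Eventually.of_forall fun y => ?_)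
      simp only [hg1, hg2]; ring
    have heq : ∀ x ∈ U, Kop t R g x = (cN N)⁻¹ * (newt g1 x + newt g2 x + T x) := by
      intro x hx
      unfold Kop
      rw [(hT3 x hx).2, ← hn]
      congr 2
      simp only [Finset.sum_singleton, sg, if_true, one_mul]
      unfold newt
      refine integral_congr_ae (Eventually.of_forall fun y => ?_)
      simp only [gq_t0]
      rw [sq_pow_ss _ (norm_nonneg _)]
    have hUn : U ∈ 𝓝 x0 := Metric.isOpen_ball.mem_nhds hx0U
    have heq' : Kop t R g =ᶠ[𝓝 x0] fun x => (cN N)⁻¹ * (newt g1 x + newt g2 x + T x) :=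
      Filter.eventually_of_mem hUn heq
    have s1 := q1.contDiffAt (x := x0)
    have s2 := p1.contDiffAt hUn
    have s3 := hT1.contDiffAt hUn
    have s12 : ContDiffAt ℝ 2 (fun x => newt g1 x + newt g2 x) x0 := s1.add s2
    have s123 : ContDiffAt ℝ 2 (fun x => newt g1 x + newt g2 x + T x) x0 := s12.add s3
    refine ⟨((contDiffAt_const (c := (cN N)⁻¹)).mul s123).congr_of_eventuallyEq heq', ?_⟩
    rw [lapE_congr heq', lapE_const_mul _ s123, lapE_add s12 s3, lapE_add s1 s2, q2, p4 x0 hx0U, hT2 x0 hx0U]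
    have : g1 x0 = g x0 := by simp [hg1, χ6 x0 (Metric.mem_closedBall_self hrp.le)]
    rw [this]
    change -((cN N)⁻¹ * (-(cN N) * g x0 + 0 + 0)) = g x0
    field_simp
    ring
  exact ⟨fun x hx => (main x hx).1.contDiffWithinAt, fun x hx => (main x hx).2⟩

lemma kop_bdry {t R : ℝ} (ht : 1 < t) (hR : 0 < R) (g : 𝔼 → ℝ) {x : 𝔼} (hx : ‖x‖ = R ∨ ‖x‖ = t * R) :
    Kop t R g x = 0 := by
  unfold Kop
  rcases hx with hx | hx
  · simp [Gr_inner hR hx]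
  · simp [Gr_outer ht hR hx]

end M8

section M9

lemma young3 {α : Type*} [MeasurableSpace α] (μ : Measure α) {k h : α → ℝ≥0∞} (hk : AEMeasurable k μ) (hh : AEMeasurable h μ)
    {r a s : ℝ} (hr : 0 < r) (ha : 0 < a) (hs : 0 < s) (h1 : 1 / r + 1 / a = 1 + 1 / s)
    (hrs : 1 / s ≤ 1 / r) (has : 1 / s ≤ 1 / a) :
    ∫⁻ y, k y * h y ∂μ ≤ (∫⁻ y, k y ^ r * h y ^ a ∂μ) ^ (1 / s) * (∫⁻ y, k y ^ r ∂μ) ^ (1 / r - 1 / s)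
      * (∫⁻ y, h y ^ a ∂μ) ^ (1 / a - 1 / s) := by
  have h2 := ENNReal.lintegral_prod_norm_pow_le (μ := μ) (Finset.univ : Finset (Fin 3))
    (f := ![fun y => k y ^ r * h y ^ a, fun y => k y ^ r, fun y => h y ^ a])
    (p := ![1 / s, 1 / r - 1 / s, 1 / a - 1 / s])
    (by
      intro i _
      fin_cases i
      · exact (hk.pow_const r).mul (hh.pow_const a)
      · exact hk.pow_const r
      · exact hh.pow_const a)
    (by simp [Fin.sum_univ_three]; simp at h1; linarith)
    (by
      intro i _
      fin_cases i
      · simp; exact hs.le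
      · simpa using hrs
      · simpa using has)
  simp only [Fin.prod_univ_three, Matrix.cons_val_zero, Matrix.cons_val_one, Matrix.cons_val_two, Matrix.head_cons, Matrix.tail_cons] at h2
  refine le_trans (le_of_eq ?_) h2
  refine lintegral_congr fun y => ?_
  have e1 : k y ^ (r * (1 / s)) * k y ^ (r * (1 / r - 1 / s)) = k y := by
    rw [← ENNReal.rpow_add_of_nonneg _ _ (by positivity) (mul_nonneg hr.le (by linarith))]
    have : r * (1 / s) + r * (1 / r - 1 / s) = 1 := by field_simp; ring
    rw [this, ENNReal.rpow_one]
  have e2 : h y ^ (a * (1 / s)) * h y ^ (a * (1 / a - 1 / s)) = h y := by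
    rw [← ENNReal.rpow_add_of_nonneg _ _ (by positivity) (mul_nonneg ha.le (by linarith))]
    have : a * (1 / s) + a * (1 / a - 1 / s) = 1 := by field_simp; ring
    rw [this, ENNReal.rpow_one]
  show k y * h y = (k y ^ r * h y ^ a) ^ (1 / s) * (k y ^ r) ^ (1 / r - 1 / s) * (h y ^ a) ^ (1 / a - 1 / s)
  rw [ENNReal.mul_rpow_of_nonneg _ _ (by positivity), ← ENNReal.rpow_mul, ← ENNReal.rpow_mul, ← ENNReal.rpow_mul, ← ENNReal.rpow_mul]
  calc k y * h y = (k y ^ (r * (1 / s)) * k y ^ (r * (1 / r - 1 / s))) * (h y ^ (a * (1 / s)) * h y ^ (a * (1 / a - 1 / s))) := by rw [e1, e2]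
    _ = _ := by ring

lemma young {α : Type*} [MeasurableSpace α] (μ : Measure α) [SFinite μ] {k : α → α → ℝ≥0∞} (hk : Measurable (Function.uncurry k))
    {h : α → ℝ≥0∞} (hh : Measurable h)
    {r a s : ℝ} (hr : 0 < r) (ha : 0 < a) (hs : 0 < s) (h1 : 1 / r + 1 / a = 1 + 1 / s)
    (hrs : 1 / s ≤ 1 / r) (has : 1 / s ≤ 1 / a) {A : ℝ≥0∞} (hA1 : ∀ᵐ x ∂μ, ∫⁻ y, k x y ^ r ∂μ ≤ A)
    (hA2 : ∀ᵐ y ∂μ, ∫⁻ x, k x y ^ r ∂μ ≤ A) :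
    ∫⁻ x, (∫⁻ y, k x y * h y ∂μ) ^ s ∂μ ≤ A ^ (s / r) * (∫⁻ y, h y ^ a ∂μ) ^ (s / a) := by
  set H := ∫⁻ y, h y ^ a ∂μ with hH
  have hsr : 0 ≤ s / r - 1 := by
    have : s * (1 / s) ≤ s * (1 / r) := by gcongr
    rw [mul_one_div, mul_one_div, div_self hs.ne'] at this; linarith
  have hsa : 0 ≤ s / a - 1 := by
    have : s * (1 / s) ≤ s * (1 / a) := by gcongr
    rw [mul_one_div, mul_one_div, div_self hs.ne'] at this; linarith
  have step : ∀ᵐ x ∂μ, (∫⁻ y, k x y * h y ∂μ) ^ s ≤ (∫⁻ y, k x y ^ r * h y ^ a ∂μ) * (A ^ (s / r - 1) * H ^ (s / a - 1)) := by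
    filter_upwards [hA1] with x hA1
    have hkx : Measurable (k x) := hk.comp measurable_prodMk_left
    have := young3 μ hkx.aemeasurable hh.aemeasurable hr ha hs h1 hrs has
    refine (ENNReal.rpow_le_rpow this hs.le).trans ?_
    rw [ENNReal.mul_rpow_of_nonneg _ _ hs.le, ENNReal.mul_rpow_of_nonneg _ _ hs.le, ← ENNReal.rpow_mul, ← ENNReal.rpow_mul, ← ENNReal.rpow_mul, ← hH]
    have e1 : 1 / s * s = 1 := by field_simp
    have e2 : (1 / r - 1 / s) * s = s / r - 1 := by field_simp
    have e3 : (1 / a - 1 / s) * s = s / a - 1 := by field_simp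
    rw [e1, e2, e3, ENNReal.rpow_one, mul_assoc]
    gcongr
  refine (lintegral_mono_ae step).trans ?_
  have hkr : Measurable (fun p : α × α => k p.1 p.2 ^ r * h p.2 ^ a) :=
    (Measurable.pow_const hk r).mul ((hh.comp measurable_snd).pow_const a)
  rw [lintegral_mul_const'' _ (hkr.lintegral_prod_right').aemeasurable]
  have hswap : ∫⁻ x, ∫⁻ y, k x y ^ r * h y ^ a ∂μ ∂μ ≤ A * H := by
    rw [lintegral_lintegral_swap hkr.aemeasurable]
    calc ∫⁻ y, ∫⁻ x, k x y ^ r * h y ^ a ∂μ ∂μ = ∫⁻ y, (∫⁻ x, k x y ^ r ∂μ) * h y ^ a ∂μ := by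
          refine lintegral_congr fun y => ?_
          have : Measurable (fun x => k x y) := hk.comp measurable_prodMk_right
          rw [lintegral_mul_const _ (this.pow_const r)]
      _ ≤ ∫⁻ y, A * h y ^ a ∂μ := lintegral_mono_ae (by filter_upwards [hA2] with y hy; gcongr)
      _ = A * H := lintegral_const_mul _ (hh.pow_const a)
  calc _ ≤ (A * H) * (A ^ (s / r - 1) * H ^ (s / a - 1)) := by gcongr
    _ = (A ^ (1:ℝ) * A ^ (s / r - 1)) * (H ^ (1:ℝ) * H ^ (s / a - 1)) := by rw [ENNReal.rpow_one, ENNReal.rpow_one]; ring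
    _ = A ^ (s / r) * H ^ (s / a) := by
      rw [← ENNReal.rpow_add_of_nonneg _ _ zero_le_one hsr, ← ENNReal.rpow_add_of_nonneg _ _ zero_le_one hsa]
      congr 2 <;> ring

end M9

section M10
variable {N : ℕ}
local notation "𝔼" => EuclideanSpace ℝ (Fin N)

lemma weak_sub {H : Type*} [NormedAddCommGroup H] [InnerProductSpace ℝ H] [CompleteSpace H]
    [TopologicalSpace.SeparableSpace H] (f : ℕ → H) {M : ℝ} (hf : ∀ n, ‖f n‖ ≤ M) :
    ∃ φ : ℕ → ℕ, StrictMono φ ∧ ∀ ψ : H, ∃ l : ℝ, Tendsto (fun n => ⟪f (φ n), ψ⟫_ℝ) atTop (𝓝 l) := by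
  have hc := WeakDual.isSeqCompact_closedBall ℝ H (0 : StrongDual ℝ H) M
  obtain ⟨a, -, φ, hφ, hlim⟩ := hc (x := fun n => StrongDual.toWeakDual (InnerProductSpace.toDual ℝ H (f n)))
    (fun n => by
      simp only [Set.mem_preimage, Metric.mem_closedBall, dist_zero_right]
      change ‖InnerProductSpace.toDual ℝ H (f n)‖ ≤ M
      rw [LinearIsometryEquiv.norm_map]; exact hf n)
  refine ⟨φ, hφ, fun ψ => ⟨a ψ, ?_⟩⟩
  have := (WeakDual.eval_continuous (𝕜 := ℝ) ψ).tendsto a |>.comp hlim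
  exact this

lemma cauchy_of_approx {X : Type*} [PseudoMetricSpace X] {W : ℕ → X} {A : ℕ → ℕ → X} {δ : ℕ → ℝ}
    (hA : ∀ k, CauchySeq (A k)) (hd : ∀ k n, dist (W n) (A k n) ≤ δ k) (hδ : Tendsto δ atTop (𝓝 0)) :
    CauchySeq W := by
  rw [Metric.cauchySeq_iff]
  intro ε hε
  obtain ⟨k, hk⟩ := ((hδ.eventually (gt_mem_nhds (show 0 < ε / 4 by positivity)))).exists
  obtain ⟨n0, hn0⟩ := Metric.cauchySeq_iff.1 (hA k) (ε / 4) (by positivity)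
  refine ⟨n0, fun m hm n hn => ?_⟩
  have h1 := hd k m
  have h2 := hd k n
  have h3 := hn0 m hm n hn
  have h4 := dist_triangle4 (W m) (A k m) (A k n) (W n)
  rw [dist_comm (A k n)] at h4
  linarith

lemma lp_of_approx {α : Type*} [MeasurableSpace α] {μ : Measure α} [IsFiniteMeasure μ] {q : ℝ} (hq : 1 ≤ q)
    {W : ℕ → α → ℝ} {A : ℕ → ℕ → α → ℝ} {δ : ℕ → ℝ≥0∞} (hW : ∀ n, MemLp (W n) (ENNReal.ofReal q) μ)
    (hAm : ∀ k n, AEStronglyMeasurable (A k n) μ) (hAb : ∀ k, ∃ C : ℝ, ∀ n, ∀ᵐ x ∂μ, ‖A k n x‖ ≤ C)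
    (hAl : ∀ k x, ∃ l, Tendsto (fun n => A k n x) atTop (𝓝 l))
    (hd : ∀ k n, eLpNorm (W n - A k n) (ENNReal.ofReal q) μ ≤ δ k) (hδ : Tendsto δ atTop (𝓝 0)) :
    ∃ u, MemLp u (ENNReal.ofReal q) μ ∧
      Tendsto (fun n => eLpNorm (W n - u) (ENNReal.ofReal q) μ) atTop (𝓝 0) := by
  haveI : Fact (1 ≤ ENNReal.ofReal q) := ⟨by simpa using hq⟩
  choose C hC using hAb
  choose G hG using hAl
  have hAM : ∀ k n, MemLp (A k n) (ENNReal.ofReal q) μ := fun k n => MemLp.of_bound (hAm k n) (C k) (hC k n)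
  have hq0 : ENNReal.ofReal q ≠ 0 := by simpa using (by linarith : 0 < q)
  have hqr : (ENNReal.ofReal q).toReal = q := ENNReal.toReal_ofReal (by linarith)
  have hGm : ∀ k, AEStronglyMeasurable (G k) μ := fun k =>
    aestronglyMeasurable_of_tendsto_ae atTop (hAm k) (Eventually.of_forall fun x => hG k x)
  have hGb : ∀ k, ∀ᵐ x ∂μ, ‖G k x‖ ≤ C k := by
    intro k
    filter_upwards [ae_all_iff.2 (hC k)] with x hx
    exact le_of_tendsto (hG k x).norm (Eventually.of_forall hx)
  have hGM : ∀ k, MemLp (G k) (ENNReal.ofReal q) μ := fun k => MemLp.of_bound (hGm k) (C k) (hGb k)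
  have hAG : ∀ k, Tendsto (fun n => eLpNorm (A k n - G k) (ENNReal.ofReal q) μ) atTop (𝓝 0) := by
    intro k
    have h1 : Tendsto (fun n => ∫⁻ x, ‖A k n x - G k x‖ₑ ^ q ∂μ) atTop (𝓝 (∫⁻ x, 0 ∂μ)) := by
      refine tendsto_lintegral_of_dominated_convergence' (fun _ => ENNReal.ofReal (2 * C k) ^ q) ?_ ?_ ?_ ?_
      · exact fun n => (((hAm k n).sub (hGm k)).enorm).pow_const q
      · intro n
        filter_upwards [hC k n, hGb k] with x h1 h2
        refine ENNReal.rpow_le_rpow ?_ (by linarith)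
        rw [← ofReal_norm_eq_enorm]
        exact ENNReal.ofReal_le_ofReal ((norm_sub_le _ _).trans (by linarith))
      · rw [lintegral_const]
        exact ENNReal.mul_ne_top (ENNReal.rpow_ne_top_of_nonneg (by linarith) ENNReal.ofReal_ne_top) (measure_ne_top _ _)
      · refine Eventually.of_forall fun x => ?_
        have h2 : Tendsto (fun n => ‖A k n x - G k x‖ₑ) atTop (𝓝 0) := by
          have := ((hG k x).sub_const (G k x)).enorm
          simpa using this
        have := (ENNReal.continuous_rpow_const (y := q)).tendsto 0 |>.comp h2
        simpa [ENNReal.zero_rpow_of_pos (show 0 < q by linarith), Function.comp_def] using this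
    have h2 : ∀ n, eLpNorm (A k n - G k) (ENNReal.ofReal q) μ = (∫⁻ x, ‖A k n x - G k x‖ₑ ^ q ∂μ) ^ (1 / q) := by
      intro n
      rw [eLpNorm_eq_lintegral_rpow_enorm_toReal hq0 ENNReal.ofReal_ne_top, hqr]
      rfl
    simp_rw [h2]
    have := (ENNReal.continuous_rpow_const (y := 1 / q)).tendsto _ |>.comp h1
    have h0 : 0 < q := by linarith
    simpa [ENNReal.zero_rpow_of_pos (show 0 < q⁻¹ by positivity), Function.comp_def] using this
  have hcau : CauchySeq (fun n => (hW n).toLp (W n)) := by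
    obtain ⟨k0, hk0⟩ := eventually_atTop.1 (hδ.eventually (gt_mem_nhds ENNReal.zero_lt_top))
    refine cauchy_of_approx (A := fun k n => (hAM (k0 + k) n).toLp _) (δ := fun k => (δ (k0 + k)).toReal) ?_ ?_ ?_
    · intro k
      refine Tendsto.cauchySeq (x := (hGM (k0 + k)).toLp _) ?_
      rw [Lp.tendsto_Lp_iff_tendsto_eLpNorm'']
      exact hAG _
    · intro k n
      rw [dist_eq_norm, ← MemLp.toLp_sub, Lp.norm_toLp]
      have h5 : δ (k0 + k) ≠ ⊤ := (hk0 (k0 + k) (Nat.le_add_right _ _)).ne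
      have h6 := hd (k0 + k) n
      exact ENNReal.toReal_mono h5 h6
    · have h1 : Tendsto (fun k : ℕ => k0 + k) atTop atTop := tendsto_atTop_mono (fun k => Nat.le_add_left k k0) tendsto_id
      have := (ENNReal.tendsto_toReal ENNReal.zero_ne_top).comp (hδ.comp h1)
      simpa [Function.comp_def] using this
  obtain ⟨u, hu⟩ := cauchySeq_tendsto_of_complete hcau
  refine ⟨u, Lp.memLp u, ?_⟩
  rw [← Lp.toLp_coeFn u (Lp.memLp u), Lp.tendsto_Lp_iff_tendsto_eLpNorm''] at hu
  exact hu

end M10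

section M11
variable {N : ℕ}
local notation "𝔼" => EuclideanSpace ℝ (Fin N)

lemma clD (R r : ℝ) {x : 𝔼} (hx : x ∈ closure (DSet N R r)) : R ≤ ‖x‖ ∧ ‖x‖ ≤ r := by
  have hc : IsClosed {x : 𝔼 | R ≤ ‖x‖ ∧ ‖x‖ ≤ r} :=
    (isClosed_le continuous_const continuous_norm).inter (isClosed_le continuous_norm continuous_const)
  have : closure (DSet N R r) ⊆ {x : 𝔼 | R ≤ ‖x‖ ∧ ‖x‖ ≤ r} :=
    closure_minimal (fun y hy => ⟨hy.1.le, hy.2.le⟩) hc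
  exact this hx

lemma frD (R r : ℝ) {x : 𝔼} (hx : x ∈ frontier (DSet N R r)) : ‖x‖ = R ∨ ‖x‖ = r := by
  have h1 := clD R r (frontier_subset_closure hx)
  have h2 : x ∉ DSet N R r := fun h => by
    rw [(D_open R r).frontier_eq] at hx; exact hx.2 h
  by_contra h
  push Not at h
  exact h2 ⟨lt_of_le_of_ne h1.1 (Ne.symm h.1), lt_of_le_of_ne h1.2 h.2⟩

lemma ae_frD (hN : 1 ≤ N) (R r : ℝ) : ∀ᵐ x : 𝔼, x ∉ frontier (DSet N R r) := by
  haveI : Nonempty (Fin N) := ⟨⟨0, by omega⟩⟩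
  have h1 : ∀ s : ℝ, volume {x : 𝔼 | ‖x‖ = s} = 0 := by
    intro s
    have := Measure.addHaar_sphere (volume : Measure 𝔼) 0 s
    rwa [show Metric.sphere (0:𝔼) s = {x : 𝔼 | ‖x‖ = s} by ext; simp] at this
  rw [ae_iff]
  refine measure_mono_null (t := {x : 𝔼 | ‖x‖ = R} ∪ {x : 𝔼 | ‖x‖ = r}) ?_ (measure_union_null (h1 R) (h1 r))
  intro x hx
  simp only [not_not] at hx
  exact frD R r hx

lemma fderiv_off (hN : 1 ≤ N) (R r : ℝ) {w : 𝔼 → ℝ} (h0 : ∀ x, x ∉ DSet N R r → w x = 0) :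
    ∀ᵐ x : 𝔼, x ∉ DSet N R r → fderiv ℝ w x = 0 := by
  filter_upwards [ae_frD hN R r] with x hx hxD
  have h1 : x ∉ closure (DSet N R r) := by
    intro h
    rw [(D_open R r).frontier_eq] at hx
    exact hx ⟨h, hxD⟩
  have h2 : w =ᶠ[𝓝 x] fun _ => 0 := by
    filter_upwards [isClosed_closure.isOpen_compl.mem_nhds h1] with y hy
    exact h0 y fun h => hy (subset_closure h)
  rw [h2.fderiv_eq]; simp

lemma cs_of_off (R r : ℝ) {w : 𝔼 → ℝ} (h0 : ∀ x, x ∉ DSet N R r → w x = 0) : HasCompactSupport w := by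
  refine HasCompactSupport.of_support_subset_isCompact (D_bdd R r).isCompact_closure ?_
  intro x hx
  by_contra h
  exact hx (h0 x fun h' => h (subset_closure h'))

instance finD (R r : ℝ) : IsFiniteMeasure ((volume : Measure 𝔼).restrict (DSet N R r)) :=
  ⟨by simpa using (D_bdd R r).measure_lt_top⟩

lemma kk_neg (e : ℝ) (z : 𝔼) : kk e (-z) = - kk e z := by simp [kk]

/-- error size -/
def Aerr (N : ℕ) (k : ℕ) (ρ r : ℝ) : ℝ≥0∞ :=
  ∫⁻ z in Metric.ball (0 : EuclideanSpace ℝ (Fin N)) ρ, ‖kk ((1 / ((k:ℝ) + 1)) ^ 2) z - kk 0 z‖ₑ ^ r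

lemma Aerr_tendsto (hN : 1 ≤ N) (ρ : ℝ) {r : ℝ} (hr : 0 < r) (hr' : ((N:ℝ) - 1) * r < N) :
    Tendsto (fun k => Aerr N k ρ r) atTop (𝓝 0) := by
  have h0 : Tendsto (fun k => Aerr N k ρ r) atTop (𝓝 (∫⁻ z in Metric.ball (0 : 𝔼) ρ, 0)) := by
    unfold Aerr
    refine tendsto_lintegral_of_dominated_convergence'
      (fun z => ENNReal.ofReal ((2:ℝ) ^ r * ‖z‖ ^ (-(((N:ℝ) - 1) * r)))) ?_ ?_ ?_ ?_
    · exact fun n => ((((kk_meas _).sub (kk_meas _)).enorm).pow_const r).aemeasurable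
    · intro n
      refine Eventually.of_forall fun z => ?_
      dsimp only
      rw [← ofReal_norm_eq_enorm, ENNReal.ofReal_rpow_of_nonneg (norm_nonneg _) hr.le]
      refine ENNReal.ofReal_le_ofReal ?_
      have h1 : ‖kk ((1 / ((n:ℝ) + 1)) ^ 2) z - kk 0 z‖ ≤ 2 * ‖z‖ ^ (-((N:ℝ) - 1)) := by
        refine (norm_sub_le _ _).trans ?_
        linarith [kk_norm_le (sq_nonneg (1 / ((n:ℝ) + 1))) z, kk_norm_le le_rfl z]
      refine (Real.rpow_le_rpow (norm_nonneg _) h1 hr.le).trans (le_of_eq ?_)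
      rw [Real.mul_rpow (by norm_num) (by positivity), ← Real.rpow_mul (norm_nonneg _)]
      congr 2; ring
    · have := ((ker_int0 hN hr' ρ).const_mul ((2:ℝ) ^ r))
      exact (lintegral_ofReal_ne_top_iff_integrable this.aestronglyMeasurable
        (Eventually.of_forall fun z => by positivity)).2 this
    · refine Eventually.of_forall fun z => ?_
      have h1 : Tendsto (fun n : ℕ => 1 / ((n:ℝ) + 1)) atTop (𝓝[>] 0) := by
        rw [tendsto_nhdsWithin_iff]
        exact ⟨tendsto_one_div_add_atTop_nhds_zero_nat, Eventually.of_forall fun n => by simp; positivity⟩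
      have h2 := (((kk_tendsto z).comp h1).sub_const (kk 0 z)).enorm
      have := (ENNReal.continuous_rpow_const (y := r)).tendsto _ |>.comp h2
      simpa [ENNReal.zero_rpow_of_pos hr, Function.comp_def] using this
  simpa using h0

/-- mollified representation -/
def aE (k : ℕ) (w : 𝔼 → ℝ) (x : 𝔼) : ℝ := ∫ y, fderiv ℝ w y (kk ((1 / ((k:ℝ) + 1)) ^ 2) (x - y))

lemma lip_int {w : 𝔼 → ℝ} {K : ℝ≥0} (hN : 1 ≤ N) (hg : LipschitzWith K w) (hc : HasCompactSupport w) (x : 𝔼)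
    {e : ℝ} (he : 0 ≤ e) : Integrable (fun y => fderiv ℝ w y (kk e (x - y))) := by
  refine Integrable.mono' (g := (tsupport w).indicator (fun y => K * ‖x - y‖ ^ (-((N : ℝ) - 1)))) ?_
    (fderiv_kk_meas w e x).aestronglyMeasurable (Eventually.of_forall fun y => lip_kk_le hg x y he)
  rw [integrable_indicator_iff (isClosed_tsupport w).measurableSet]
  exact (ker_int_bdd hN (by linarith) x hc.isCompact.isBounded).const_mul _

lemma aE_err (hN : 3 ≤ N) {R r₂ : ℝ} {w : 𝔼 → ℝ} {K : ℝ≥0} (hg : LipschitzWith K w)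
    (h0 : ∀ x, x ∉ DSet N R r₂ → w x = 0) {q : ℝ} (hq : 2 ≤ q) (k : ℕ) :
    eLpNorm (kp N • w - aE k w) (ENNReal.ofReal q) (volume.restrict (DSet N R r₂)) ≤
      Aerr N k (2 * r₂) (1 / (1 / 2 + 1 / q)) ^ (1 / 2 + 1 / q) *
        (∫⁻ y in DSet N R r₂, ‖fderiv ℝ w y‖ₑ ^ (2:ℝ)) ^ (1 / 2 : ℝ) := by
  have hq0 : 0 < q := by linarith
  have hc := cs_of_off R r₂ h0
  set e := (1 / ((k:ℝ) + 1)) ^ 2 with he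
  set r := 1 / (1 / 2 + 1 / q) with hr
  have hr0 : 0 < r := by positivity
  have h1r : 1 / r = 1 / 2 + 1 / q := by rw [hr, one_div_one_div]
  set μ := (volume : Measure 𝔼).restrict (DSet N R r₂) with hμ
  rw [eLpNorm_eq_lintegral_rpow_enorm_toReal (by simpa using hq0) ENNReal.ofReal_ne_top,
    ENNReal.toReal_ofReal hq0.le]
  have hpt : ∀ x, ‖(kp N • w - aE k w) x‖ₑ ≤ ∫⁻ y, ‖kk e (x - y) - kk 0 (x - y)‖ₑ * ‖fderiv ℝ w y‖ₑ ∂μ := by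
    intro x
    have h1 : (kp N • w - aE k w) x = ∫ y, fderiv ℝ w y (kk 0 (x - y) - kk e (x - y)) := by
      simp only [Pi.sub_apply, Pi.smul_apply, smul_eq_mul, map_sub]
      rw [integral_sub (lip_int (by omega) hg hc x le_rfl) (lip_int (by omega) hg hc x (by positivity)),
        rep (by omega) hg hc x]
      rfl
    rw [h1]
    refine (enorm_integral_le_lintegral_enorm _).trans ?_
    rw [hμ, ← lintegral_indicator (D_open _ _).measurableSet]
    refine lintegral_mono_ae ?_
    filter_upwards [fderiv_off (by omega) R r₂ h0] with y hy
    by_cases hyD : y ∈ DSet N R r₂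
    · rw [Set.indicator_of_mem hyD, mul_comm, ← enorm_neg (kk e (x-y) - _), neg_sub]
      exact ContinuousLinearMap.le_opNorm_enorm _ _
    · rw [hy hyD]; simp
  have hD : ∀ x ∈ DSet N R r₂, DSet N R r₂ ⊆ Metric.ball x (2 * r₂) := by
    intro x hx y hy
    rw [Metric.mem_ball, dist_eq_norm]
    have := norm_sub_le y x
    linarith [hx.2, hy.2]
  have hy1 : ∀ x ∈ DSet N R r₂, ∫⁻ y, ‖kk e (x - y) - kk 0 (x - y)‖ₑ ^ r ∂μ ≤ Aerr N k (2 * r₂) r := by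
    intro x hx
    refine (lintegral_mono_set (hD x hx)).trans ?_
    rw [ker_lint (fun z => ‖kk e z - kk 0 z‖ₑ ^ r)]
    rfl
  have hmk : Measurable (fun p : 𝔼 × 𝔼 => ‖kk e (p.1 - p.2) - kk 0 (p.1 - p.2)‖ₑ) := by
    have : Measurable (fun p : 𝔼 × 𝔼 => p.1 - p.2) := measurable_fst.sub measurable_snd
    exact (((kk_meas e).comp this).sub ((kk_meas 0).comp this)).enorm
  have hY := young μ (k := fun x y => ‖kk e (x - y) - kk 0 (x - y)‖ₑ) hmk
    (h := fun y => ‖fderiv ℝ w y‖ₑ) (measurable_fderiv ℝ w).enorm hr0 (show (0:ℝ) < 2 by norm_num) hq0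
    (by rw [h1r]; ring) (by rw [h1r]; linarith [show (0:ℝ) ≤ 1/2 by norm_num])
    (one_div_le_one_div_of_le (by norm_num) hq) (A := Aerr N k (2 * r₂) r)
    (by
      rw [hμ, ae_restrict_iff' (D_open _ _).measurableSet]
      exact Eventually.of_forall hy1)
    (by
      rw [hμ, ae_restrict_iff' (D_open _ _).measurableSet]
      refine Eventually.of_forall fun y hy => le_trans (le_of_eq ?_) (hy1 y hy)
      refine lintegral_congr fun x => ?_
      rw [show x - y = -(y - x) by abel, kk_neg, kk_neg, ← enorm_neg]
      congr 2; abel)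
  have h2 : ∫⁻ x, ‖(kp N • w - aE k w) x‖ₑ ^ q ∂μ ≤ Aerr N k (2 * r₂) r ^ (q / r) *
      (∫⁻ y, ‖fderiv ℝ w y‖ₑ ^ (2:ℝ) ∂μ) ^ (q / 2) :=
    (lintegral_mono fun x => ENNReal.rpow_le_rpow (hpt x) hq0.le).trans hY
  refine (ENNReal.rpow_le_rpow h2 (by positivity : 0 ≤ 1 / q)).trans (le_of_eq ?_)
  rw [ENNReal.mul_rpow_of_nonneg _ _ (by positivity), ← ENNReal.rpow_mul, ← ENNReal.rpow_mul]
  congr 2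
  · rw [← h1r]; field_simp
  · field_simp

end M11

section M12
variable {N : ℕ}
local notation "𝔼" => EuclideanSpace ℝ (Fin N)

lemma inner_toLp {α : Type*} [MeasurableSpace α] {μ : Measure α} {f g : α → 𝔼} (hf : MemLp f 2 μ) (hg : MemLp g 2 μ) :
    ⟪hf.toLp f, hg.toLp g⟫_ℝ = ∫ x, ⟪f x, g x⟫_ℝ ∂μ := by
  rw [L2.inner_def]
  refine integral_congr_ae ?_
  filter_upwards [hf.coeFn_toLp, hg.coeFn_toLp] with x h1 h2
  rw [h1, h2]

/-- gradient -/
def grd (w : 𝔼 → ℝ) (x : 𝔼) : 𝔼 := (InnerProductSpace.toDual ℝ 𝔼).symm (fderiv ℝ w x)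

lemma grd_norm (w : 𝔼 → ℝ) (x : 𝔼) : ‖grd w x‖ = ‖fderiv ℝ w x‖ := by simp [grd]

lemma grd_inner (w : 𝔼 → ℝ) (x v : 𝔼) : ⟪grd w x, v⟫_ℝ = fderiv ℝ w x v := by simp [grd]

lemma grd_meas (w : 𝔼 → ℝ) : Measurable (grd w) :=
  ((InnerProductSpace.toDual ℝ 𝔼).symm.continuous.measurable).comp (measurable_fderiv ℝ w)

lemma grd_sq_int {w : 𝔼 → ℝ} {K : ℝ≥0} (hw : LipschitzWith K w) (R r : ℝ) :
    IntegrableOn (fun x => ‖fderiv ℝ w x‖ ^ 2) (DSet N R r) := by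
  refine Measure.integrableOn_of_bounded (M := (K:ℝ) ^ 2) ((D_bdd R r).measure_lt_top.ne)
    ((measurable_fderiv ℝ w).norm.pow_const 2).aestronglyMeasurable ?_
  refine Eventually.of_forall fun x => ?_
  rw [Real.norm_eq_abs, abs_of_nonneg (by positivity)]
  exact pow_le_pow_left₀ (norm_nonneg _) (norm_fderiv_le_of_lipschitz ℝ hw) 2

lemma grd_memLp {w : 𝔼 → ℝ} {K : ℝ≥0} (hw : LipschitzWith K w) (R r : ℝ) :
    MemLp (grd w) 2 (volume.restrict (DSet N R r)) := by
  refine MemLp.of_bound (grd_meas w).aestronglyMeasurable K ?_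
  refine Eventually.of_forall fun x => ?_
  rw [grd_norm]
  exact norm_fderiv_le_of_lipschitz ℝ hw

lemma grd_toLp_norm {w : 𝔼 → ℝ} {K : ℝ≥0} (hw : LipschitzWith K w) (R r : ℝ) :
    ‖(grd_memLp hw R r).toLp _‖ ^ 2 = ∫ x in DSet N R r, ‖fderiv ℝ w x‖ ^ 2 := by
  rw [← real_inner_self_eq_norm_sq, inner_toLp]
  refine integral_congr_ae (Eventually.of_forall fun x => ?_)
  dsimp only
  rw [real_inner_self_eq_norm_sq, grd_norm]

lemma aE_meas (k : ℕ) (w : 𝔼 → ℝ) : StronglyMeasurable (aE k w) := by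
  unfold aE
  have h1 : Measurable (fun p : 𝔼 × 𝔼 => fderiv ℝ w p.2 (kk ((1 / ((k:ℝ) + 1)) ^ 2) (p.1 - p.2))) := by
    have h2 : Measurable (fun p : 𝔼 × 𝔼 => kk ((1 / ((k:ℝ) + 1)) ^ 2) (p.1 - p.2)) :=
      (kk_meas _).comp (measurable_fst.sub measurable_snd)
    simp_rw [fun p : 𝔼 × 𝔼 => fderiv_sum_single (f := fderiv ℝ w p.2) (kk ((1 / ((k:ℝ) + 1)) ^ 2) (p.1 - p.2))]
    refine Finset.measurable_fun_sum _ fun i _ =>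
      ((measurable_fderiv_apply_const ℝ w _).comp measurable_snd).mul ?_
    exact (prj i).measurable.comp h2
  exact h1.stronglyMeasurable.integral_prod_right

lemma kk_memLp (hN : 1 ≤ N) (k : ℕ) (x : 𝔼) (R r : ℝ) :
    MemLp (fun y => kk ((1 / ((k:ℝ) + 1)) ^ 2) (x - y)) 2 (volume.restrict (DSet N R r)) := by
  refine MemLp.of_bound ((kk_meas _).comp (measurable_const.sub measurable_id)).aestronglyMeasurable
    (((1 / ((k:ℝ) + 1)) ^ 2) ^ ((1 - (N:ℝ)) / 2)) (Eventually.of_forall fun y => kk_norm_le' hN (by positivity) _)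

lemma aE_inner (hN : 1 ≤ N) {w : 𝔼 → ℝ} {K : ℝ≥0} (hw : LipschitzWith K w) {R r : ℝ}
    (h0 : ∀ x, x ∉ DSet N R r → w x = 0) (k : ℕ) (x : 𝔼) :
    aE k w x = ⟪(grd_memLp hw R r).toLp _, (kk_memLp hN k x R r).toLp _⟫_ℝ := by
  rw [inner_toLp]
  simp_rw [grd_inner]
  unfold aE
  symm
  refine setIntegral_eq_integral_of_ae_compl_eq_zero ?_
  filter_upwards [fderiv_off hN R r h0] with y hy hyD
  rw [hy hyD]; simp

/-- Rellich type compactness -/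
theorem compactness (hN : 3 ≤ N) {R r : ℝ} {q : ℝ} (hq : 2 ≤ q) (hq' : ((N:ℝ) - 2) * q < 2 * N)
    (w : ℕ → 𝔼 → ℝ) (hL : ∀ n, ∃ K, LipschitzWith K (w n)) (h0 : ∀ n, ∀ x, x ∉ DSet N R r → w n x = 0)
    {M : ℝ} (hM : ∀ n, ∫ x in DSet N R r, ‖fderiv ℝ (w n) x‖ ^ 2 ≤ M) :
    ∃ φ : ℕ → ℕ, StrictMono φ ∧ ∃ u, MemLp u (ENNReal.ofReal q) (volume.restrict (DSet N R r)) ∧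
      Tendsto (fun n => eLpNorm (w (φ n) - u) (ENNReal.ofReal q) (volume.restrict (DSet N R r))) atTop (𝓝 0) := by
  have hq0 : 0 < q := by linarith
  have hN1 : 1 ≤ N := by omega
  choose K hK using hL
  haveI : Fact ((1:ℝ≥0∞) ≤ 2) := ⟨by norm_num⟩
  haveI : Fact ((2:ℝ≥0∞) ≠ ∞) := ⟨by norm_num⟩
  have hfb : ∀ n, ‖(grd_memLp (hK n) R r).toLp _‖ ≤ √M := by
    intro n
    apply Real.le_sqrt_of_sq_le
    rw [grd_toLp_norm (hK n)]; exact hM n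
  obtain ⟨φ, hφ, hlim⟩ := weak_sub (fun n => (grd_memLp (hK n) R r).toLp _) hfb
  refine ⟨φ, hφ, ?_⟩
  have hkp := kp_pos hN1
  have hWL : ∀ n, MemLp (w n) (ENNReal.ofReal q) (volume.restrict (DSet N R r)) := by
    intro n
    obtain ⟨C, hC⟩ := (cs_of_off R r (h0 n)).exists_bound_of_continuous (hK n).continuous
    exact MemLp.of_bound (hK n).continuous.aestronglyMeasurable C (Eventually.of_forall hC)
  have hlint : ∀ n, ∫⁻ y in DSet N R r, ‖fderiv ℝ (w n) y‖ₑ ^ (2:ℝ) ≤ ENNReal.ofReal M := by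
    intro n
    have h1 : ∀ y, ‖fderiv ℝ (w n) y‖ₑ ^ (2:ℝ) = ENNReal.ofReal (‖fderiv ℝ (w n) y‖ ^ 2) := by
      intro y
      rw [← ofReal_norm_eq_enorm, ENNReal.ofReal_rpow_of_nonneg (norm_nonneg _) (by norm_num)]
      norm_num
    simp_rw [h1]
    rw [← ofReal_integral_eq_lintegral_ofReal (grd_sq_int (hK n) R r) (Eventually.of_forall fun x => by positivity)]
    exact ENNReal.ofReal_le_ofReal (hM n)
  have hr0 : (0:ℝ) < 1 / 2 + 1 / q := by positivity
  have hN2 : (0:ℝ) < (N:ℝ) - 2 := by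
    have : (3:ℝ) ≤ N := by exact_mod_cast hN
    linarith
  have hA := Aerr_tendsto hN1 (2 * r) (r := 1 / (1 / 2 + 1 / q)) (by positivity) (by
    rw [mul_one_div, div_lt_iff₀ hr0]
    have h1 : ((N:ℝ) - 2) / 2 < N / q := by
      rw [div_lt_div_iff₀ (by norm_num) hq0]; linarith
    have h2 : (N:ℝ) * (1 / 2 + 1 / q) = N / 2 + N / q := by ring
    rw [h2]; linarith)
  obtain ⟨u, hu, hulim⟩ := lp_of_approx (μ := volume.restrict (DSet N R r)) (q := q) (by linarith)
    (W := fun n => kp N • w (φ n)) (A := fun k n => aE k (w (φ n)))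
    (δ := fun k => Aerr N k (2 * r) (1 / (1 / 2 + 1 / q)) ^ (1 / 2 + 1 / q) * (ENNReal.ofReal M) ^ (1 / 2 : ℝ))
    (fun n => (hWL _).const_smul _) (fun k n => (aE_meas k _).aestronglyMeasurable)
    (by
      intro k
      refine ⟨√M * ((volume.restrict (DSet N R r)).real Set.univ ^ (ENNReal.toReal 2)⁻¹ *
        (((1 / ((k:ℝ) + 1)) ^ 2) ^ ((1 - (N:ℝ)) / 2))), fun n => Eventually.of_forall fun x => ?_⟩
      rw [aE_inner hN1 (hK (φ n)) (h0 _)]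
      refine (norm_inner_le_norm _ _).trans ?_
      refine mul_le_mul (hfb _) ?_ (norm_nonneg _) (Real.sqrt_nonneg _)
      refine Lp.norm_le_of_ae_bound (by positivity) ?_
      filter_upwards [(kk_memLp hN1 k x R r).coeFn_toLp] with y hy
      rw [hy]
      exact kk_norm_le' hN1 (by positivity) _)
    (by
      intro k x
      obtain ⟨l, hl⟩ := hlim ((kk_memLp hN1 k x R r).toLp _)
      refine ⟨l, hl.congr fun n => ?_⟩
      exact (aE_inner hN1 (hK (φ n)) (h0 _) k x).symm)
    (by
      intro k n
      refine (aE_err hN (hK (φ n)) (h0 _) hq k).trans ?_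
      gcongr
      exact hlint _)
    (by
      have h1 := (ENNReal.continuous_rpow_const (y := 1 / 2 + 1 / q)).tendsto _ |>.comp hA
      rw [ENNReal.zero_rpow_of_pos hr0] at h1
      have := ENNReal.Tendsto.mul_const (b := (ENNReal.ofReal M) ^ (1 / 2 : ℝ)) h1
        (Or.inr (ENNReal.rpow_ne_top_of_nonneg (by norm_num) ENNReal.ofReal_ne_top))
      simpa [Function.comp_def] using this)
  refine ⟨(kp N)⁻¹ • u, hu.const_smul _, ?_⟩
  have h3 : ∀ n, w (φ n) - (kp N)⁻¹ • u = (kp N)⁻¹ • (kp N • w (φ n) - u) := by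
    intro n
    rw [smul_sub, smul_smul, inv_mul_cancel₀ hkp.ne', one_smul]
  simp_rw [h3, eLpNorm_const_smul]
  have := ENNReal.Tendsto.const_mul (a := ‖(kp N)⁻¹‖ₑ) hulim (Or.inr enorm_ne_top)
  simpa using this

end M12

section M13
variable {N : ℕ}
local notation "𝔼" => EuclideanSpace ℝ (Fin N)

/-- admissible functions -/
def Adm (R r : ℝ) (w : 𝔼 → ℝ) : Prop := (∃ K, LipschitzWith K w) ∧ ∀ x, x ∉ DSet N R r → w x = 0

lemma lip_ind {R r : ℝ} {f : 𝔼 → ℝ} {K : ℝ≥0} (hf : LipschitzOnWith K f (closure (DSet N R r)))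
    (hfr : ∀ x ∈ frontier (DSet N R r), f x = 0) : Adm R r ((DSet N R r).indicator f) := by
  refine ⟨⟨K, ?_⟩, fun x hx => Set.indicator_of_notMem hx _⟩
  have key : ∀ x y, x ∈ DSet N R r → y ∉ DSet N R r → |f x| ≤ K * dist x y := by
    intro x y hx hy
    obtain ⟨z, hz1, hz2⟩ : ∃ z ∈ segment ℝ x y, z ∈ frontier (DSet N R r) := by
      by_contra hcon
      push Not at hcon
      have hfr : ∀ z ∈ segment ℝ x y, z ∉ DSet N R r → z ∉ closure (DSet N R r) := by
        intro z hz h1 h2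
        refine hcon z hz ?_
        rw [(D_open R r).frontier_eq]
        exact ⟨h2, h1⟩
      obtain ⟨z, -, hz1, hz2⟩ := (convex_segment (𝕜 := ℝ) x y).isPreconnected (DSet N R r)
        (closure (DSet N R r))ᶜ (D_open R r) isClosed_closure.isOpen_compl
        (fun z hz => by
          by_cases h : z ∈ DSet N R r
          · exact Or.inl h
          · exact Or.inr (hfr z hz h))
        ⟨x, left_mem_segment _ _ _, hx⟩ ⟨y, right_mem_segment _ _ _, hfr y (right_mem_segment _ _ _) hy⟩
      exact hz2 (subset_closure hz1)
    have h1 := hf.dist_le_mul x (subset_closure hx) z (frontier_subset_closure hz2)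
    rw [hfr z hz2, Real.dist_eq, sub_zero] at h1
    have h2 := dist_add_dist_of_mem_segment hz1
    refine h1.trans (mul_le_mul_of_nonneg_left ?_ K.2)
    linarith [dist_nonneg (x := z) (y := y)]
  refine LipschitzWith.of_dist_le_mul fun x y => ?_
  by_cases hx : x ∈ DSet N R r <;> by_cases hy : y ∈ DSet N R r
  · rw [Set.indicator_of_mem hx, Set.indicator_of_mem hy]
    exact hf.dist_le_mul x (subset_closure hx) y (subset_closure hy)
  · rw [Set.indicator_of_mem hx, Set.indicator_of_notMem hy, Real.dist_eq, sub_zero]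
    exact key x y hx hy
  · rw [Set.indicator_of_notMem hx, Set.indicator_of_mem hy, Real.dist_eq, zero_sub, abs_neg, dist_comm]
    exact key y x hy hx
  · rw [Set.indicator_of_notMem hx, Set.indicator_of_notMem hy, dist_self]
    positivity

namespace Adm
variable {R r : ℝ} {w φ : EuclideanSpace ℝ (Fin N) → ℝ}

lemma cont (h : Adm R r w) : Continuous w := h.1.choose_spec.continuous
lemma cs (h : Adm R r w) : HasCompactSupport w := cs_of_off R r h.2
lemma bdd (h : Adm R r w) : ∃ C, ∀ x, ‖w x‖ ≤ C := h.cs.exists_bound_of_continuous h.cont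
lemma memLp (h : Adm R r w) (q : ℝ≥0∞) (μ : Measure 𝔼) [IsFiniteMeasure μ] : MemLp w q μ := by
  obtain ⟨C, hC⟩ := h.bdd
  exact MemLp.of_bound h.cont.aestronglyMeasurable C (Eventually.of_forall hC)
lemma smul (h : Adm R r w) (c : ℝ) : Adm R r (fun x => c * w x) := by
  obtain ⟨⟨K, hK⟩, h0⟩ := h
  exact ⟨⟨_, (lipschitzWith_smul c).comp hK⟩, fun x hx => by simp [h0 x hx]⟩
lemma add (h : Adm R r w) (h' : Adm R r φ) : Adm R r (fun x => w x + φ x) := by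
  obtain ⟨⟨K, hK⟩, h0⟩ := h
  obtain ⟨⟨K', hK'⟩, h0'⟩ := h'
  exact ⟨⟨_, hK.add hK'⟩, fun x hx => by simp [h0 x hx, h0' x hx]⟩
lemma abs (h : Adm R r w) : Adm R r (fun x => |w x|) := by
  obtain ⟨⟨K, hK⟩, h0⟩ := h
  refine ⟨⟨K, LipschitzWith.of_dist_le_mul fun x y => ?_⟩, fun x hx => by simp [h0 x hx]⟩
  refine le_trans ?_ (hK.dist_le_mul x y)
  exact abs_abs_sub_abs_le _ _
lemma diff (h : Adm R r w) : ∀ᵐ x, DifferentiableAt ℝ w x := h.1.choose_spec.ae_differentiableAt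
lemma tsup (h : Adm R r w) : tsupport w ⊆ closure (DSet N R r) := by
  refine closure_mono fun x hx => ?_
  by_contra h'
  exact hx (h.2 x h')
lemma grdLp (h : Adm R r w) : MemLp (grd w) 2 (volume.restrict (DSet N R r)) := grd_memLp h.1.choose_spec R r
lemma sqInt (h : Adm R r w) : IntegrableOn (fun x => ‖fderiv ℝ w x‖ ^ 2) (DSet N R r) :=
  grd_sq_int h.1.choose_spec R r
end Adm

lemma clD_Unb {t R : ℝ} (ht : 1 < t) (hR : 0 < R) : closure (DSet N R (t * R)) ⊆ Unb N t R := by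
  intro x hx
  have h1 := clD _ _ hx
  have h2 : 1 < √t := by rw [Real.lt_sqrt (by norm_num)]; simpa using ht
  refine ⟨lt_of_lt_of_le ?_ h1.1, lt_of_le_of_lt h1.2 ?_⟩
  · rw [div_lt_iff₀ (by positivity)]; nlinarith
  · have : 0 < t * R := by positivity
    nlinarith

/-- cut-off extension of C^1 function -/
lemma lip_of_Unb {t R : ℝ} (ht : 1 < t) (hR : 0 < R) {f : 𝔼 → ℝ} (hf : ContDiffOn ℝ 1 f (Unb N t R)) :
    ∃ K, LipschitzOnWith K f (closure (DSet N R (t * R))) := by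
  obtain ⟨χ, h1, h2, h3, h4, h5⟩ := exists_cutoff (D_bdd (N := N) R (t * R)).isCompact_closure (Unb_open t R)
    (clD_Unb ht hR)
  have hC : ContDiff ℝ 1 (fun x => χ x * f x) := by
    rw [contDiff_iff_contDiffAt]
    intro x
    by_cases hx : x ∈ tsupport χ
    · exact (h1.of_le (by norm_num)).contDiffAt.mul (hf.contDiffAt ((Unb_open t R).mem_nhds (h3 hx)))
    · have : (fun x => χ x * f x) =ᶠ[𝓝 x] fun _ => 0 := by
        filter_upwards [(isClosed_tsupport χ).isOpen_compl.mem_nhds hx] with y hy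
        rw [image_eq_zero_of_notMem_tsupport hy, zero_mul]
      exact contDiffAt_const.congr_of_eventuallyEq this
  obtain ⟨K, hK⟩ := hC.lipschitzWith_of_hasCompactSupport h2.mul_right (by norm_num)
  refine ⟨K, fun x hx y hy => ?_⟩
  have hx1 := h4.self_of_nhdsSet x hx
  have hy1 := h4.self_of_nhdsSet y hy
  have := hK x y
  simpa [hx1, hy1] using this

lemma adm_Kop (hN : 3 ≤ N) {t R B : ℝ} (ht : 1 < t) (hR : 0 < R) {g : 𝔼 → ℝ} (hg : DD t R g B) :
    Adm R (t * R) ((DSet N R (t * R)).indicator (Kop t R g)) := by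
  obtain ⟨K, hK⟩ := lip_of_Unb ht hR (kop_near hN ht hR hg).2.1
  exact lip_ind hK fun x hx => kop_bdry ht hR g (frD _ _ hx)

lemma fderiv_ind {R r : ℝ} (f : 𝔼 → ℝ) {x : 𝔼} (hx : x ∈ DSet N R r) :
    fderiv ℝ ((DSet N R r).indicator f) x = fderiv ℝ f x := by
  refine Filter.EventuallyEq.fderiv_eq ?_
  filter_upwards [(D_open R r).mem_nhds hx] with y hy
  exact Set.indicator_of_mem hy _

lemma inner_grd (w φ : 𝔼 → ℝ) (x : 𝔼) : ⟪grd w x, grd φ x⟫_ℝ =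
    ∑ i, fderiv ℝ w x (EuclideanSpace.single i 1) * fderiv ℝ φ x (EuclideanSpace.single i 1) := by
  rw [grd_inner, fderiv_sum_single]
  refine Finset.sum_congr rfl fun i _ => ?_
  congr 1
  rw [← grd_inner φ, EuclideanSpace.inner_single_right]
  simp

/-- integration by parts against test functions which are C^2 near the closure of `D` -/
lemma test_ibp (hN : 3 ≤ N) {t R : ℝ} (ht : 1 < t) (hR : 0 < R) {φ w : 𝔼 → ℝ} (hw : Adm R (t * R) w)
    (hφ : ContDiffOn ℝ 2 φ (Unb N t R)) :
    ∫ x in DSet N R (t * R), ⟪grd w x, grd ((DSet N R (t * R)).indicator φ) x⟫_ℝ =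
      ∫ x in DSet N R (t * R), w x * (-lapE φ x) := by
  obtain ⟨K, hK⟩ := hw.1
  have h1 := ibp2 hK hw.cs (Unb_open t R) (hw.tsup.trans (clD_Unb ht hR)) hφ
  have h2 : ∫ x in DSet N R (t * R), ⟪grd w x, grd ((DSet N R (t * R)).indicator φ) x⟫_ℝ =
      ∫ x, ∑ i, fderiv ℝ w x (EuclideanSpace.single i 1) * fderiv ℝ φ x (EuclideanSpace.single i 1) := by
    have h3 : ∫ x in DSet N R (t * R), (∑ i, fderiv ℝ w x (EuclideanSpace.single i 1) *
        fderiv ℝ φ x (EuclideanSpace.single i 1)) =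
        ∫ x, ∑ i, fderiv ℝ w x (EuclideanSpace.single i 1) * fderiv ℝ φ x (EuclideanSpace.single i 1) := by
      refine setIntegral_eq_integral_of_ae_compl_eq_zero ?_
      filter_upwards [fderiv_off (by omega) R (t * R) hw.2] with x hx hxD
      rw [hx hxD]; simp
    rw [← h3]
    refine setIntegral_congr_fun (D_open _ _).measurableSet fun x hx => ?_
    rw [inner_grd, fderiv_ind φ hx]
  rw [h2, h1, ← integral_neg]
  rw [← setIntegral_eq_integral_of_forall_compl_eq_zero (s := DSet N R (t * R))]
  · refine integral_congr_ae (Eventually.of_forall fun x => ?_)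
    dsimp only; ring
  · intro x hx
    rw [hw.2 x hx]; simp

lemma test_Kop (hN : 3 ≤ N) {t R B : ℝ} (ht : 1 < t) (hR : 0 < R) {g w : 𝔼 → ℝ} (hg : DD t R g B)
    (hw : Adm R (t * R) w) (hg1 : ContDiff ℝ 1 g) (hg2 : HasCompactSupport g) :
    ∫ x in DSet N R (t * R), ⟪grd w x, grd ((DSet N R (t * R)).indicator (Kop t R g)) x⟫_ℝ =
      ∫ x in DSet N R (t * R), w x * g x := by
  rw [test_ibp hN ht hR hw ((kop_near hN ht hR hg).2.2 hg1 hg2)]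
  refine setIntegral_congr_fun (D_open _ _).measurableSet fun x hx => ?_
  rw [(kop_C2 hN ht hR hg hg1.contDiffOn).2 x hx]

/-- Dirichlet energy expansions -/
def Dir (R r : ℝ) (w : 𝔼 → ℝ) : ℝ := ∫ x in DSet N R r, ‖fderiv ℝ w x‖ ^ 2

lemma Dir_add {R r : ℝ} {w φ : 𝔼 → ℝ} (hw : Adm R r w) (hφ : Adm R r φ) (s : ℝ) :
    Dir R r (fun x => w x + s * φ x) =
      Dir R r w + 2 * s * (∫ x in DSet N R r, ⟪grd w x, grd φ x⟫_ℝ) + s ^ 2 * Dir R r φ := by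
  unfold Dir
  have h0 : IntegrableOn (fun x => ⟪grd w x, grd φ x⟫_ℝ) (DSet N R r) := by
    have := L2.integrable_inner (𝕜 := ℝ) (hw.grdLp.toLp _) (hφ.grdLp.toLp _)
    refine this.congr ?_
    filter_upwards [hw.grdLp.coeFn_toLp, hφ.grdLp.coeFn_toLp] with x h1 h2
    rw [h1, h2]
  rw [← integral_const_mul, ← integral_const_mul, ← integral_add hw.sqInt (h0.const_mul (2 * s))]
  have h5 : Integrable (fun a => ‖fderiv ℝ w a‖ ^ 2 + 2 * s * ⟪grd w a, grd φ a⟫_ℝ)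
    (volume.restrict (DSet N R r)) := hw.sqInt.add (h0.const_mul (2 * s))
  rw [← integral_add h5 (hφ.sqInt.const_mul (s ^ 2))]
  refine integral_congr_ae ?_
  filter_upwards [ae_restrict_of_ae hw.diff, ae_restrict_of_ae hφ.diff] with x h1 h2
  have h3 : fderiv ℝ (fun x => w x + s * φ x) x = fderiv ℝ w x + s • fderiv ℝ φ x := by
    have := (h1.hasFDerivAt.add (h2.hasFDerivAt.const_mul s)).fderiv
    exact this
  have h4 : grd (fun x => w x + s * φ x) x = grd w x + s • grd φ x := by
    unfold grd; rw [h3, map_add, map_smul]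
  rw [← grd_norm, h4, ← grd_norm w, ← grd_norm φ, norm_add_sq_real, norm_smul, inner_smul_right, mul_pow,
    Real.norm_eq_abs, sq_abs]
  ring

lemma Dir_smul {R r : ℝ} {w : 𝔼 → ℝ} (hw : Adm R r w) (s : ℝ) :
    Dir R r (fun x => s * w x) = s ^ 2 * Dir R r w := by
  unfold Dir
  rw [← integral_const_mul]
  refine integral_congr_ae ?_
  filter_upwards [ae_restrict_of_ae hw.diff] with x h1
  rw [show fderiv ℝ (fun x => s * w x) x = s • fderiv ℝ w x from (h1.hasFDerivAt.const_mul s).fderiv,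
    norm_smul, mul_pow, Real.norm_eq_abs, sq_abs]

lemma Dir_nonneg (R r : ℝ) (w : 𝔼 → ℝ) : 0 ≤ Dir R r w := integral_nonneg fun x => by positivity

lemma fderiv_abs_le (w : 𝔼 → ℝ) (hw : Continuous w) (x : 𝔼) : ‖fderiv ℝ (fun y => |w y|) x‖ ≤ ‖fderiv ℝ w x‖ := by
  rcases lt_trichotomy (w x) 0 with h | h | h
  · have : (fun y => |w y|) =ᶠ[𝓝 x] fun y => - w y := by
      filter_upwards [hw.continuousAt.eventually (gt_mem_nhds h)] with y hy
      exact abs_of_neg hy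
    rw [this.fderiv_eq, fderiv_fun_neg, norm_neg]
  · have : IsLocalMin (fun y => |w y|) x := Eventually.of_forall fun y => by simp [h]
    rw [this.fderiv_eq_zero]; simp
  · have : (fun y => |w y|) =ᶠ[𝓝 x] fun y => w y := by
      filter_upwards [hw.continuousAt.eventually (lt_mem_nhds h)] with y hy
      exact abs_of_pos hy
    rw [this.fderiv_eq]

lemma Dir_abs {R r : ℝ} {w : 𝔼 → ℝ} (hw : Adm R r w) : Dir R r (fun x => |w x|) ≤ Dir R r w := by
  refine integral_mono hw.abs.sqInt hw.sqInt fun x => ?_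
  exact pow_le_pow_left₀ (norm_nonneg _) (fderiv_abs_le w hw.cont x) 2

end M13

section M14
variable {N : ℕ}
local notation "𝔼" => EuclideanSpace ℝ (Fin N)

/-- weighted measure on the annulus -/
def nu (N : ℕ) (R r : ℝ) : Measure (EuclideanSpace ℝ (Fin N)) :=
  (volume.restrict (DSet N R r)).withDensity (fun x => ENNReal.ofReal (1 / (2 * ‖x‖)))

lemma nu_dm : Measurable (fun x : 𝔼 => ENNReal.ofReal (1 / (2 * ‖x‖))) := by fun_prop

lemma nu_le {R r : ℝ} (hR : 0 < R) : nu N R r ≤ ENNReal.ofReal (1 / (2 * R)) • volume.restrict (DSet N R r) := by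
  rw [← withDensity_const]
  refine withDensity_mono ?_
  rw [EventuallyLE, ae_restrict_iff' (D_open _ _).measurableSet]
  refine Eventually.of_forall fun x hx => ENNReal.ofReal_le_ofReal ?_
  exact one_div_le_one_div_of_le (by positivity) (by linarith [hx.1])

lemma nu_fin {R r : ℝ} (hR : 0 < R) : IsFiniteMeasure (nu N R r) := by
  refine ⟨lt_of_le_of_lt (nu_le hR _) ?_⟩
  simp only [Measure.smul_apply, smul_eq_mul]
  exact ENNReal.mul_lt_top ENNReal.ofReal_lt_top (measure_lt_top _ _)

lemma nu_ac' {R r : ℝ} (hR : 0 < R) : (volume.restrict (DSet N R r)) ≪ nu N R r := by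
  refine withDensity_absolutelyContinuous' nu_dm.aemeasurable ?_
  rw [ae_restrict_iff' (D_open _ _).measurableSet]
  refine Eventually.of_forall fun x hx => ?_
  have : 0 < ‖x‖ := hR.trans hx.1
  simp [this]

lemma nu_ac (R r : ℝ) : nu N R r ≪ (volume.restrict (DSet N R r)) := withDensity_absolutelyContinuous _ _

lemma int_nu (R r : ℝ) (f : 𝔼 → ℝ) : ∫ x, f x ∂(nu N R r) = ∫ x in DSet N R r, f x / (2 * ‖x‖) := by
  unfold nu
  rw [integral_withDensity_eq_integral_toReal_smul nu_dm (Eventually.of_forall fun x => ENNReal.ofReal_lt_top)]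
  refine integral_congr_ae (Eventually.of_forall fun x => ?_)
  dsimp only
  rw [ENNReal.toReal_ofReal (by positivity), smul_eq_mul]; ring

lemma memLp_nu {R r : ℝ} (hR : 0 < R) {q : ℝ≥0∞} {f : 𝔼 → ℝ} (hf : MemLp f q (volume.restrict (DSet N R r))) :
    MemLp f q (nu N R r) := hf.of_measure_le_smul ENNReal.ofReal_ne_top (nu_le hR)

lemma tendsto_nu {R r : ℝ} (hR : 0 < R) {q : ℝ≥0∞} {f : ℕ → 𝔼 → ℝ}
    (hf : Tendsto (fun n => eLpNorm (f n) q (volume.restrict (DSet N R r))) atTop (𝓝 0)) :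
    Tendsto (fun n => eLpNorm (f n) q (nu N R r)) atTop (𝓝 0) := by
  by_cases hc : ENNReal.ofReal (1 / (2 * R)) = 0
  · have : 0 < 1 / (2 * R) := by positivity
    rw [ENNReal.ofReal_eq_zero] at hc; linarith
  have h1 : ∀ n, eLpNorm (f n) q (nu N R r) ≤
      ENNReal.ofReal (1 / (2 * R)) ^ (1 / q).toReal * eLpNorm (f n) q (volume.restrict (DSet N R r)) := by
    intro n
    refine (eLpNorm_mono_measure _ (nu_le hR)).trans ?_
    rw [eLpNorm_smul_measure_of_ne_zero hc, smul_eq_mul]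
  have h2 := ENNReal.Tendsto.const_mul (a := ENNReal.ofReal (1 / (2 * R)) ^ (1 / q).toReal) hf
    (Or.inr (ENNReal.rpow_ne_top_of_nonneg ENNReal.toReal_nonneg ENNReal.ofReal_ne_top))
  rw [mul_zero] at h2
  exact tendsto_of_tendsto_of_tendsto_of_le_of_le tendsto_const_nhds h2 (fun n => zero_le) h1

/-- weighted norm -/
def nq (R r q : ℝ) (w : 𝔼 → ℝ) : ℝ := (eLpNorm w (ENNReal.ofReal q) (nu N R r)).toReal

lemma nq_nonneg (R r q : ℝ) (w : 𝔼 → ℝ) : 0 ≤ nq R r q w := ENNReal.toReal_nonneg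

lemma nq_smul (R r q : ℝ) (w : 𝔼 → ℝ) (c : ℝ) : nq R r q (fun x => c * w x) = |c| * nq R r q w := by
  unfold nq
  rw [show (fun x => c * w x) = c • w from rfl, eLpNorm_const_smul, ENNReal.toReal_mul]
  simp

lemma nq_abs (R r q : ℝ) (w : 𝔼 → ℝ) : nq R r q (fun x => |w x|) = nq R r q w := by
  unfold nq
  congr 1
  exact eLpNorm_norm w

lemma nq_rpow {R r q : ℝ} (hq : 0 < q) {w : 𝔼 → ℝ} (hw : MemLp w (ENNReal.ofReal q) (nu N R r)) :
    nq R r q w ^ q = ∫ x, |w x| ^ q ∂(nu N R r) := by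
  unfold nq
  have h0 : 0 ≤ ∫ x, |w x| ^ q ∂(nu N R r) := integral_nonneg fun x => by positivity
  rw [hw.eLpNorm_eq_integral_rpow_norm (by simpa using hq) ENNReal.ofReal_ne_top, ENNReal.toReal_ofReal hq.le]
  simp only [Real.norm_eq_abs]
  rw [ENNReal.toReal_ofReal (by positivity), Real.rpow_inv_rpow h0 hq.ne']

lemma nq_pos {R r q : ℝ} (hR : 0 < R) (hq : 0 < q) {w : 𝔼 → ℝ} (hw : Adm R r w) {x : 𝔼} (hx : w x ≠ 0) :
    0 < nq R r q w := by
  haveI := nu_fin (N := N) (r := r) hR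
  refine lt_of_le_of_ne (nq_nonneg _ _ _ _) fun h => ?_
  unfold nq at h
  have h1 := ((ENNReal.toReal_eq_zero_iff _).1 h.symm).resolve_right (hw.memLp _ _).2.ne
  rw [eLpNorm_eq_zero_iff hw.cont.aestronglyMeasurable (by simpa using hq)] at h1
  have h2 := (nu_ac' hR).ae_eq h1
  have h3 : w =ᵐ[volume] 0 := by
    rw [EventuallyEq, ae_restrict_iff' (D_open _ _).measurableSet] at h2
    filter_upwards [h2] with y hy
    by_cases hyD : y ∈ DSet N R r
    · exact hy hyD
    · exact hw.2 y hyD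
  have h4 := (Continuous.ae_eq_iff_eq volume hw.cont continuous_zero).1 h3
  exact hx (congrFun h4 x)

/-- total quadratic form -/
def Qf (R r lam : ℝ) (w : 𝔼 → ℝ) : ℝ := Dir R r w + lam * ∫ x, w x ^ 2 ∂(nu N R r)

lemma Qf_nonneg {R r lam : ℝ} (hl : 0 < lam) (w : 𝔼 → ℝ) : 0 ≤ Qf R r lam w :=
  add_nonneg (Dir_nonneg _ _ _) (mul_nonneg hl.le (integral_nonneg fun x => by positivity))

lemma Qf_smul {R r lam : ℝ} {w : 𝔼 → ℝ} (hw : Adm R r w) (s : ℝ) :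
    Qf R r lam (fun x => s * w x) = s ^ 2 * Qf R r lam w := by
  unfold Qf
  rw [Dir_smul hw]
  simp_rw [mul_pow]
  rw [integral_const_mul]; ring

lemma Qf_abs {R r lam : ℝ} {w : 𝔼 → ℝ} (hw : Adm R r w) : Qf R r lam (fun x => |w x|) ≤ Qf R r lam w := by
  unfold Qf
  simp_rw [sq_abs]
  linarith [Dir_abs hw]

lemma sq_int_nu {R r : ℝ} (hR : 0 < R) {w φ : 𝔼 → ℝ} (hw : Adm R r w) (hφ : Adm R r φ) :
    Integrable (fun x => w x * φ x) (nu N R r) := by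
  haveI := nu_fin (N := N) (r := r) hR
  exact (hw.memLp 2 _).integrable_mul (hφ.memLp 2 _)

lemma Qf_add {R r lam : ℝ} (hR : 0 < R) {w φ : 𝔼 → ℝ} (hw : Adm R r w) (hφ : Adm R r φ) (s : ℝ) :
    Qf R r lam (fun x => w x + s * φ x) = Qf R r lam w +
      2 * s * ((∫ x in DSet N R r, ⟪grd w x, grd φ x⟫_ℝ) + lam * ∫ x, w x * φ x ∂(nu N R r)) +
      s ^ 2 * Qf R r lam φ := by
  unfold Qf
  rw [Dir_add hw hφ]
  have h1 : ∫ x, (w x + s * φ x) ^ 2 ∂(nu N R r) = ∫ x, w x ^ 2 ∂(nu N R r) +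
      2 * s * ∫ x, w x * φ x ∂(nu N R r) + s ^ 2 * ∫ x, φ x ^ 2 ∂(nu N R r) := by
    have i1 : Integrable (fun x => w x ^ 2) (nu N R r) := by simpa [sq] using sq_int_nu hR hw hw
    have i2 : Integrable (fun x => φ x ^ 2) (nu N R r) := by simpa [sq] using sq_int_nu hR hφ hφ
    have i3 := (sq_int_nu hR hw hφ).const_mul (2 * s)
    rw [← integral_const_mul, ← integral_const_mul, ← integral_add i1 i3]
    have i4 : Integrable (fun x => w x ^ 2 + 2 * s * (w x * φ x)) (nu N R r) := i1.add i3
    rw [← integral_add i4 (i2.const_mul _)]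
    refine integral_congr_ae (Eventually.of_forall fun x => ?_)
    dsimp only; ring
  rw [h1]; ring

/-- the minimal level -/
def Clev (N : ℕ) (R r lam q : ℝ) : ℝ :=
  sInf {a | ∃ w : EuclideanSpace ℝ (Fin N) → ℝ, Adm R r w ∧ nq R r q w = 1 ∧ a = Qf R r lam w}

lemma Clev_bdd {R r lam q : ℝ} (hl : 0 < lam) :
    BddBelow {a | ∃ w : EuclideanSpace ℝ (Fin N) → ℝ, Adm R r w ∧ nq R r q w = 1 ∧ a = Qf R r lam w} :=
  ⟨0, by rintro a ⟨w, -, -, rfl⟩; exact Qf_nonneg hl w⟩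

lemma exists_pt (hN : 1 ≤ N) {R r : ℝ} (hR : 0 < R) (hr : R < r) : ∃ x : 𝔼, x ∈ DSet N R r := by
  refine ⟨EuclideanSpace.single ⟨0, by omega⟩ ((R + r) / 2), ?_, ?_⟩ <;>
  · rw [EuclideanSpace.norm_single, Real.norm_eq_abs, abs_of_pos (by linarith)]; linarith

lemma Clev_ne (hN : 1 ≤ N) {R r lam q : ℝ} (hR : 0 < R) (hr : R < r) (hq : 0 < q) :
    {a | ∃ w : EuclideanSpace ℝ (Fin N) → ℝ, Adm R r w ∧ nq R r q w = 1 ∧ a = Qf R r lam w}.Nonempty := by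
  obtain ⟨x, hx⟩ := exists_pt hN hR hr
  have hc : IsClosed (DSet N R r)ᶜ := (D_open R r).isClosed_compl
  have hne : (DSet N R r)ᶜ.Nonempty := ⟨0, fun h => by have := h.1; simp at this; linarith⟩
  have hw : Adm R r (fun y : 𝔼 => Metric.infDist y (DSet N R r)ᶜ) := by
    refine ⟨⟨1, Metric.lipschitz_infDist_pt _⟩, fun y hy => ?_⟩
    exact Metric.infDist_zero_of_mem hy
  have hpos : Metric.infDist x (DSet N R r)ᶜ ≠ 0 := by
    intro h
    exact ((hc.mem_iff_infDist_zero hne).2 h) hx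
  have h1 := nq_pos hR hq hw (x := x) hpos
  refine ⟨_, _, hw.smul (nq R r q (fun y : 𝔼 => Metric.infDist y (DSet N R r)ᶜ))⁻¹, ?_, rfl⟩
  rw [nq_smul, abs_of_pos (inv_pos.2 h1), inv_mul_cancel₀ h1.ne']

lemma Clev_nonneg (hN : 1 ≤ N) {R r lam q : ℝ} (hR : 0 < R) (hr : R < r) (hq : 0 < q) (hl : 0 < lam) :
    0 ≤ Clev N R r lam q :=
  le_csInf (Clev_ne hN hR hr hq) (by rintro a ⟨w, -, -, rfl⟩; exact Qf_nonneg hl w)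

lemma Clev_ineq {R r lam q : ℝ} (hl : 0 < lam) {w : 𝔼 → ℝ} (hw : Adm R r w) :
    Clev N R r lam q * nq R r q w ^ 2 ≤ Qf R r lam w := by
  rcases (nq_nonneg R r q w).eq_or_lt with h | h
  · rw [← h]; simpa using Qf_nonneg hl w
  have h1 : Clev N R r lam q ≤ Qf R r lam (fun x => (nq R r q w)⁻¹ * w x) :=
    csInf_le (Clev_bdd hl) ⟨_, hw.smul _, by rw [nq_smul, abs_of_pos (inv_pos.2 h), inv_mul_cancel₀ h.ne'], rfl⟩
  rw [Qf_smul hw, inv_pow, inv_mul_eq_div, le_div_iff₀ (by positivity)] at h1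
  exact h1

/-- existence of a minimising sequence converging in `L^q` -/
lemma min_seq (hN : 3 ≤ N) {R r lam q : ℝ} (hR : 0 < R) (hr : R < r) (hq : 2 ≤ q) (hq' : ((N:ℝ) - 2) * q < 2 * N)
    (hl : 0 < lam) : ∃ (w : ℕ → 𝔼 → ℝ) (u : 𝔼 → ℝ), (∀ n, Adm R r (w n)) ∧ (∀ n, nq R r q (w n) = 1) ∧
      Tendsto (fun n => Qf R r lam (w n)) atTop (𝓝 (Clev N R r lam q)) ∧ Measurable u ∧ (∀ x, 0 ≤ u x) ∧
      MemLp u (ENNReal.ofReal q) (volume.restrict (DSet N R r)) ∧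
      Tendsto (fun n => eLpNorm (w n - u) (ENNReal.ofReal q) (volume.restrict (DSet N R r))) atTop (𝓝 0) := by
  obtain ⟨a, -, ha, haS⟩ := exists_seq_tendsto_sInf (Clev_ne (N := N) (lam := lam) (by omega) hR hr
    (show 0 < q by linarith)) (Clev_bdd hl)
  choose w0 hw0 h1 h2 using haS
  have hw : ∀ n, Adm R r (fun x => |w0 n x|) := fun n => (hw0 n).abs
  have hn1 : ∀ n, nq R r q (fun x => |w0 n x|) = 1 := fun n => by rw [nq_abs, h1]
  have hQ : Tendsto (fun n => Qf R r lam (fun x => |w0 n x|)) atTop (𝓝 (Clev N R r lam q)) := by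
    refine tendsto_of_tendsto_of_tendsto_of_le_of_le tendsto_const_nhds ha (fun n => ?_) (fun n => ?_)
    · exact csInf_le (Clev_bdd hl) ⟨_, hw n, hn1 n, rfl⟩
    · rw [h2]; exact Qf_abs (hw0 n)
  obtain ⟨M, hM⟩ := hQ.bddAbove_range
  obtain ⟨φ, hφ, u, hu, hlim⟩ := compactness hN hq hq' (fun n x => |w0 n x|) (fun n => (hw n).1) (fun n => (hw n).2)
    (M := M) (fun n => by
      have h3 : Qf R r lam (fun x => |w0 n x|) ≤ M := hM ⟨n, rfl⟩
      have h4 : 0 ≤ lam * ∫ x, |w0 n x| ^ 2 ∂(nu N R r) := mul_nonneg hl.le (integral_nonneg fun x => by positivity)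
      unfold Qf Dir at h3
      linarith)
  obtain ⟨u', hu'm, hu'⟩ := hu.1.aemeasurable
  have hu'' : (fun x => |u' x|) =ᵐ[volume.restrict (DSet N R r)] fun x => |u x| := by
    filter_upwards [hu'] with x hx; rw [hx]
  refine ⟨fun n x => |w0 (φ n) x|, fun x => |u' x|, fun n => hw _, fun n => hn1 _, hQ.comp hφ.tendsto_atTop,
    hu'm.abs, fun x => abs_nonneg _, ?_, ?_⟩
  · exact (memLp_congr_ae hu'').2 hu.abs
  · refine tendsto_of_tendsto_of_tendsto_of_le_of_le tendsto_const_nhds hlim (fun n => zero_le) (fun n => ?_)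
    refine eLpNorm_mono_ae ?_
    filter_upwards [hu''] with x hx
    simp only [Pi.sub_apply, Real.norm_eq_abs]
    rw [hx]
    have := abs_abs_sub_abs_le (|w0 (φ n) x|) (u x)
    rwa [abs_abs] at this

end M14

section M15
variable {N : ℕ}
local notation "𝔼" => EuclideanSpace ℝ (Fin N)

lemma int_lim {α : Type*} [MeasurableSpace α] {μ : Measure α} [IsFiniteMeasure μ] {q : ℝ} (hq : 1 ≤ q)
    {f : ℕ → α → ℝ} {u g : α → ℝ} (hf : ∀ n, MemLp (f n) (ENNReal.ofReal q) μ) (hu : MemLp u (ENNReal.ofReal q) μ)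
    (h : Tendsto (fun n => eLpNorm (f n - u) (ENNReal.ofReal q) μ) atTop (𝓝 0))
    (hg : AEStronglyMeasurable g μ) {G : ℝ} (hG : ∀ x, |g x| ≤ G) :
    Tendsto (fun n => ∫ x, f n x * g x ∂μ) atTop (𝓝 (∫ x, u x * g x ∂μ)) := by
  have hq1 : (1:ℝ≥0∞) ≤ ENNReal.ofReal q := by rw [← ENNReal.ofReal_one]; exact ENNReal.ofReal_le_ofReal hq
  have i1 : ∀ v : α → ℝ, MemLp v (ENNReal.ofReal q) μ → Integrable (fun x => v x * g x) μ := fun v hv => by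
    have := (hv.integrable hq1).bdd_mul (c := G) hg (Eventually.of_forall hG)
    simpa [mul_comm] using this
  refine tendsto_integral_of_L1' _ (i1 u hu).1 (Eventually.of_forall fun n => i1 _ (hf n)) ?_
  have hb : ∀ n, eLpNorm ((fun x => f n x * g x) - fun x => u x * g x) 1 μ ≤
      ENNReal.ofReal G * (eLpNorm (f n - u) (ENNReal.ofReal q) μ *
        μ Set.univ ^ (1 / (1:ℝ≥0∞).toReal - 1 / (ENNReal.ofReal q).toReal)) := fun n => by
    refine (eLpNorm_le_mul_eLpNorm_of_ae_le_mul (g := f n - u) (c := G) (Eventually.of_forall fun x => ?_) 1).trans ?_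
    · simp only [Pi.sub_apply, Real.norm_eq_abs]
      rw [← sub_mul, abs_mul, mul_comm]
      exact mul_le_mul_of_nonneg_right (hG x) (abs_nonneg _)
    · gcongr
      exact eLpNorm_le_eLpNorm_mul_rpow_measure_univ hq1 ((hf n).1.sub hu.1)
  refine tendsto_of_tendsto_of_tendsto_of_le_of_le tendsto_const_nhds ?_ (fun n => zero_le) hb
  have hfin : μ Set.univ ^ (1 / (1:ℝ≥0∞).toReal - 1 / (ENNReal.ofReal q).toReal) ≠ ∞ := by
    refine (ENNReal.rpow_lt_top_of_nonneg ?_ (measure_ne_top _ _)).ne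
    rw [ENNReal.toReal_ofReal (by linarith)]
    have : 1 / q ≤ 1 := by rw [div_le_one (by linarith)]; exact hq
    simp; simpa using this
  have h2 := ENNReal.Tendsto.mul_const h (Or.inr hfin)
  have h3 := ENNReal.Tendsto.const_mul (a := ENNReal.ofReal G) h2 (Or.inr ENNReal.ofReal_ne_top)
  simpa using h3

lemma nq_lim {R r q : ℝ} (hq : 1 ≤ q) {f : ℕ → 𝔼 → ℝ} {u : 𝔼 → ℝ}
    (hf : ∀ n, MemLp (f n) (ENNReal.ofReal q) (nu N R r)) (hu : MemLp u (ENNReal.ofReal q) (nu N R r))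
    (h : Tendsto (fun n => eLpNorm (f n - u) (ENNReal.ofReal q) (nu N R r)) atTop (𝓝 0)) :
    Tendsto (fun n => nq R r q (f n)) atTop (𝓝 (nq R r q u)) := by
  haveI : Fact (1 ≤ ENNReal.ofReal q) := ⟨by rw [← ENNReal.ofReal_one]; exact ENNReal.ofReal_le_ofReal hq⟩
  have h1 := (Lp.tendsto_Lp_iff_tendsto_eLpNorm'' f hf u hu).2 h
  have h2 := h1.norm
  simp only [Lp.norm_toLp] at h2
  exact h2

lemma holder_u {R r q : ℝ} (hq : 1 < q) {u v : 𝔼 → ℝ} (hu0 : ∀ x, 0 ≤ u x)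
    (hu : MemLp u (ENNReal.ofReal q) (nu N R r)) (hv : MemLp v (ENNReal.ofReal q) (nu N R r))
    (hu1 : nq R r q u = 1) : Integrable (fun x => v x * u x ^ (q - 1)) (nu N R r) ∧
    ∫ x, v x * u x ^ (q - 1) ∂(nu N R r) ≤ nq R r q v := by
  have hq0 : 0 < q := by linarith
  have hpq : q.HolderConjugate (q / (q - 1)) := Real.HolderConjugate.conjExponent hq
  have hm : MemLp (fun x => u x ^ (q - 1)) (ENNReal.ofReal (q / (q - 1))) (nu N R r) := by
    have := hu.norm_rpow_div (ENNReal.ofReal (q - 1))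
    rw [ENNReal.toReal_ofReal (by linarith), ← ENNReal.ofReal_div_of_pos (by linarith)] at this
    refine (memLp_congr_ae (Eventually.of_forall fun x => ?_)).1 this
    simp only [Real.norm_eq_abs, abs_of_nonneg (hu0 x)]
  haveI : ENNReal.HolderConjugate (ENNReal.ofReal q) (ENNReal.ofReal (q / (q - 1))) := hpq.ennrealOfReal
  have hIntg : Integrable (fun x => v x * u x ^ (q - 1)) (nu N R r) := hv.integrable_mul hm
  refine ⟨hIntg, ?_⟩
  have h1 := integral_mul_le_Lp_mul_Lq_of_nonneg hpq (μ := nu N R r) (f := fun x => |v x|) (g := fun x => u x ^ (q - 1))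
    (Eventually.of_forall fun x => abs_nonneg _) (Eventually.of_forall fun x => rpow_nonneg (hu0 x) _) hv.abs hm
  have h2 : ∫ x, (u x ^ (q - 1)) ^ (q / (q - 1)) ∂(nu N R r) = 1 := by
    have h3 := nq_rpow hq0 hu
    rw [hu1, one_rpow] at h3
    refine Eq.trans ?_ h3.symm
    refine integral_congr_ae (Eventually.of_forall fun x => ?_)
    simp only [abs_of_nonneg (hu0 x)]
    rw [← rpow_mul (hu0 x), mul_div_cancel₀ _ (by linarith)]
  rw [h2, one_rpow, mul_one, ← nq_rpow hq0 hv, ← rpow_mul (nq_nonneg _ _ _ _), mul_one_div, div_self hq0.ne', rpow_one] at h1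
  refine le_trans (integral_mono hIntg ?_ fun x => ?_) h1
  · have := hIntg.abs
    refine this.congr (Eventually.of_forall fun x => ?_)
    simp only [abs_mul, abs_of_nonneg (rpow_nonneg (hu0 x) (q-1))]
  · exact mul_le_mul_of_nonneg_right (le_abs_self _) (rpow_nonneg (hu0 x) _)

lemma quad_eq {C I L E : ℝ} (h : ∀ s : ℝ, 0 ≤ 1 + s * I → C * (1 + s * I) ^ 2 ≤ C + 2 * s * L + s ^ 2 * E) : L = C * I := by
  have h0 : ∃ δ > 0, ∀ s : ℝ, |s| < δ → 0 ≤ 1 + s * I := by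
    refine ⟨1 / (|I| + 1), by positivity, fun s hs => ?_⟩
    rw [lt_div_iff₀ (by positivity)] at hs
    have : |s * I| ≤ 1 := by rw [abs_mul]; nlinarith [abs_nonneg s, abs_nonneg I]
    linarith [neg_abs_le (s * I)]
  obtain ⟨δ, hδ, hs⟩ := h0
  have key : ∀ s : ℝ, |s| < δ → 0 ≤ s * (2 * (L - C * I)) + s ^ 2 * (E - C * I ^ 2) := fun s hs' => by
    have := h s (hs s hs'); nlinarith
  by_contra hne
  set a := 2 * (L - C * I) with ha
  set b := E - C * I ^ 2 with hb
  have ha0 : a ≠ 0 := by intro h; apply hne; linarith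
  -- choose s = -ε * a
  have hε : ∃ ε > 0, |(-ε) * a| < δ ∧ ε * |b| < 1 := by
    refine ⟨min (δ / (2 * |a|)) (1 / (2 * (|b| + 1))), by positivity, ?_, ?_⟩
    · rw [abs_mul, abs_neg, abs_of_pos (by positivity)]
      calc _ ≤ δ / (2 * |a|) * |a| := by gcongr; exact min_le_left _ _
        _ = δ / 2 := by have := abs_pos.2 ha0; field_simp
        _ < δ := by linarith
    · calc _ ≤ 1 / (2 * (|b| + 1)) * |b| := by gcongr; exact min_le_right _ _
        _ < 1 := by rw [div_mul_eq_mul_div, div_lt_one (by positivity)]; linarith [abs_nonneg b]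
  obtain ⟨ε, e0, e1, e2⟩ := hε
  have h3 := key _ e1
  have h4 : 0 < a ^ 2 := by positivity
  have h5 : ε * b < 1 := lt_of_le_of_lt (mul_le_mul_of_nonneg_left (le_abs_self b) e0.le) e2
  have h6 : -ε * a * a + (-ε * a) ^ 2 * b = ε * a ^ 2 * (ε * b - 1) := by ring
  rw [h6] at h3
  have : 0 < ε * a ^ 2 := by positivity
  nlinarith

end M15

section M16
variable {N : ℕ}
local notation "𝔼" => EuclideanSpace ℝ (Fin N)

lemma euler {t R lam q : ℝ} (hN : 3 ≤ N) (ht : 1 < t) (hR : 0 < R) (hl : 0 < lam) (hq : 2 ≤ q)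
    {w : ℕ → 𝔼 → ℝ} {u : 𝔼 → ℝ} (hw : ∀ n, Adm R (t*R) (w n)) (hw1 : ∀ n, nq R (t*R) q (w n) = 1)
    (hQ : Tendsto (fun n => Qf R (t*R) lam (w n)) atTop (𝓝 (Clev N R (t*R) lam q)))
    (hu0 : ∀ x, 0 ≤ u x) (hu : MemLp u (ENNReal.ofReal q) (volume.restrict (DSet N R (t*R))))
    (hlim : Tendsto (fun n => eLpNorm (w n - u) (ENNReal.ofReal q) (volume.restrict (DSet N R (t*R)))) atTop (𝓝 0)) :
    nq R (t*R) q u = 1 ∧ ∀ (g : 𝔼 → ℝ) (B : ℝ), DD t R g B → ContDiff ℝ 1 g → HasCompactSupport g →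
      (∫ x in DSet N R (t*R), u x * g x) + lam * ∫ x, u x * (DSet N R (t*R)).indicator (Kop t R g) x ∂(nu N R (t*R))
        = Clev N R (t*R) lam q * ∫ x, (DSet N R (t*R)).indicator (Kop t R g) x * u x ^ (q-1) ∂(nu N R (t*R)) := by
  haveI := nu_fin (N := N) (r := t*R) hR
  have huν : MemLp u (ENNReal.ofReal q) (nu N R (t*R)) := memLp_nu hR hu
  have hlν := tendsto_nu hR hlim
  have hwν : ∀ n, MemLp (w n) (ENNReal.ofReal q) (nu N R (t*R)) := fun n => (hw n).memLp _ _
  have hu1 : nq R (t*R) q u = 1 := by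
    have := nq_lim (by linarith) hwν huν hlν
    simp only [hw1] at this
    exact tendsto_nhds_unique this tendsto_const_nhds
  refine ⟨hu1, fun g B hg hg1 hg2 => ?_⟩
  set φ := (DSet N R (t*R)).indicator (Kop t R g) with hφd
  have hφ : Adm R (t*R) φ := adm_Kop hN ht hR hg
  have hφν : MemLp φ (ENNReal.ofReal q) (nu N R (t*R)) := hφ.memLp _ _
  obtain ⟨Bφ, hBφ⟩ := hφ.bdd
  set I := ∫ x, φ x * u x ^ (q-1) ∂(nu N R (t*R)) with hI
  refine quad_eq (E := Qf R (t*R) lam φ) fun s hs => ?_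
  have hsφ : MemLp (fun x => u x + s * φ x) (ENNReal.ofReal q) (nu N R (t*R)) := huν.add (hφν.const_mul s)
  have hnl : Tendsto (fun n => nq R (t*R) q (fun x => w n x + s * φ x)) atTop (𝓝 (nq R (t*R) q (fun x => u x + s * φ x))) := by
    refine nq_lim (by linarith) (fun n => (hwν n).add (hφν.const_mul s)) hsφ ?_
    refine hlν.congr fun n => ?_
    congr 1; ext x; simp
  have hI1 : 1 + s * I ≤ nq R (t*R) q (fun x => u x + s * φ x) := by
    refine le_trans (le_of_eq ?_) (holder_u (by linarith) hu0 huν hsφ hu1).2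
    have i1 := (holder_u (by linarith) hu0 huν huν hu1).1
    have i2 := (holder_u (by linarith) hu0 huν hφν hu1).1
    have e1 : ∫ x, u x * u x ^ (q-1) ∂(nu N R (t*R)) = 1 := by
      have h3 := nq_rpow (by linarith) huν
      rw [hu1, one_rpow] at h3
      refine Eq.trans ?_ h3.symm
      refine integral_congr_ae (Eventually.of_forall fun x => ?_)
      simp only [abs_of_nonneg (hu0 x)]
      rcases (hu0 x).eq_or_lt with h | h
      · rw [← h, zero_mul, zero_rpow (by linarith)]
      · rw [rpow_sub h, rpow_one]; field_simp
    have e2 : ∫ x, (u x * u x ^ (q-1) + s * (φ x * u x ^ (q-1))) ∂(nu N R (t*R)) = 1 + s * I := by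
      rw [integral_add i1 (i2.const_mul s), e1, integral_const_mul]
    rw [← e2]
    refine integral_congr_ae (Eventually.of_forall fun x => ?_)
    dsimp only; ring
  have l1 := int_lim (by linarith) (fun n => (hw n).memLp (ENNReal.ofReal q) (volume.restrict (DSet N R (t*R)))) hu hlim
    (g := g) hg.meas.aestronglyMeasurable hg.bd
  have l2 := int_lim (by linarith) hwν huν hlν (g := φ) hφν.1 hBφ
  have hlim2 := (hQ.add ((l1.add (l2.const_mul lam)).const_mul (2 * s))).add_const (s ^ 2 * Qf R (t*R) lam φ)
  have h5 := le_of_tendsto_of_tendsto' ((hnl.pow 2).const_mul (Clev N R (t*R) lam q)) hlim2 fun n => by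
    have h6 := Clev_ineq (q := q) hl ((hw n).add (hφ.smul s))
    rw [Qf_add hR (hw n) hφ s, test_Kop hN ht hR hg (hw n) hg1 hg2] at h6
    exact h6
  refine le_trans ?_ h5
  have hC := Clev_nonneg (N := N) (lam := lam) (q := q) (by omega) hR (show R < t * R by nlinarith) (by linarith) hl
  gcongr

end M16

section M17
variable {N : ℕ}
local notation "𝔼" => EuclideanSpace ℝ (Fin N)

/-- the Riesz kernel -/
def rk (N : ℕ) (a : ℝ) (x y : EuclideanSpace ℝ (Fin N)) : ℝ≥0∞ := ENNReal.ofReal (‖x - y‖ ^ (-a))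

lemma rk_meas (a : ℝ) : Measurable (Function.uncurry (rk N a)) := by
  unfold rk Function.uncurry
  fun_prop

lemma rk_symm (a : ℝ) (x y : 𝔼) : rk N a x y = rk N a y x := by
  unfold rk; rw [norm_sub_rev]

lemma rk_unif (hN : 1 ≤ N) {a : ℝ} (ha : a < N) (R r : ℝ) : ∃ A : ℝ≥0∞, A ≠ ∞ ∧ ∀ x : 𝔼, ‖x‖ ≤ r →
    ∫⁻ y in DSet N R r, rk N a x y ≤ A := by
  refine ⟨∫⁻ z in Metric.ball (0:𝔼) (2 * r), ENNReal.ofReal (‖z‖ ^ (-a)), ?_, fun x hx => ?_⟩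
  · have := (ker_int0 hN ha (2 * r)).2
    have h2 := this.ne
    convert h2 using 2 with x
    ext x
    rw [← ofReal_norm_eq_enorm, Real.norm_eq_abs, abs_of_nonneg (rpow_nonneg (norm_nonneg _) _)]
  · rw [← ker_lint _ x]
    unfold rk
    refine lintegral_mono_set fun y hy => ?_
    rw [Metric.mem_ball, dist_eq_norm]
    have := hy.2
    calc _ ≤ ‖y‖ + ‖x‖ := norm_sub_le _ _
      _ < _ := by linarith

lemma gr_le (hN : 3 ≤ N) {t R : ℝ} (ht : 1 < t) (hR : 0 < R) : ∃ C : ℝ, 0 < C ∧ ∀ x : 𝔼, R ≤ ‖x‖ → ‖x‖ ≤ t * R →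
    ∀ᵐ y ∂(volume.restrict (DSet N R (t*R))), ‖Gr t R x y‖ₑ ≤ ENNReal.ofReal C * rk N ((N:ℝ)-2) x y := by
  obtain ⟨C, hC, h⟩ := Gr_bound hN ht hR (N := N)
  refine ⟨C, hC, fun x h1 h2 => ?_⟩
  haveI : Nonempty (Fin N) := ⟨⟨0, by omega⟩⟩
  rw [ae_restrict_iff' (D_open _ _).measurableSet]
  have h3 : ∀ᵐ y : 𝔼, y ≠ x := by
    rw [ae_iff]; simp
  filter_upwards [h3] with y hy hyD
  unfold rk
  rw [← ENNReal.ofReal_mul hC.le, ← ofReal_norm_eq_enorm]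
  exact ENNReal.ofReal_le_ofReal (h x y h1 h2 hyD hy.symm)

lemma kop_le (hN : 3 ≤ N) {t R : ℝ} (ht : 1 < t) (hR : 0 < R) : ∃ C : ℝ≥0∞, C ≠ ∞ ∧ ∀ (f : 𝔼 → ℝ) (x : 𝔼), R ≤ ‖x‖ → ‖x‖ ≤ t * R →
    ‖Kop t R ((DSet N R (t*R)).indicator f) x‖ₑ ≤ C * ∫⁻ y in DSet N R (t*R), rk N ((N:ℝ)-2) x y * ‖f y‖ₑ := by
  obtain ⟨C, hC, h⟩ := gr_le hN ht hR (N := N)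
  refine ⟨‖(cN N)⁻¹‖ₑ * ENNReal.ofReal C, ENNReal.mul_ne_top enorm_ne_top ENNReal.ofReal_ne_top, fun f x h1 h2 => ?_⟩
  unfold Kop
  rw [enorm_mul, mul_assoc]
  gcongr
  have e1 : ∫ y, (DSet N R (t*R)).indicator f y * Gr t R x y = ∫ y in DSet N R (t*R), f y * Gr t R x y := by
    rw [← integral_indicator (D_open _ _).measurableSet]
    congr 1; ext y
    by_cases hy : y ∈ DSet N R (t*R) <;> simp [hy]
  rw [e1]
  refine (enorm_integral_le_lintegral_enorm _).trans ?_
  rw [← lintegral_const_mul' _ _ ENNReal.ofReal_ne_top]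
  refine lintegral_mono_ae ?_
  filter_upwards [h x h1 h2] with y hy
  rw [enorm_mul, mul_comm, ← mul_assoc]
  gcongr

lemma gr_prod (hN : 3 ≤ N) {t R : ℝ} (ht : 1 < t) (hR : 0 < R) {f : 𝔼 → ℝ}
    (hf : Integrable f (volume.restrict (DSet N R (t*R)))) :
    Integrable (fun p : 𝔼 × 𝔼 => f p.1 * Gr t R p.2 p.1)
      ((volume.restrict (DSet N R (t*R))).prod (volume.restrict (DSet N R (t*R)))) := by
  obtain ⟨C, hC, h⟩ := gr_le hN ht hR (N := N)
  obtain ⟨A, hA, hA2⟩ := rk_unif (N := N) (by omega) (show (N:ℝ) - 2 < N by linarith) R (t*R)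
  have hm : AEStronglyMeasurable (fun p : 𝔼 × 𝔼 => f p.1 * Gr t R p.2 p.1)
      ((volume.restrict (DSet N R (t*R))).prod (volume.restrict (DSet N R (t*R)))) := by
    refine hf.1.comp_fst.mul ?_
    exact ((Gr_meas t R).comp measurable_swap).aestronglyMeasurable
  refine ⟨hm, ?_⟩
  unfold HasFiniteIntegral
  rw [lintegral_prod _ hm.enorm]
  refine lt_of_le_of_lt (b := ∫⁻ x in DSet N R (t*R), ‖f x‖ₑ * (ENNReal.ofReal C * A)) ?_ ?_
  · refine lintegral_mono_ae ?_
    filter_upwards [ae_restrict_mem (D_open R (t*R)).measurableSet] with x hx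
    have e1 : ∫⁻ y in DSet N R (t*R), ‖f x * Gr t R y x‖ₑ = ‖f x‖ₑ * ∫⁻ y in DSet N R (t*R), ‖Gr t R x y‖ₑ := by
      rw [← lintegral_const_mul' _ _ enorm_ne_top]
      refine lintegral_congr fun y => ?_
      rw [enorm_mul, Gr_symm]
    rw [e1]
    gcongr
    refine (lintegral_mono_ae (h x hx.1.le hx.2.le)).trans ?_
    rw [lintegral_const_mul' _ _ ENNReal.ofReal_ne_top]
    gcongr
    exact hA2 x hx.2.le
  · rw [lintegral_mul_const' _ _ (ENNReal.mul_ne_top ENNReal.ofReal_ne_top hA)]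
    exact ENNReal.mul_lt_top hf.2 (ENNReal.mul_lt_top ENNReal.ofReal_lt_top hA.lt_top)

/-- the integral equation from the Euler-Lagrange identity -/
lemma int_eq (hN : 3 ≤ N) {t R : ℝ} (ht : 1 < t) (hR : 0 < R) {u f : 𝔼 → ℝ}
    (hf : Integrable f (volume.restrict (DSet N R (t*R)))) (hu : Integrable u (volume.restrict (DSet N R (t*R))))
    (h : ∀ (g : 𝔼 → ℝ) (B : ℝ), DD t R g B → ContDiff ℝ 1 g → HasCompactSupport g →
      ∫ x in DSet N R (t*R), u x * g x = ∫ x in DSet N R (t*R), f x * Kop t R g x) :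
    ∀ᵐ x ∂(volume.restrict (DSet N R (t*R))), u x = Kop t R ((DSet N R (t*R)).indicator f) x := by
  set μ := (volume : Measure 𝔼).restrict (DSet N R (t*R)) with hμ
  have hK : ∀ (g : 𝔼 → ℝ) x, (∀ y, g y ≠ 0 → y ∈ DSet N R (t*R)) → Kop t R g x = (cN N)⁻¹ * ∫ y, g y * Gr t R x y ∂μ := fun g x hg => by
    unfold Kop
    rw [hμ, setIntegral_eq_integral_of_forall_compl_eq_zero]
    intro y hy
    by_contra hne
    exact hy (hg y (left_ne_zero_of_mul hne))
  have hK2 : ∀ x, Kop t R ((DSet N R (t*R)).indicator f) x = (cN N)⁻¹ * ∫ y, f y * Gr t R x y ∂μ := fun x => by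
    rw [hK]
    · congr 1
      refine integral_congr_ae ?_
      filter_upwards [ae_restrict_mem (D_open R (t*R)).measurableSet] with y hy
      rw [Set.indicator_of_mem hy]
    · intro y hy; by_contra hn; exact hy (by simp [hn])
  have hP := gr_prod hN ht hR hf
  have hV : Integrable (fun x => Kop t R ((DSet N R (t*R)).indicator f) x) μ := by
    simp only [hK2]
    exact (hP.integral_prod_right).const_mul _
  have hd := hu.sub hV
  have hz := (D_open R (t*R)).ae_eq_zero_of_integral_contDiff_smul_eq_zero (μ := volume) (f := u - fun x => Kop t R ((DSet N R (t*R)).indicator f) x)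
    (IntegrableOn.locallyIntegrableOn hd) (fun g hg hgc hgs => ?_)
  · rw [hμ, ae_restrict_iff' (D_open _ _).measurableSet]
    filter_upwards [hz] with x hx hxD
    have := hx hxD
    simp only [Pi.sub_apply] at this
    linarith
  · obtain ⟨B, hB⟩ := hgc.exists_bound_of_continuous hg.continuous
    have hgD : ∀ y, g y ≠ 0 → y ∈ DSet N R (t*R) := fun y hy => hgs (subset_tsupport _ hy)
    have hDD : DD t R g B := ⟨hg.continuous.measurable, hB, hgD⟩
    have h1 := h g B hDD (hg.of_le (by exact_mod_cast le_top)) hgc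
    have e0 : ∫ x, g x • (u - fun x => Kop t R ((DSet N R (t*R)).indicator f) x) x
        = ∫ x, (u x * g x - Kop t R ((DSet N R (t*R)).indicator f) x * g x) ∂μ := by
      rw [hμ, setIntegral_eq_integral_of_forall_compl_eq_zero]
      · congr 1; ext x; simp; ring
      · intro x hx
        have : g x = 0 := by by_contra hn; exact hx (hgD x hn)
        simp [this]
    have bm : ∀ v : 𝔼 → ℝ, Integrable v μ → Integrable (fun x => v x * g x) μ := fun v hv => by
      have := hv.bdd_mul (c := B) hg.continuous.aestronglyMeasurable (Eventually.of_forall hB)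
      simpa [mul_comm] using this
    rw [e0, integral_sub (bm u hu) (bm _ hV), h1, sub_eq_zero]
    -- Fubini
    have e1 : ∀ x, f x * Kop t R g x = (cN N)⁻¹ * ∫ y, g y * (f x * Gr t R y x) ∂μ := fun x => by
      rw [hK g x hgD, ← mul_assoc, mul_comm (f x), mul_assoc, ← integral_const_mul]
      congr 2; ext y; rw [Gr_symm x y]; ring
    have e2 : ∀ y, Kop t R ((DSet N R (t*R)).indicator f) y * g y = (cN N)⁻¹ * ∫ x, g y * (f x * Gr t R y x) ∂μ := fun y => by
      rw [hK2, integral_const_mul]; ring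
    simp only [e1, e2, integral_const_mul]
    congr 1
    have hP2 : Integrable (Function.uncurry fun x y => g y * (f x * Gr t R y x)) (μ.prod μ) := by
      refine hP.bdd_mul (c := B) (f := fun p : 𝔼 × 𝔼 => g p.2) ?_ (Eventually.of_forall fun p => hB p.2)
      exact (hg.continuous.comp continuous_snd).aestronglyMeasurable
    have := integral_integral_swap hP2
    simpa only [integral_const_mul] using this

end M17

section M18
variable {N : ℕ}
local notation "𝔼" => EuclideanSpace ℝ (Fin N)

lemma rk_rpow (a r : ℝ) (hr : 0 ≤ r) (x y : 𝔼) : rk N a x y ^ r = rk N (a * r) x y := by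
  unfold rk
  rw [ENNReal.ofReal_rpow_of_nonneg (rpow_nonneg (norm_nonneg _) _) hr, ← rpow_mul (norm_nonneg _), neg_mul]

lemma boot_step (hN : 3 ≤ N) {R r p σ d : ℝ} (hp : 1 < p) (hσ : σ * (p + 1) ≤ 1) (hd : 0 < d) (hdσ : d < σ)
    (hdN : d + (p - 1) * σ < 2 / N) {c : ℝ≥0∞} (hc : c ≠ ∞) {W : 𝔼 → ℝ≥0∞} (hW : Measurable W)
    (h : ∀ᵐ x ∂(volume.restrict (DSet N R r)), W x ≤ 1 + c * ∫⁻ y in DSet N R r, rk N ((N:ℝ)-2) x y * W y ^ p)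
    (hfin : ∫⁻ y in DSet N R r, W y ^ (1 / σ) ≠ ∞) :
    ∫⁻ y in DSet N R r, W y ^ (1 / (σ - d)) ≠ ∞ := by
  set μ := (volume : Measure 𝔼).restrict (DSet N R r) with hμ
  have hN0 : (3:ℝ) ≤ N := by exact_mod_cast hN
  have hσ0 : 0 < σ := by linarith
  have hσ1 : σ < 1 := by nlinarith
  set e := 1 - d - (p - 1) * σ with he
  have he0 : 1 - 2 / N < e := by rw [he]; linarith
  have h2N : 2 / (N:ℝ) < 1 := by rw [div_lt_one (by linarith)]; linarith
  have hepos : 0 < e := by linarith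
  have hre : ((N:ℝ) - 2) * (1 / e) < N := by
    rw [mul_one_div, div_lt_iff₀ hepos]
    have : (N:ℝ) * (1 - 2 / N) < N * e := by gcongr
    rw [mul_sub, mul_div_cancel₀ _ (by linarith)] at this
    linarith
  obtain ⟨A, hA, hA2⟩ := rk_unif (N := N) (by omega) hre R r
  have hA1 : ∀ᵐ x ∂μ, ∫⁻ y, rk N ((N:ℝ)-2) x y ^ (1/e) ∂μ ≤ A := by
    filter_upwards [ae_restrict_mem (D_open R r).measurableSet] with x hx
    simp only [rk_rpow _ _ (by positivity : 0 ≤ 1 / e)]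
    exact hA2 x hx.2.le
  have hA1' : ∀ᵐ y ∂μ, ∫⁻ x, rk N ((N:ℝ)-2) x y ^ (1/e) ∂μ ≤ A := by
    filter_upwards [hA1] with x hx
    simpa only [rk_symm _ x] using hx
  have hs : 0 < 1 / (σ - d) := by have : 0 < σ - d := by linarith
                                  positivity
  have hY := young μ (rk_meas ((N:ℝ)-2)) (hW.pow_const p) (r := 1 / e) (a := 1 / (p * σ)) (s := 1 / (σ - d))
    (by positivity) (by positivity) hs (by rw [one_div_one_div, one_div_one_div, one_div_one_div, he]; ring)
    (by rw [one_div_one_div, one_div_one_div, he]; nlinarith) (by rw [one_div_one_div, one_div_one_div]; nlinarith) hA1 hA1'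
  have hH : ∫⁻ y, (W y ^ p) ^ (1 / (p * σ)) ∂μ ≠ ∞ := by
    have : p * (1 / (p * σ)) = 1 / σ := by field_simp
    simpa only [← ENNReal.rpow_mul, this] using hfin
  have hI : ∫⁻ x, (∫⁻ y, rk N ((N:ℝ)-2) x y * W y ^ p ∂μ) ^ (1 / (σ - d)) ∂μ ≠ ∞ := by
    refine ne_top_of_le_ne_top (ENNReal.mul_ne_top ?_ ?_) hY
    · exact ENNReal.rpow_ne_top_of_nonneg (by positivity) hA
    · exact ENNReal.rpow_ne_top_of_nonneg (by positivity) hH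
  have hs1 : 1 ≤ 1 / (σ - d) := by rw [le_div_iff₀ (by linarith)]; linarith
  have hb : ∫⁻ x, W x ^ (1 / (σ - d)) ∂μ ≤ ∫⁻ x, 2 ^ (1 / (σ - d) - 1) * (1 + c ^ (1 / (σ - d)) *
      (∫⁻ y, rk N ((N:ℝ)-2) x y * W y ^ p ∂μ) ^ (1 / (σ - d))) ∂μ := by
    refine lintegral_mono_ae ?_
    filter_upwards [h] with x hx
    refine (ENNReal.rpow_le_rpow hx hs.le).trans ?_
    refine (ENNReal.rpow_add_le_mul_rpow_add_rpow _ _ hs1).trans ?_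
    rw [ENNReal.one_rpow, ENNReal.mul_rpow_of_nonneg _ _ hs.le]
  refine ne_top_of_le_ne_top ?_ hb
  have h2 : (2:ℝ≥0∞) ^ (1 / (σ - d) - 1) ≠ ∞ := ENNReal.rpow_ne_top_of_nonneg (by linarith) (by simp)
  rw [lintegral_const_mul' _ _ h2, lintegral_add_left measurable_const, lintegral_const_mul' _ _ (ENNReal.rpow_ne_top_of_nonneg hs.le hc)]
  refine ENNReal.mul_ne_top h2 (ENNReal.add_ne_top.2 ⟨?_, ENNReal.mul_ne_top (ENNReal.rpow_ne_top_of_nonneg hs.le hc) hI⟩)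
  simp only [lintegral_const, one_mul]
  exact measure_ne_top _ _

lemma boot_last (hN : 3 ≤ N) {R r p σ : ℝ} (hp : 1 < p) (hσ0 : 0 < σ)
    (hdN : p * σ < 2 / N) {c : ℝ≥0∞} (hc : c ≠ ∞) {W : 𝔼 → ℝ≥0∞} (hW : Measurable W)
    (h : ∀ᵐ x ∂(volume.restrict (DSet N R r)), W x ≤ 1 + c * ∫⁻ y in DSet N R r, rk N ((N:ℝ)-2) x y * W y ^ p)
    (hfin : ∫⁻ y in DSet N R r, W y ^ (1 / σ) ≠ ∞) :
    ∃ B : ℝ≥0∞, B ≠ ∞ ∧ ∀ᵐ x ∂(volume.restrict (DSet N R r)), W x ≤ B := by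
  set μ := (volume : Measure 𝔼).restrict (DSet N R r) with hμ
  have hN0 : (3:ℝ) ≤ N := by exact_mod_cast hN
  set e := 1 - p * σ with he
  have he0 : 1 - 2 / N < e := by rw [he]; linarith
  have h2N : 2 / (N:ℝ) < 1 := by rw [div_lt_one (by linarith)]; linarith
  have hepos : 0 < e := by linarith
  have hpσ : 0 < p * σ := by positivity
  have hre : ((N:ℝ) - 2) * (1 / e) < N := by
    rw [mul_one_div, div_lt_iff₀ hepos]
    have : (N:ℝ) * (1 - 2 / N) < N * e := by gcongr
    rw [mul_sub, mul_div_cancel₀ _ (by linarith)] at this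
    linarith
  obtain ⟨A, hA, hA2⟩ := rk_unif (N := N) (by omega) hre R r
  have hpq : (1 / e).HolderConjugate (1 / (p * σ)) := by
    rw [Real.holderConjugate_iff]
    refine ⟨?_, ?_⟩
    · rw [lt_div_iff₀ hepos]; linarith
    · rw [one_div, one_div, inv_inv, inv_inv, he]; ring
  have hH : ∫⁻ y, (W y ^ p) ^ (1 / (p * σ)) ∂μ ≠ ∞ := by
    have : p * (1 / (p * σ)) = 1 / σ := by field_simp
    simpa only [← ENNReal.rpow_mul, this] using hfin
  refine ⟨1 + c * (A ^ (1 / (1 / e)) * (∫⁻ y, (W y ^ p) ^ (1 / (p * σ)) ∂μ) ^ (1 / (1 / (p * σ)))), ?_, ?_⟩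
  · refine ENNReal.add_ne_top.2 ⟨by simp, ENNReal.mul_ne_top hc (ENNReal.mul_ne_top ?_ ?_)⟩
    · exact ENNReal.rpow_ne_top_of_nonneg (by positivity) hA
    · exact ENNReal.rpow_ne_top_of_nonneg (by positivity) hH
  · filter_upwards [h, ae_restrict_mem (D_open R r).measurableSet] with x hx hxD
    refine hx.trans ?_
    gcongr
    have hm : Measurable (rk N ((N:ℝ)-2) x) := by unfold rk; fun_prop
    refine (ENNReal.lintegral_mul_le_Lp_mul_Lq μ hpq hm.aemeasurable (hW.pow_const p).aemeasurable).trans ?_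
    gcongr
    simp only [rk_rpow _ _ (by positivity : 0 ≤ 1 / e)]
    exact hA2 x hxD.2.le

lemma boot (hN : 3 ≤ N) {R r p : ℝ} (hp : 1 < p) (hp' : (p - 1) / (p + 1) < 2 / N)
    {c : ℝ≥0∞} (hc : c ≠ ∞) {W : 𝔼 → ℝ≥0∞} (hW : Measurable W)
    (h : ∀ᵐ x ∂(volume.restrict (DSet N R r)), W x ≤ 1 + c * ∫⁻ y in DSet N R r, rk N ((N:ℝ)-2) x y * W y ^ p)
    (hfin : ∫⁻ y in DSet N R r, W y ^ (p + 1) ≠ ∞) :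
    ∃ B : ℝ≥0∞, B ≠ ∞ ∧ ∀ᵐ x ∂(volume.restrict (DSet N R r)), W x ≤ B := by
  have hN0 : (3:ℝ) ≤ N := by exact_mod_cast hN
  set σ0 := 1 / (p + 1) with hσ0
  have hσpos : 0 < σ0 := by positivity
  have hgap : 0 < 2 / (N:ℝ) - (p - 1) / (p + 1) := by linarith
  obtain ⟨M, hM⟩ := exists_nat_gt (max (p * σ0 / (2 / (N:ℝ))) (σ0 / (2 / (N:ℝ) - (p - 1) / (p + 1))))
  have hM1 := lt_of_le_of_lt (le_max_left _ _) hM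
  have hM2 := lt_of_le_of_lt (le_max_right _ _) hM
  rw [div_lt_iff₀ (by positivity)] at hM1 
  rw [div_lt_iff₀ hgap] at hM2
  set d := σ0 / (M + 1 / 2) with hd
  have hMp : (0:ℝ) < M + 1 / 2 := by positivity
  have hdpos : 0 < d := by positivity
  have hdM : d * (M + 1 / 2) = σ0 := by rw [hd]; field_simp
  have hd1 : d < 2 / (N:ℝ) - (p - 1) / (p + 1) := by
    rw [hd, div_lt_iff₀ hMp]; nlinarith
  have hd2 : p * (d / 2) < 2 / N := by
    have : p * d < 2 / N := by
      rw [hd, ← mul_div_assoc, div_lt_iff₀ hMp]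
      have : 0 < 2 / (N:ℝ) := by positivity
      nlinarith
    have : 0 < p * d := by positivity
    linarith
  have key : ∀ k : ℕ, k ≤ M → ∫⁻ y in DSet N R r, W y ^ (1 / (σ0 - k * d)) ≠ ∞ := by
    intro k
    induction k with
    | zero => intro _; simpa [hσ0] using hfin
    | succ k ih =>
      intro hk
      have h1 := ih (by omega)
      have hk' : (k:ℝ) + 1 ≤ M := by exact_mod_cast hk
      have hkd : ((k:ℝ) + 1) * d ≤ M * d := by gcongr
      have h2 : σ0 - (k:ℝ) * d ≤ σ0 := by have : 0 ≤ (k:ℝ) * d := by positivity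
                                          linarith
      have h3 := boot_step hN hp (σ := σ0 - k * d) (d := d) (by
          calc _ ≤ σ0 * (p + 1) := by gcongr
            _ = 1 := by rw [hσ0]; field_simp) hdpos (by nlinarith) (by
          have : (p - 1) * (σ0 - k * d) ≤ (p - 1) * σ0 := by gcongr
          have e : (p - 1) * σ0 = (p - 1) / (p + 1) := by rw [hσ0]; ring
          linarith) hc hW h h1
      have e : σ0 - ((k + 1 : ℕ):ℝ) * d = σ0 - k * d - d := by push_cast; ring
      rw [e]; exact h3
  have hl := key M le_rfl
  have e : σ0 - M * d = d / 2 := by rw [← hdM]; ring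
  rw [e] at hl
  exact boot_last hN hp (by positivity) hd2 hc hW h hl

end M18

section M19
variable {N : ℕ}
local notation "𝔼" => EuclideanSpace ℝ (Fin N)

/-- the right-hand side -/
def nl (C lam p : ℝ) (u : EuclideanSpace ℝ (Fin N) → ℝ) (x : EuclideanSpace ℝ (Fin N)) : ℝ :=
  (C * u x ^ p - lam * u x) / (2 * ‖x‖)

lemma nl_bound {C lam p R a b : ℝ} (hC : 0 ≤ C) (hl : 0 < lam) (hp : 1 < p) (hR : 0 < R) (ha : 0 ≤ a) (hab : a ≤ b) (hb : 1 ≤ b)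
    {u : 𝔼 → ℝ} {x : 𝔼} (hu : u x = a) (hx : R < ‖x‖) : |nl C lam p u x| ≤ (C + lam) / (2 * R) * b ^ p := by
  unfold nl
  rw [hu, abs_div, abs_of_pos (show 0 < 2 * ‖x‖ by linarith)]
  have h1 : a ^ p ≤ b ^ p := rpow_le_rpow ha hab (by linarith)
  have h2 : b ≤ b ^ p := by
    calc b = b ^ (1:ℝ) := (rpow_one b).symm
      _ ≤ b ^ p := rpow_le_rpow_of_exponent_le hb hp.le
  have h3 : |C * a ^ p - lam * a| ≤ (C + lam) * b ^ p := by
    have h4 : 0 ≤ a ^ p := rpow_nonneg ha _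
    have h5 : C * a ^ p ≤ C * b ^ p := by gcongr
    have h6 : lam * a ≤ lam * b ^ p := by gcongr; linarith
    have h7 : 0 ≤ C * a ^ p := by positivity
    have h8 : 0 ≤ lam * a := by positivity
    rw [abs_le]; constructor <;> nlinarith
  calc _ ≤ (C + lam) * b ^ p / (2 * R) := by
        gcongr
    _ = _ := by ring

set_option maxHeartbeats 800000 in
lemma exists_u (hN : 3 ≤ N) {t R lam p : ℝ} (ht : 1 < t) (hR : 0 < R) (hl : 0 < lam) (hp : 1 < p)
    (hp' : p * ((N:ℝ) - 2) < N + 2) : ∃ (u : 𝔼 → ℝ) (B : ℝ), Measurable u ∧ (∀ x, 0 ≤ u x) ∧ 0 ≤ B ∧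
      nq R (t*R) (p+1) u = 1 ∧ (∀ᵐ x ∂(volume.restrict (DSet N R (t*R))), u x ≤ B) ∧
      ∀ᵐ x ∂(volume.restrict (DSet N R (t*R))), u x = Kop t R ((DSet N R (t*R)).indicator
        (nl (Clev N R (t*R) lam (p+1)) lam p u)) x := by
  have hN0 : (3:ℝ) ≤ N := by exact_mod_cast hN
  have hr : R < t * R := by nlinarith
  obtain ⟨w, u, hw, hw1, hQ, hum, hu0, hu, hlim⟩ := min_seq hN hR hr (q := p + 1) (by linarith) (by nlinarith) hl
  obtain ⟨hu1, hE⟩ := euler hN ht hR hl (by linarith) hw hw1 hQ hu0 hu hlim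
  set C := Clev N R (t*R) lam (p+1) with hC
  have hC0 : 0 ≤ C := Clev_nonneg (N := N) (lam := lam) (q := p+1) (by omega) hR hr (by linarith) hl
  set μ := (volume : Measure 𝔼).restrict (DSet N R (t*R)) with hμ
  have hq1 : (1:ℝ≥0∞) ≤ ENNReal.ofReal (p + 1) := by rw [← ENNReal.ofReal_one]; exact ENNReal.ofReal_le_ofReal (by linarith)
  have hui : Integrable u μ := hu.integrable hq1
  have hupi : Integrable (fun x => u x ^ p) μ := by
    have := hu.norm_rpow_div (ENNReal.ofReal p)
    rw [ENNReal.toReal_ofReal (by linarith), ← ENNReal.ofReal_div_of_pos (by linarith)] at this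
    have h2 := this.integrable (by rw [← ENNReal.ofReal_one]; apply ENNReal.ofReal_le_ofReal; rw [le_div_iff₀ (by linarith)]; linarith)
    refine h2.congr (Eventually.of_forall fun x => ?_)
    simp only [Real.norm_eq_abs, abs_of_nonneg (hu0 x)]
  have hfi : Integrable (nl C lam p u) μ := by
    have h1 := (hupi.const_mul C).sub (hui.const_mul lam)
    have h2 := h1.bdd_mul (f := fun x : 𝔼 => (2 * ‖x‖)⁻¹) (c := (2 * R)⁻¹)
      (Measurable.aestronglyMeasurable (by fun_prop)) (by
        filter_upwards [ae_restrict_mem (D_open R (t*R)).measurableSet] with x hx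
        have := hx.1
        rw [Real.norm_eq_abs, abs_of_pos (by have : 0 < ‖x‖ := by linarith
                                             positivity)]
        gcongr)
    refine h2.congr (Eventually.of_forall fun x => ?_)
    simp only [nl, Pi.sub_apply]; rw [div_eq_inv_mul]
  have hIntg := int_eq hN ht hR hfi hui (fun g B hg hg1 hg2 => by
    have h1 := hE g B hg hg1 hg2
    haveI := nu_fin (N := N) (r := t*R) hR
    have huν : MemLp u (ENNReal.ofReal (p+1)) (nu N R (t*R)) := memLp_nu hR hu
    have hφ : Adm R (t*R) ((DSet N R (t*R)).indicator (Kop t R g)) := adm_Kop hN ht hR hg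
    have i1 := (holder_u (by linarith) hu0 huν (hφ.memLp _ _) hu1).1
    obtain ⟨Bφ, hBφ⟩ := hφ.bdd
    have i2 : Integrable (fun x => u x * (DSet N R (t*R)).indicator (Kop t R g) x) (nu N R (t*R)) := by
      have := (huν.integrable hq1).bdd_mul (c := Bφ) (hφ.memLp 1 _).1 (Eventually.of_forall hBφ)
      simpa [mul_comm] using this
    have h2 : ∫ x in DSet N R (t*R), u x * g x = ∫ x, (C * ((DSet N R (t*R)).indicator (Kop t R g) x * u x ^ (p + 1 - 1)) -
        lam * (u x * (DSet N R (t*R)).indicator (Kop t R g) x)) ∂(nu N R (t*R)) := by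
      rw [integral_sub (i1.const_mul C) (i2.const_mul lam), integral_const_mul, integral_const_mul]
      linarith
    rw [h2, int_nu]
    refine setIntegral_congr_fun (D_open R (t*R)).measurableSet fun x hx => ?_
    simp only [Set.indicator_of_mem hx, nl, add_sub_cancel_right]
    ring)
  -- bootstrap
  obtain ⟨C0, hC0', hk⟩ := kop_le hN ht hR (N := N)
  set W : 𝔼 → ℝ≥0∞ := fun x => ENNReal.ofReal (1 + u x) with hW
  have hWm : Measurable W := (measurable_const.add hum).ennreal_ofReal
  have hWp : ∀ (x : 𝔼) (s : ℝ), W x ^ s = ENNReal.ofReal ((1 + u x) ^ s) := fun x s =>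
    ENNReal.ofReal_rpow_of_pos (by linarith [hu0 x])
  have hWfin : ∫⁻ y, W y ^ (p + 1) ∂μ ≠ ∞ := by
    have h1 : MemLp (fun x => 1 + u x) (ENNReal.ofReal (p+1)) μ := by
      have hc : MemLp (fun _ : 𝔼 => (1:ℝ)) (ENNReal.ofReal (p+1)) μ := memLp_const (1:ℝ)
      exact hc.add hu
    have h2 := lintegral_rpow_enorm_lt_top_of_eLpNorm_lt_top (by simp; linarith) ENNReal.ofReal_ne_top h1.2
    rw [ENNReal.toReal_ofReal (by linarith)] at h2
    refine ne_of_eq_of_ne (lintegral_congr fun x => ?_) h2.ne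
    rw [← ofReal_norm_eq_enorm, Real.norm_eq_abs, abs_of_pos (by linarith [hu0 x])]
  have hWle : ∀ᵐ x ∂μ, W x ≤ 1 + (C0 * ENNReal.ofReal ((C + lam) / (2 * R))) *
      ∫⁻ y in DSet N R (t*R), rk N ((N:ℝ)-2) x y * W y ^ p := by
    filter_upwards [hIntg, ae_restrict_mem (D_open R (t*R)).measurableSet] with x hx hxD
    have h1 : W x = 1 + ‖u x‖ₑ := by
      have e : W x = ENNReal.ofReal (1 + u x) := rfl
      rw [e, ← ofReal_norm_eq_enorm, Real.norm_eq_abs, abs_of_nonneg (hu0 x), ENNReal.ofReal_add (by norm_num) (hu0 x), ENNReal.ofReal_one]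
    rw [h1, hx]
    gcongr
    refine (hk _ x hxD.1.le hxD.2.le).trans ?_
    rw [mul_assoc, ← lintegral_const_mul' _ _ ENNReal.ofReal_ne_top]
    refine mul_le_mul_right (lintegral_mono_ae ?_) _
    filter_upwards [ae_restrict_mem (D_open R (t*R)).measurableSet] with y hy
    rw [mul_left_comm]
    gcongr
    rw [hWp, ← ENNReal.ofReal_mul (by positivity), ← ofReal_norm_eq_enorm]
    exact ENNReal.ofReal_le_ofReal (nl_bound hC0 hl hp hR (hu0 y) (by linarith) (by linarith [hu0 y]) rfl hy.1)
  obtain ⟨B, hB, hB2⟩ := boot hN hp (by rw [div_lt_div_iff₀ (by linarith) (by linarith)]; nlinarith)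
    (ENNReal.mul_ne_top hC0' ENNReal.ofReal_ne_top) hWm hWle hWfin
  refine ⟨u, B.toReal, hum, hu0, ENNReal.toReal_nonneg, hu1, ?_, hIntg⟩
  filter_upwards [hB2] with x hx
  have := ENNReal.toReal_mono hB hx
  rw [hW, ENNReal.toReal_ofReal (by linarith [hu0 x])] at this
  linarith

lemma kop_congr {t R : ℝ} {f g : 𝔼 → ℝ} (h : ∀ᵐ x ∂(volume.restrict (DSet N R (t*R))), f x = g x) :
    Kop t R ((DSet N R (t*R)).indicator f) = Kop t R ((DSet N R (t*R)).indicator g) := by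
  ext x
  unfold Kop
  congr 1
  rw [ae_restrict_iff' (D_open _ _).measurableSet] at h
  refine integral_congr_ae ?_
  filter_upwards [h] with y hy
  by_cases hD : y ∈ DSet N R (t*R)
  · simp [hD, hy hD]
  · simp [hD]

lemma exists_u1 (hN : 3 ≤ N) {t R lam p : ℝ} (ht : 1 < t) (hR : 0 < R) (hl : 0 < lam) (hp : 1 < p)
    (hp' : p * ((N:ℝ) - 2) < N + 2) : ∃ u : 𝔼 → ℝ, ContDiffOn ℝ 1 u (Unb N t R) ∧ ContDiffOn ℝ 2 u (DSet N R (t*R)) ∧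
      (∀ x ∈ DSet N R (t*R), 0 ≤ u x) ∧ (∀ x, ‖x‖ = R ∨ ‖x‖ = t*R → u x = 0) ∧
      (∀ x ∈ DSet N R (t*R), -lapE u x = nl (Clev N R (t*R) lam (p+1)) lam p u x) ∧ nq R (t*R) (p+1) u = 1 := by
  have hN0 : (3:ℝ) ≤ N := by exact_mod_cast hN
  have hr : R < t * R := by nlinarith
  obtain ⟨u, B, hum, hu0, hB0, hu1, hB, hIntg⟩ := exists_u hN ht hR hl hp hp'
  set C := Clev N R (t*R) lam (p+1) with hC
  have hC0 : 0 ≤ C := Clev_nonneg (N := N) (lam := lam) (q := p+1) (by omega) hR hr (by linarith) hl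
  have hD := (D_open (N := N) R (t*R))
  have hDU : DSet N R (t*R) ⊆ Unb N t R := subset_closure.trans (clD_Unb ht hR)
  set ub : 𝔼 → ℝ := fun x => min (u x) B with hub
  have hubm : Measurable ub := hum.min measurable_const
  have hub_eq : ∀ᵐ x ∂(volume.restrict (DSet N R (t*R))), nl C lam p u x = nl C lam p ub x := by
    filter_upwards [hB] with x hx
    simp only [nl, hub, min_eq_left hx]
  set f1 := (DSet N R (t*R)).indicator (nl C lam p ub) with hf1
  have hf1D : DD t R f1 ((C + lam) / (2 * R) * (B + 1) ^ p) := by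
    refine ⟨Measurable.indicator ?_ hD.measurableSet, fun y => ?_, fun y hy => ?_⟩
    · unfold nl; fun_prop
    · by_cases hy : y ∈ DSet N R (t*R)
      · rw [hf1, Set.indicator_of_mem hy]
        exact nl_bound hC0 hl hp hR (le_min (hu0 y) hB0) ((min_le_right _ _).trans (by linarith)) (by linarith) rfl hy.1
      · rw [hf1, Set.indicator_of_notMem hy, abs_zero]; positivity
    · by_contra hn; exact hy (Set.indicator_of_notMem hn _)
  set u1 := Kop t R f1 with hu1d
  have hk1 : Kop t R ((DSet N R (t*R)).indicator (nl C lam p u)) = u1 := kop_congr hub_eq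
  rw [hk1] at hIntg
  have hC1 := (kop_near hN ht hR hf1D).2.1
  have hcont : ContinuousOn u1 (DSet N R (t*R)) := (hC1.mono hDU).continuousOn
  have hpos : ∀ x ∈ DSet N R (t*R), 0 ≤ u1 x := by
    have := Measure.eqOn_open_of_ae_eq (μ := volume) (f := u1) (g := fun x => |u1 x|) (by
      filter_upwards [hIntg] with x hx
      rw [← hx, abs_of_nonneg (hu0 x)]) hD hcont hcont.abs
    intro x hx
    rw [this hx]; exact abs_nonneg _
  have hu2 : ∀ᵐ x ∂(volume.restrict (DSet N R (t*R))), nl C lam p ub x = nl C lam p u1 x := by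
    filter_upwards [hub_eq, hIntg] with x h1 h2
    rw [← h1]; simp only [nl, h2]
  have hk2 : Kop t R ((DSet N R (t*R)).indicator (nl C lam p u1)) = u1 := (kop_congr hu2).symm
  obtain ⟨B1, hB1⟩ := (adm_Kop hN ht hR hf1D).bdd
  have hB1' : ∀ x ∈ DSet N R (t*R), u1 x ≤ B1 := fun x hx => by
    have := hB1 x
    rw [Set.indicator_of_mem hx] at this
    exact (le_abs_self _).trans this
  have hC1D : ContDiffOn ℝ 1 (nl C lam p u1) (DSet N R (t*R)) := by
    have h1 : ContDiffOn ℝ 1 u1 (DSet N R (t*R)) := hC1.mono hDU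
    unfold nl
    refine ContDiffOn.div ?_ ?_ ?_
    · refine (contDiffOn_const.mul ?_).sub (contDiffOn_const.mul h1)
      exact ContDiffOn.rpow_const_of_le (m := 1) h1 (by simpa using hp.le)
    · refine contDiffOn_const.mul fun x hx => ?_
      have hx0 : x ≠ 0 := by rintro rfl; have := hx.1; simp at this; linarith
      exact (contDiffAt_norm ℝ hx0).contDiffWithinAt
    · intro x hx
      have := hx.1
      have : 0 < ‖x‖ := by linarith
      positivity
  set f2 := (DSet N R (t*R)).indicator (nl C lam p u1) with hf2
  have hf2D : DD t R f2 ((C + lam) / (2 * R) * (|B1| + 1) ^ p) := by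
    refine ⟨?_, fun y => ?_, fun y hy => ?_⟩
    · classical
      have := ContinuousOn.measurable_piecewise (f := nl C lam p u1) (g := fun _ => (0:ℝ)) hC1D.continuousOn continuousOn_const hD.measurableSet
      have e : f2 = (DSet N R (t*R)).piecewise (nl C lam p u1) (fun _ => (0:ℝ)) := by
        ext x; rw [hf2, Set.indicator_apply, Set.piecewise]
      rw [e]; exact this
    · by_cases hy : y ∈ DSet N R (t*R)
      · rw [hf2, Set.indicator_of_mem hy]
        exact nl_bound hC0 hl hp hR (hpos y hy) ((hB1' y hy).trans (by linarith [le_abs_self B1])) (by linarith [abs_nonneg B1]) rfl hy.1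
      · rw [hf2, Set.indicator_of_notMem hy, abs_zero]; positivity
    · by_contra hn; exact hy (Set.indicator_of_notMem hn _)
  have hC2 := kop_C2 hN ht hR hf2D (hC1D.congr fun x hx => by rw [hf2, Set.indicator_of_mem hx])
  rw [hk2] at hC2
  refine ⟨u1, hC1, hC2.1, hpos, fun x hx => kop_bdry ht hR _ hx, fun x hx => ?_, ?_⟩
  · rw [hC2.2 x hx, hf2, Set.indicator_of_mem hx]
  · refine Eq.trans ?_ hu1
    unfold nq
    congr 1
    refine eLpNorm_congr_ae ?_
    have := (nu_ac (N := N) R (t*R)).ae_le hIntg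
    filter_upwards [this] with x hx
    exact hx.symm

end M19

section M20
variable {N : ℕ}
local notation "𝔼" => EuclideanSpace ℝ (Fin N)

structure Sol (t R lam p C : ℝ) (u : 𝔼 → ℝ) : Prop where
  c1 : ContDiffOn ℝ 1 u (Unb N t R)
  c2 : ContDiffOn ℝ 2 u (DSet N R (t*R))
  nn : ∀ x ∈ DSet N R (t*R), 0 ≤ u x
  bdry : ∀ x, ‖x‖ = R ∨ ‖x‖ = t*R → u x = 0
  eq : ∀ x ∈ DSet N R (t*R), -lapE u x = nl C lam p u x
  nq1 : nq R (t*R) (p+1) u = 1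

lemma Sol.adm {t R lam p C : ℝ} {u : 𝔼 → ℝ} (ht : 1 < t) (hR : 0 < R) (h : Sol t R lam p C u) :
    Adm R (t*R) ((DSet N R (t*R)).indicator u) := by
  obtain ⟨K, hK⟩ := lip_of_Unb ht hR h.c1
  exact lip_ind hK fun x hx => h.bdry x (frD _ _ hx)

/-- truncation -/
def trn (R r δ : ℝ) (u : 𝔼 → ℝ) (x : 𝔼) : ℝ := max ((DSet N R r).indicator u x - δ) 0

lemma trn_adm {R r δ : ℝ} (hδ : 0 < δ) {u : 𝔼 → ℝ} (h : Adm R r ((DSet N R r).indicator u)) : Adm R r (trn R r δ u) := by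
  obtain ⟨⟨K, hK⟩, h0⟩ := h
  refine ⟨⟨K, ?_⟩, fun x hx => ?_⟩
  · unfold trn
    have h2 : LipschitzWith K fun x => (DSet N R r).indicator u x - δ := by
      refine LipschitzWith.of_dist_le_mul fun x y => ?_
      have := hK.dist_le_mul x y
      simpa [Real.dist_eq] using this
    exact h2.max_const 0
  · unfold trn
    rw [h0 x hx]; simp [hδ.le]

lemma Sol.trn_tsup {t R lam p C δ : ℝ} {u : 𝔼 → ℝ} (ht : 1 < t) (hR : 0 < R) (h : Sol t R lam p C u) (hδ : 0 < δ) :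
    tsupport (trn R (t*R) δ u) ⊆ DSet N R (t*R) := by
  have hA := (h.adm ht hR).cont
  have hcl : IsClosed {x | δ ≤ (DSet N R (t*R)).indicator u x} := isClosed_le continuous_const hA
  have h1 : tsupport (trn R (t*R) δ u) ⊆ {x | δ ≤ (DSet N R (t*R)).indicator u x} := by
    refine closure_minimal (fun x hx => ?_) hcl
    by_contra hn
    simp only [Set.mem_setOf_eq, not_le] at hn
    exact hx (max_eq_right (by linarith))
  refine h1.trans fun x hx => ?_
  by_contra hn
  simp only [Set.mem_setOf_eq, Set.indicator_of_notMem hn] at hx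
  linarith

lemma Sol.trn_fderiv {t R lam p C δ : ℝ} {u : 𝔼 → ℝ} (ht : 1 < t) (hR : 0 < R) (h : Sol t R lam p C u) {x : 𝔼} (hx : x ∈ DSet N R (t*R)) :
    fderiv ℝ (trn R (t*R) δ u) x = if δ < u x then fderiv ℝ u x else 0 := by
  have hD := (D_open (N := N) R (t*R))
  split_ifs with hd
  · have hc : ContinuousAt u x := h.c2.continuousOn.continuousAt (hD.mem_nhds hx)
    have he : trn R (t*R) δ u =ᶠ[𝓝 x] fun y => u y - δ := by
      filter_upwards [hD.mem_nhds hx, hc.eventually (lt_mem_nhds hd)] with y hy hy2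
      unfold trn
      rw [Set.indicator_of_mem hy, max_eq_left (by linarith)]
    rw [he.fderiv_eq, fderiv_sub_const]
  · refine IsLocalMin.fderiv_eq_zero (Eventually.of_forall fun y => ?_)
    have : trn R (t*R) δ u x = 0 := by
      unfold trn
      rw [Set.indicator_of_mem hx, max_eq_right (by linarith)]
    rw [this]
    exact le_max_right _ _

lemma Sol.trn_ibp {t R lam p C δ : ℝ} {u : 𝔼 → ℝ} (ht : 1 < t) (hR : 0 < R) (h : Sol t R lam p C u) (hδ : 0 < δ) :
    ∫ x in DSet N R (t*R), (if δ < u x then ‖fderiv ℝ u x‖ ^ 2 else 0) =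
    ∫ x in DSet N R (t*R), max (u x - δ) 0 * nl C lam p u x := by
  have hD := (D_open (N := N) R (t*R))
  have hA := trn_adm hδ (h.adm ht hR)
  have hts := h.trn_tsup ht hR hδ
  obtain ⟨⟨K, hK⟩, h0⟩ := hA
  have hcs := cs_of_off R (t*R) h0
  have key := ibp2 hK hcs hD hts h.c2
  have e1 : ∫ x, ∑ i, fderiv ℝ (trn R (t*R) δ u) x (EuclideanSpace.single i 1) * fderiv ℝ u x (EuclideanSpace.single i 1)
      = ∫ x in DSet N R (t*R), (if δ < u x then ‖fderiv ℝ u x‖ ^ 2 else 0) := by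
    have h3 : ∀ x, x ∉ DSet N R (t*R) → ∑ i, fderiv ℝ (trn R (t*R) δ u) x (EuclideanSpace.single i 1) * fderiv ℝ u x (EuclideanSpace.single i 1) = 0 := by
      intro x hx
      have : fderiv ℝ (trn R (t*R) δ u) x = 0 := by
        by_contra hne
        exact hx (hts (support_fderiv_subset ℝ hne))
      simp [this]
    rw [← setIntegral_eq_integral_of_forall_compl_eq_zero h3]
    refine setIntegral_congr_fun hD.measurableSet fun x hx => ?_
    simp only [h.trn_fderiv ht hR hx]
    split_ifs with hd
    · rw [← inner_grd, real_inner_self_eq_norm_sq, grd_norm]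
    · simp
  have e2 : -∫ x, trn R (t*R) δ u x * lapE u x = ∫ x in DSet N R (t*R), max (u x - δ) 0 * nl C lam p u x := by
    rw [← integral_neg]
    have h3 : ∀ x, x ∉ DSet N R (t*R) → -(trn R (t*R) δ u x * lapE u x) = 0 := fun x hx => by rw [h0 x hx]; simp
    rw [← setIntegral_eq_integral_of_forall_compl_eq_zero h3]
    refine setIntegral_congr_fun hD.measurableSet fun x hx => ?_
    simp only [← h.eq x hx, trn, Set.indicator_of_mem hx]
    ring
  rw [← e1, ← e2]; exact key

lemma Sol.dir {t R lam p C : ℝ} {u : 𝔼 → ℝ} (hN : 3 ≤ N) (ht : 1 < t) (hR : 0 < R) (hl : 0 < lam) (hp : 1 < p) (hC : 0 ≤ C)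
    (h : Sol t R lam p C u) :
    ∫ x in DSet N R (t*R), ‖fderiv ℝ u x‖ ^ 2 = ∫ x in DSet N R (t*R), u x * nl C lam p u x := by
  have hD := (D_open (N := N) R (t*R))
  have hA := h.adm ht hR
  have hcu : ContinuousOn u (DSet N R (t*R)) := h.c2.continuousOn
  have hcf : ContinuousOn (fderiv ℝ u) (DSet N R (t*R)) := h.c2.continuousOn_fderiv_of_isOpen hD (by norm_num)
  obtain ⟨B, hB⟩ := hA.bdd
  have hB' : ∀ x ∈ DSet N R (t*R), u x ≤ B := fun x hx => by
    have := hB x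
    rw [Set.indicator_of_mem hx] at this
    exact (le_abs_self _).trans this
  have hi1 : Integrable (fun x => ‖fderiv ℝ u x‖ ^ 2) (volume.restrict (DSet N R (t*R))) := by
    obtain ⟨⟨K, hK⟩, -⟩ := hA
    refine Integrable.of_bound ((hcf.norm.pow 2).aestronglyMeasurable hD.measurableSet) ((K:ℝ) ^ 2) ?_
    filter_upwards [ae_restrict_mem hD.measurableSet] with x hx
    rw [← fderiv_ind u hx, Real.norm_eq_abs, abs_of_nonneg (by positivity)]
    gcongr
    exact norm_fderiv_le_of_lipschitz ℝ hK
  have hcn : ContinuousOn (nl C lam p u) (DSet N R (t*R)) := by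
    unfold nl
    refine ContinuousOn.div ?_ (by fun_prop) fun x hx => ?_
    · exact (continuousOn_const.mul (hcu.rpow_const fun x _ => Or.inr (by linarith))).sub (continuousOn_const.mul hcu)
    · have := hx.1
      have : 0 < ‖x‖ := by linarith
      positivity
  have hbn : ∀ x ∈ DSet N R (t*R), |nl C lam p u x| ≤ (C + lam) / (2 * R) * (|B| + 1) ^ p := fun x hx =>
    nl_bound hC hl hp hR (h.nn x hx) ((hB' x hx).trans (by linarith [le_abs_self B])) (by linarith [abs_nonneg B]) rfl hx.1
  set M := (C + lam) / (2 * R) * (|B| + 1) ^ p with hM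
  have hM0 : 0 ≤ M := by positivity
  have hδ : ∀ n : ℕ, (0:ℝ) < 1 / ((n:ℝ) + 1) := fun n => by positivity
  have hδl : Tendsto (fun n : ℕ => 1 / ((n:ℝ) + 1)) atTop (𝓝 0) := tendsto_one_div_add_atTop_nhds_zero_nat
  have L1 : Tendsto (fun n : ℕ => ∫ x in DSet N R (t*R), (if 1 / ((n:ℝ) + 1) < u x then ‖fderiv ℝ u x‖ ^ 2 else 0)) atTop
      (𝓝 (∫ x in DSet N R (t*R), ‖fderiv ℝ u x‖ ^ 2)) := by
    refine tendsto_integral_of_dominated_convergence (fun x => ‖fderiv ℝ u x‖ ^ 2) (fun n => ?_) hi1 (fun n => ?_) ?_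
    · have hm : NullMeasurableSet {x | 1 / ((n:ℝ) + 1) < u x} (volume.restrict (DSet N R (t*R))) := by
        have := (hcu.aestronglyMeasurable (μ := volume) hD.measurableSet)
        exact nullMeasurableSet_lt aemeasurable_const this.aemeasurable
      have := hi1.1.indicator₀ hm
      refine this.congr (Eventually.of_forall fun x => ?_)
      simp only [Set.indicator, Set.mem_setOf_eq]
    · refine Eventually.of_forall fun x => ?_
      split_ifs
      · rw [Real.norm_eq_abs, abs_of_nonneg (by positivity)]
      · simp
    · filter_upwards [ae_restrict_mem hD.measurableSet] with x hx
      rcases (h.nn x hx).eq_or_lt with h0 | h0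
      · have : fderiv ℝ u x = 0 := by
          refine IsLocalMin.fderiv_eq_zero ?_
          filter_upwards [hD.mem_nhds hx] with y hy
          rw [← h0]; exact h.nn y hy
        simp [this]
      · refine Tendsto.congr' ?_ tendsto_const_nhds
        filter_upwards [hδl.eventually (gt_mem_nhds h0)] with n hn
        rw [if_pos hn]
  have L2 : Tendsto (fun n : ℕ => ∫ x in DSet N R (t*R), max (u x - 1 / ((n:ℝ) + 1)) 0 * nl C lam p u x) atTop
      (𝓝 (∫ x in DSet N R (t*R), u x * nl C lam p u x)) := by
    refine tendsto_integral_of_dominated_convergence (fun x => |B| * M) (fun n => ?_) (integrable_const _) (fun n => ?_) ?_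
    · refine ContinuousOn.aestronglyMeasurable ?_ hD.measurableSet
      exact ((hcu.sub continuousOn_const).sup continuousOn_const).mul hcn
    · filter_upwards [ae_restrict_mem hD.measurableSet] with x hx
      rw [Real.norm_eq_abs, abs_mul]
      refine mul_le_mul ?_ (hbn x hx) (abs_nonneg _) (abs_nonneg _)
      have h00 : 0 ≤ max (u x - 1 / ((n:ℝ) + 1)) 0 := le_max_right _ _
      rw [abs_of_nonneg h00]
      refine max_le ?_ (abs_nonneg _)
      linarith [hδ n, hB' x hx, le_abs_self B]
    · filter_upwards [ae_restrict_mem hD.measurableSet] with x hx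
      have h1 : Tendsto (fun n : ℕ => max (u x - 1 / ((n:ℝ) + 1)) 0) atTop (𝓝 (max (u x - 0) 0)) :=
        (tendsto_const_nhds.sub hδl).max tendsto_const_nhds
      rw [sub_zero, max_eq_left (h.nn x hx)] at h1
      exact h1.mul_const _
  refine tendsto_nhds_unique L1 (L2.congr fun n => ?_)
  exact (h.trn_ibp ht hR (hδ n)).symm

end M20

section M21
variable {N : ℕ}
local notation "𝔼" => EuclideanSpace ℝ (Fin N)

lemma ind_ae {R r : ℝ} (u : 𝔼 → ℝ) : (DSet N R r).indicator u =ᵐ[nu N R r] u := by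
  refine (nu_ac (N := N) R r).ae_le ?_
  filter_upwards [ae_restrict_mem (D_open (N := N) R r).measurableSet] with x hx
  rw [Set.indicator_of_mem hx]

lemma Sol.memLp {t R lam p C : ℝ} {u : 𝔼 → ℝ} (ht : 1 < t) (hR : 0 < R) (h : Sol t R lam p C u) (q : ℝ≥0∞) :
    MemLp u q (nu N R (t*R)) := by
  haveI := nu_fin (N := N) (r := t*R) hR
  exact (memLp_congr_ae (ind_ae u)).1 ((h.adm ht hR).memLp q _)

lemma Sol.one {t R lam p C : ℝ} {u : 𝔼 → ℝ} (ht : 1 < t) (hR : 0 < R) (hp : 1 < p) (h : Sol t R lam p C u) :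
    ∫ x, |u x| ^ (p+1) ∂(nu N R (t*R)) = 1 := by
  rw [← nq_rpow (by linarith) (h.memLp ht hR _), h.nq1, one_rpow]

lemma Sol.energy {t R lam p C : ℝ} {u : 𝔼 → ℝ} (hN : 3 ≤ N) (ht : 1 < t) (hR : 0 < R) (hl : 0 < lam) (hp : 1 < p) (hC : 0 ≤ C)
    (h : Sol t R lam p C u) :
    (∫ x in DSet N R (t*R), ‖fderiv ℝ u x‖ ^ 2) + lam * ∫ x, u x ^ 2 ∂(nu N R (t*R)) = C := by
  haveI := nu_fin (N := N) (r := t*R) hR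
  rw [h.dir hN ht hR hl hp hC]
  have i1 : Integrable (fun x => |u x| ^ (p+1)) (nu N R (t*R)) := by
    have := (h.memLp ht hR (ENNReal.ofReal (p+1))).integrable_norm_rpow (by simp; linarith) ENNReal.ofReal_ne_top
    rw [ENNReal.toReal_ofReal (by linarith)] at this
    exact this
  have i2 : Integrable (fun x => u x ^ 2) (nu N R (t*R)) := (h.memLp ht hR 2).integrable_sq
  have e : ∫ x in DSet N R (t*R), u x * nl C lam p u x = ∫ x, (C * |u x| ^ (p+1) - lam * u x ^ 2) ∂(nu N R (t*R)) := by
    rw [int_nu]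
    refine setIntegral_congr_fun (D_open R (t*R)).measurableSet fun x hx => ?_
    have h0 := h.nn x hx
    simp only [nl, abs_of_nonneg h0]
    have : u x ^ (p + 1) = u x * u x ^ p := by
      rcases h0.eq_or_lt with h1 | h1
      · rw [← h1, zero_mul, zero_rpow (by linarith)]
      · rw [rpow_add h1, rpow_one, mul_comm]
    rw [this]; ring
  rw [e, integral_sub (i1.const_mul C) (i2.const_mul lam), integral_const_mul, integral_const_mul, h.one ht hR hp]
  ring

lemma Sol.Cpos {t R lam p C : ℝ} {u : 𝔼 → ℝ} (hN : 3 ≤ N) (ht : 1 < t) (hR : 0 < R) (hl : 0 < lam) (hp : 1 < p) (hC : 0 ≤ C)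
    (h : Sol t R lam p C u) : 0 < C := by
  have h1 := h.energy hN ht hR hl hp hC
  have i2 : Integrable (fun x => u x ^ 2) (nu N R (t*R)) := (h.memLp ht hR 2).integrable_sq
  have h2 : 0 ≤ ∫ x in DSet N R (t*R), ‖fderiv ℝ u x‖ ^ 2 := integral_nonneg fun x => by positivity
  have h3 : 0 ≤ ∫ x, u x ^ 2 ∂(nu N R (t*R)) := integral_nonneg fun x => by positivity
  rcases h3.eq_or_lt with h4 | h4
  · exfalso
    have h5 := (integral_eq_zero_iff_of_nonneg (fun x => by positivity) i2).1 h4.symm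
    have h6 : nq R (t*R) (p+1) u = 0 := by
      unfold nq
      rw [eLpNorm_congr_ae (g := 0), eLpNorm_zero, ENNReal.toReal_zero]
      filter_upwards [h5] with x hx
      simpa using hx
    rw [h.nq1] at h6; norm_num at h6
  · nlinarith

lemma Sol.ne_zero {t R lam p C : ℝ} {u : 𝔼 → ℝ} (h : Sol t R lam p C u) : ∃ x ∈ DSet N R (t*R), u x ≠ 0 := by
  by_contra hn
  push Not at hn
  have h6 : nq R (t*R) (p+1) u = 0 := by
    unfold nq
    rw [eLpNorm_congr_ae (g := 0), eLpNorm_zero, ENNReal.toReal_zero]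
    filter_upwards [(nu_ac (N := N) R (t*R)).ae_le (ae_restrict_mem (D_open (N := N) R (t*R)).measurableSet)] with x hx
    exact hn x hx
  rw [h.nq1] at h6; norm_num at h6

end M21

section M22
variable {N : ℕ}
local notation "𝔼" => EuclideanSpace ℝ (Fin N)

lemma dd_min {w : 𝔼 → ℝ} {x e : 𝔼} (hw : ContDiffAt ℝ 2 w x) (hm : IsLocalMin w x) :
    0 ≤ fderiv ℝ (fun y => fderiv ℝ w y e) x e := by
  set g : ℝ → ℝ := fun s => w (x + s • e) with hg
  have hl : ∀ s : ℝ, HasDerivAt (fun s : ℝ => x + s • e) e s := fun s => by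
    simpa using ((hasDerivAt_id s).smul_const e).const_add x
  have hl0 : Tendsto (fun s : ℝ => x + s • e) (𝓝 0) (𝓝 x) := by
    have := (hl 0).continuousAt.tendsto
    simpa using this
  have hd : ∀ᶠ y in 𝓝 x, DifferentiableAt ℝ w y := by
    filter_upwards [hw.eventually (by simp)] with y hy
    exact hy.differentiableAt (by norm_num)
  have h1 : ∀ᶠ s in 𝓝 (0:ℝ), deriv g s = fderiv ℝ w (x + s • e) e := by
    filter_upwards [hl0.eventually hd] with s hs
    exact (hs.hasFDerivAt.comp_hasDerivAt s (hl s)).deriv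
  have h2 : deriv (deriv g) 0 = fderiv ℝ (fun y => fderiv ℝ w y e) x e := by
    rw [EventuallyEq.deriv_eq h1]
    have h3 : DifferentiableAt ℝ (fun y => fderiv ℝ w y e) x := by
      have : ContDiffAt ℝ 1 (fderiv ℝ w) x := hw.fderiv_right (by norm_num)
      exact (this.differentiableAt (by norm_num)).clm_apply (differentiableAt_const _)
    have h4 := h3.hasFDerivAt
    have h5 : HasFDerivAt (fun y => fderiv ℝ w y e) (fderiv ℝ (fun y => fderiv ℝ w y e) x) (x + (0:ℝ) • e) := by simpa using h4
    exact (h5.comp_hasDerivAt (0:ℝ) (hl 0)).deriv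
  rw [← h2]
  by_contra hn
  push Not at hn
  have h0 : g 0 = w x := by simp [hg]
  have hmin : ∀ᶠ s in 𝓝 (0:ℝ), g 0 ≤ g s := by
    rw [h0]; exact hl0.eventually hm
  have hmin' : IsLocalMin g 0 := hmin
  have hd0 : deriv g 0 = 0 := hmin'.deriv_eq_zero
  have hc : ContinuousAt g 0 := by
    have : ContinuousAt w (x + (0:ℝ) • e) := by simpa using hw.continuousAt
    exact ContinuousAt.comp (f := fun s : ℝ => x + s • e) this (hl 0).continuousAt
  have hmax := isLocalMax_of_deriv_deriv_neg hn hd0 hc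
  have hconst : g =ᶠ[𝓝 0] fun _ => g 0 := by
    filter_upwards [hmin, hmax] with s h1 h2
    exact le_antisymm h2 h1
  have h6 : deriv g =ᶠ[𝓝 0] fun _ => 0 := by
    have := hconst.deriv
    refine this.trans (Eventually.of_forall fun s => ?_)
    simp
  rw [h6.deriv_eq] at hn
  simp at hn

lemma lapE_min {w : 𝔼 → ℝ} {x : 𝔼} (hw : ContDiffAt ℝ 2 w x) (hm : IsLocalMin w x) : 0 ≤ lapE w x :=
  Finset.sum_nonneg fun _ _ => dd_min hw hm

/-- gaussian -/
def gs (α : ℝ) (y x : 𝔼) : ℝ := Real.exp (-α * ‖x - y‖ ^ 2)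

lemma gs_contDiff (α : ℝ) (y : 𝔼) : ContDiff ℝ 2 (gs α y) := by
  unfold gs
  exact (contDiff_const.mul ((contDiff_id.sub contDiff_const).norm_sq ℝ)).exp

lemma gs_fderiv (α : ℝ) (y x : 𝔼) : HasFDerivAt (gs α y) ((-2 * α * gs α y x) • innerSL ℝ (x - y)) x := by
  have h1 : HasFDerivAt (fun x : 𝔼 => x - y) (ContinuousLinearMap.id ℝ 𝔼) x := (hasFDerivAt_id x).sub_const y
  have h2 := ((h1.norm_sq).const_mul (-α)).exp
  refine h2.congr_fderiv ?_
  ext v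
  simp [gs]; ring

lemma gs_lap (α : ℝ) (y x : 𝔼) : lapE (gs α y) x = (4 * α ^ 2 * ‖x - y‖ ^ 2 - 2 * α * N) * gs α y x := by
  have h : ∀ i : Fin N, fderiv ℝ (fun z => fderiv ℝ (gs α y) z (EuclideanSpace.single i 1)) x (EuclideanSpace.single i 1)
      = (4 * α ^ 2 * (x i - y i) ^ 2 - 2 * α) * gs α y x := by
    intro i
    have e : (fun z => fderiv ℝ (gs α y) z (EuclideanSpace.single i (1:ℝ))) = fun z => (-2 * α) * (gs α y z * ⟪EuclideanSpace.single i (1:ℝ), z - y⟫_ℝ) := by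
      ext z
      rw [(gs_fderiv α y z).fderiv]
      simp [EuclideanSpace.inner_single_right, EuclideanSpace.inner_single_left]; ring
    rw [e]
    have h1 : HasFDerivAt (fun z : 𝔼 => z - y) (ContinuousLinearMap.id ℝ 𝔼) x := (hasFDerivAt_id x).sub_const y
    have h2 : HasFDerivAt (fun z : 𝔼 => ⟪EuclideanSpace.single i (1:ℝ), z - y⟫_ℝ) (innerSL ℝ (EuclideanSpace.single i (1:ℝ))) x := by
      have := (innerSL ℝ (EuclideanSpace.single i (1:ℝ))).hasFDerivAt.comp x h1
      exact this
    have h3 := ((gs_fderiv α y x).mul h2).const_mul (-2 * α)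
    have h4 : fderiv ℝ (fun z => -2 * α * (gs α y z * ⟪EuclideanSpace.single i (1:ℝ), z - y⟫_ℝ)) x = _ := h3.fderiv
    rw [h4]
    simp [EuclideanSpace.inner_single_right, EuclideanSpace.inner_single_left]; ring
  unfold lapE
  simp only [h]
  rw [← Finset.sum_mul, Finset.sum_sub_distrib, ← Finset.mul_sum]
  have : ‖x - y‖ ^ 2 = ∑ i, (x i - y i) ^ 2 := by
    rw [EuclideanSpace.norm_sq_eq]; simp
  rw [this]
  simp
  left; ring

end M22

section M23
variable {N : ℕ}
local notation "𝔼" => EuclideanSpace ℝ (Fin N)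

lemma hopf {D : Set 𝔼} (hD : IsOpen D) {u : 𝔼 → ℝ} (hu : ContDiffOn ℝ 2 u D) {c : ℝ} (hc : 0 < c)
    (hnn : ∀ x ∈ D, 0 ≤ u x) (hlap : ∀ x ∈ D, lapE u x ≤ c * u x) {y z : 𝔼} {r : ℝ} (hr : 0 < r)
    (hb : Metric.closedBall y r ⊆ D) (hpos : ∀ x, ‖x - y‖ < r → 0 < u x) (hz : ‖z - y‖ = r) (huz : u z = 0) : False := by
  have hzD : z ∈ D := hb (by rw [Metric.mem_closedBall, dist_eq_norm]; exact hz.le)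
  -- choose alpha
  obtain ⟨α, hα0, hα⟩ : ∃ α : ℝ, 0 < α ∧ c < α ^ 2 * r ^ 2 - 2 * α * N := by
    have h1 : 0 < r ^ 2 := by positivity
    refine ⟨(2 * N + c) / r ^ 2 + 1, by positivity, ?_⟩
    set k := (2 * N + c) / r ^ 2 with hk
    have hk0 : 0 < k := by positivity
    have e : k * r ^ 2 = 2 * N + c := by rw [hk]; field_simp
    have e2 : (k + 1) ^ 2 * r ^ 2 = (k + 1) * (2 * N + c) + (k + 1) * r ^ 2 := by
      rw [← e]; ring
    rw [e2]
    have : 0 < k * c := by positivity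
    have : 0 < (k + 1) * r ^ 2 := by positivity
    nlinarith
  set b := Real.exp (-α * r ^ 2) with hbd
  have hb0 : 0 < b := Real.exp_pos _
  have hgle : ∀ x, gs α y x ≤ 1 := fun x => by
    unfold gs
    rw [Real.exp_le_one_iff]
    have : 0 ≤ α * ‖x - y‖ ^ 2 := by positivity
    linarith
  have hg_out : ∀ x, r ≤ ‖x - y‖ → gs α y x ≤ b := fun x hx => by
    unfold gs
    rw [hbd, Real.exp_le_exp]
    have : r ^ 2 ≤ ‖x - y‖ ^ 2 := by gcongr
    nlinarith
  have hgz : gs α y z = b := by unfold gs; rw [hz]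
  -- lower bound on the small ball
  have hcu : ContinuousOn u D := hu.continuousOn
  have hKc : IsCompact (Metric.closedBall y (r/2)) := isCompact_closedBall _ _
  have hKD : Metric.closedBall y (r/2) ⊆ D := (Metric.closedBall_subset_closedBall (by linarith)).trans hb
  obtain ⟨x0, hx0, hx0m⟩ := hKc.exists_isMinOn ⟨y, by simp; positivity⟩ (hcu.mono hKD)
  have hε : 0 < u x0 := hpos _ (by rw [Metric.mem_closedBall, dist_eq_norm] at hx0; linarith)
  set ε := u x0 with hεd
  set w : 𝔼 → ℝ := fun x => u x + (-ε) * gs α y x + ε * b with hw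
  have hwval : ∀ x, w x = u x - ε * (gs α y x - b) := fun x => by simp only [hw]; ring
  have hsmall : ∀ x, ‖x - y‖ ≤ r / 2 → 0 ≤ w x := fun x hx => by
    have h1 : ε ≤ u x := hx0m (by rw [Metric.mem_closedBall, dist_eq_norm]; exact hx)
    rw [hwval]
    have : ε * (gs α y x - b) ≤ ε * 1 := by gcongr; linarith [hgle x]
    linarith
  have hout : ∀ x ∈ D, r ≤ ‖x - y‖ → 0 ≤ w x := fun x hx hxr => by
    rw [hwval]
    have : ε * (gs α y x - b) ≤ 0 := mul_nonpos_of_nonneg_of_nonpos hε.le (by linarith [hg_out x hxr])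
    linarith [hnn x hx]
  have hcw : ContinuousOn w D := by
    have := (gs_contDiff α y).continuous
    exact ((hcu.add (continuousOn_const.mul this.continuousOn)).add continuousOn_const)
  have hc2 : ∀ x ∈ D, ContDiffAt ℝ 2 u x := fun x hx => hu.contDiffAt (hD.mem_nhds hx)
  have hwc2 : ∀ x ∈ D, ContDiffAt ℝ 2 w x := fun x hx =>
    ((hc2 x hx).add (contDiffAt_const.mul (gs_contDiff α y).contDiffAt)).add contDiffAt_const
  have hmid : ∀ x, ‖x - y‖ ≤ r → 0 ≤ w x := by
    obtain ⟨x1, hx1, hx1m⟩ := (isCompact_closedBall y r).exists_isMinOn ⟨y, by simp; positivity⟩ (hcw.mono hb)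
    by_contra hn
    push Not at hn
    obtain ⟨x2, hx2, hx2n⟩ := hn
    have h1 : w x1 < 0 := lt_of_le_of_lt (hx1m (by rw [Metric.mem_closedBall, dist_eq_norm]; exact hx2)) hx2n
    have hx1D := hb hx1
    have h2 : r / 2 < ‖x1 - y‖ := by
      by_contra hh; push Not at hh; linarith [hsmall x1 hh]
    have h3 : ‖x1 - y‖ < r := by
      by_contra hh; push Not at hh; linarith [hout x1 hx1D hh]
    have hloc : IsLocalMin w x1 := by
      have : Metric.ball y r ∈ 𝓝 x1 := Metric.isOpen_ball.mem_nhds (by rw [Metric.mem_ball, dist_eq_norm]; exact h3)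
      filter_upwards [this] with x hx
      exact hx1m (Metric.ball_subset_closedBall hx)
    have hlw : lapE w x1 = lapE u x1 - ε * lapE (gs α y) x1 := by
      have a1 := lapE_add (f := fun x => u x + (-ε) * gs α y x) (g := fun _ => ε * b) (x := x1)
        ((hc2 x1 hx1D).add (contDiffAt_const.mul (gs_contDiff α y).contDiffAt)) contDiffAt_const
      have a2 := lapE_add (f := u) (g := fun x => (-ε) * gs α y x) (x := x1) (hc2 x1 hx1D) (contDiffAt_const.mul (gs_contDiff α y).contDiffAt)
      have a3 := lapE_const_mul (f := gs α y) (x := x1) (-ε) (gs_contDiff α y).contDiffAt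
      have a4 : lapE (fun _ : 𝔼 => ε * b) x1 = 0 := by simp [lapE]
      rw [hw, a1, a2, a3, a4]; ring
    have h4 := lapE_min (hwc2 x1 hx1D) hloc
    rw [hlw, gs_lap] at h4
    have h5 := hlap x1 hx1D
    have hg0 : 0 < gs α y x1 := Real.exp_pos _
    have h6 : c < 4 * α ^ 2 * ‖x1 - y‖ ^ 2 - 2 * α * N := by
      have : (r / 2) ^ 2 ≤ ‖x1 - y‖ ^ 2 := by gcongr
      have : α ^ 2 * (r / 2) ^ 2 ≤ α ^ 2 * ‖x1 - y‖ ^ 2 := by gcongr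
      nlinarith
    have h7 : c * gs α y x1 ≤ (4 * α ^ 2 * ‖x1 - y‖ ^ 2 - 2 * α * N) * gs α y x1 := by gcongr
    have h8 : ε * (c * gs α y x1) ≤ ε * ((4 * α ^ 2 * ‖x1 - y‖ ^ 2 - 2 * α * N) * gs α y x1) := by gcongr
    have h9 : 0 ≤ c * w x1 := by
      rw [hwval]
      have : 0 < c * ε * b := by positivity
      nlinarith
    nlinarith
  have hall : ∀ x ∈ D, 0 ≤ w x := fun x hx => (le_total ‖x - y‖ r).elim (hmid x) (hout x hx)
  have hwz : w z = 0 := by rw [hwval, huz, hgz]; ring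
  have m1 : fderiv ℝ w z = 0 := by
    refine IsLocalMin.fderiv_eq_zero ?_
    filter_upwards [hD.mem_nhds hzD] with x hx
    rw [hwz]; exact hall x hx
  have m2 : fderiv ℝ u z = 0 := by
    refine IsLocalMin.fderiv_eq_zero ?_
    filter_upwards [hD.mem_nhds hzD] with x hx
    rw [huz]; exact hnn x hx
  have hdu : DifferentiableAt ℝ u z := (hc2 z hzD).differentiableAt (by norm_num)
  have hfd : HasFDerivAt w (fderiv ℝ u z + (-ε) • ((-2 * α * gs α y z) • innerSL ℝ (z - y))) z := by
    have := (hdu.hasFDerivAt.add ((gs_fderiv α y z).const_mul (-ε))).add_const (ε * b)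
    exact this
  have h0 := hfd.fderiv
  rw [m1, m2] at h0
  have h1 := DFunLike.congr_fun h0 (z - y)
  simp only [ContinuousLinearMap.zero_apply, ContinuousLinearMap.add_apply, ContinuousLinearMap.smul_apply, innerSL_apply_apply,
    real_inner_self_eq_norm_sq, hz, hgz, smul_eq_mul, zero_add] at h1
  have : 0 < ε * (2 * α * b * r ^ 2) := by positivity
  nlinarith

lemma D_preconn (hN : 2 ≤ N) (R r : ℝ) (hR : 0 < R) : IsPreconnected (DSet N R r) := by
  have h1 : IsPreconnected (Metric.sphere (0:𝔼) 1) := by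
    refine isPreconnected_sphere ?_ 0 1
    rw [← Module.finrank_eq_rank]
    simp only [finrank_euclideanSpace, Fintype.card_fin]
    exact_mod_cast hN
  have h2 : IsPreconnected (Set.Ioo R r) := isPreconnected_Ioo
  have h3 := (h2.prod h1).image (fun q : ℝ × 𝔼 => q.1 • q.2) (by fun_prop)
  convert h3 using 1
  ext x
  constructor
  · intro hx
    have hx0 : 0 < ‖x‖ := by linarith [hx.1]
    refine ⟨(‖x‖, ‖x‖⁻¹ • x), ⟨hx, ?_⟩, ?_⟩
    · simp [norm_smul, hx0.ne']
    · simp [smul_smul, hx0.ne']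
  · rintro ⟨⟨s, y⟩, ⟨hs, hy⟩, rfl⟩
    have hy1 : ‖y‖ = 1 := by simpa using hy
    have : ‖s • y‖ = s := by rw [norm_smul, hy1, mul_one, Real.norm_eq_abs, abs_of_pos (by linarith [hs.1])]
    simp only [DSet, Set.mem_setOf_eq, this]
    exact hs

lemma strong_max {D : Set 𝔼} (hD : IsOpen D) (hDc : IsPreconnected D) {u : 𝔼 → ℝ} (hu : ContDiffOn ℝ 2 u D) {c : ℝ} (hc : 0 < c)
    (hnn : ∀ x ∈ D, 0 ≤ u x) (hlap : ∀ x ∈ D, lapE u x ≤ c * u x) (hne : ∃ x ∈ D, u x ≠ 0) : ∀ x ∈ D, 0 < u x := by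
  by_contra hn
  push Not at hn
  obtain ⟨x0, hx0, hx0u⟩ := hn
  obtain ⟨x1, hx1, hx1u⟩ := hne
  have hcu := hu.continuousOn
  have hU : IsOpen {x | x ∈ D ∧ 0 < u x} := by
    have := hcu.isOpen_inter_preimage hD (isOpen_Ioi (a := (0:ℝ)))
    exact this
  have hV : IsOpen {x | x ∈ D ∧ u x = 0} := by
    rw [Metric.isOpen_iff]
    rintro z ⟨hzD, hz⟩
    obtain ⟨ρ, hρ, hb⟩ := Metric.isOpen_iff.1 hD z hzD
    refine ⟨ρ / 4, by positivity, fun y hy => ?_⟩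
    have hyρ : dist y z < ρ / 4 := hy
    have hyD : y ∈ D := hb (by rw [Metric.mem_ball]; linarith)
    refine ⟨hyD, ?_⟩
    by_contra hyu
    have hyp : 0 < u y := lt_of_le_of_ne (hnn y hyD) (Ne.symm hyu)
    have hsub : Metric.closedBall z (ρ / 2) ⊆ D := (Metric.closedBall_subset_ball (by linarith)).trans hb
    have hKc : IsCompact (Metric.closedBall z (ρ/2) ∩ u ⁻¹' {0}) := by
      refine (isCompact_closedBall z (ρ/2)).of_isClosed_subset ?_ Set.inter_subset_left
      exact (hcu.mono hsub).preimage_isClosed_of_isClosed Metric.isClosed_closedBall isClosed_singleton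
    have hzK : z ∈ Metric.closedBall z (ρ/2) ∩ u ⁻¹' {0} := ⟨by simp; positivity, hz⟩
    obtain ⟨z', hz', hdist⟩ := hKc.exists_infDist_eq_dist ⟨z, hzK⟩ y
    have hle : dist y z' ≤ dist y z := by rw [← hdist]; exact Metric.infDist_le_dist_of_mem hzK
    have hpos : 0 < dist y z' := by
      rw [dist_pos]; rintro rfl
      exact hyu hz'.2
    refine hopf hD hu hc hnn hlap (y := y) (z := z') (r := dist y z') hpos ?_ ?_ ?_ hz'.2
    · intro x hx
      apply hsub
      rw [Metric.mem_closedBall] at hx ⊢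
      linarith [dist_triangle x y z]
    · intro x hx
      rw [← dist_eq_norm] at hx
      have hxm : x ∈ Metric.closedBall z (ρ/2) := by
        rw [Metric.mem_closedBall]; linarith [dist_triangle x y z]
      refine lt_of_le_of_ne (hnn x (hsub hxm)) fun h0 => ?_
      have := Metric.infDist_le_dist_of_mem (x := y) (show x ∈ Metric.closedBall z (ρ/2) ∩ u ⁻¹' {0} from ⟨hxm, h0.symm⟩)
      rw [hdist, dist_comm y x] at this
      linarith
    · rw [← dist_eq_norm, dist_comm]
  obtain ⟨x, hx, h1, h2⟩ := hDc _ _ hU hV (fun x hx => by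
    rcases (hnn x hx).eq_or_lt with h | h
    · exact Or.inr ⟨hx, h.symm⟩
    · exact Or.inl ⟨hx, h⟩) ⟨x1, hx1, hx1, lt_of_le_of_ne (hnn x1 hx1) (Ne.symm hx1u)⟩ ⟨x0, hx0, hx0, le_antisymm hx0u (hnn x0 hx0)⟩
  linarith [h1.2, h2.2]

lemma Sol.pos {t R lam p C : ℝ} {u : 𝔼 → ℝ} (hN : 3 ≤ N) (hR : 0 < R) (hl : 0 < lam) (hC : 0 ≤ C)
    (h : Sol t R lam p C u) : ∀ x ∈ DSet N R (t*R), 0 < u x := by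
  refine strong_max (D_open _ _) (D_preconn (by omega) _ _ hR) h.c2 (c := lam / (2 * R)) (by positivity) h.nn (fun x hx => ?_) h.ne_zero
  have h1 := h.eq x hx
  have h2 := h.nn x hx
  have hx1 := hx.1
  have h3 : lapE u x = lam * u x / (2 * ‖x‖) - C * u x ^ p / (2 * ‖x‖) := by
    unfold nl at h1; rw [sub_div] at h1; linarith
  have h4 : 0 ≤ C * u x ^ p / (2 * ‖x‖) := by positivity
  have h5 : lam * u x / (2 * ‖x‖) ≤ lam * u x / (2 * R) := by gcongr
  calc _ ≤ lam * u x / (2 * R) := by linarith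
    _ = _ := by ring

end M23

section M24
variable {N : ℕ}
local notation "𝔼" => EuclideanSpace ℝ (Fin N)

lemma ind_Dir (R r : ℝ) (f : 𝔼 → ℝ) :
    Dir R r ((DSet N R r).indicator f) = ∫ x in DSet N R r, ‖fderiv ℝ f x‖ ^ 2 :=
  setIntegral_congr_fun (D_open R r).measurableSet fun x hx => by
    rw [fderiv_ind f hx]

lemma ind_sq (R r : ℝ) (f : 𝔼 → ℝ) :
    ∫ x, (DSet N R r).indicator f x ^ 2 ∂(nu N R r) = ∫ x in DSet N R r, f x ^ 2 / (2 * ‖x‖) := by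
  rw [int_nu]
  refine setIntegral_congr_fun (D_open R r).measurableSet fun x hx => ?_
  rw [Set.indicator_of_mem hx]

lemma ind_Qf (R r lam : ℝ) (f : 𝔼 → ℝ) :
    Qf R r lam ((DSet N R r).indicator f) = (∫ x in DSet N R r, ‖fderiv ℝ f x‖ ^ 2)
      + lam * ∫ x in DSet N R r, f x ^ 2 / (2 * ‖x‖) := by
  unfold Qf
  rw [ind_Dir, ind_sq]

lemma ind_nq {R r p : ℝ} (hR : 0 < R) (hp : 1 < p) {f : 𝔼 → ℝ}
    (hf : Adm R r ((DSet N R r).indicator f)) :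
    nq R r (p+1) ((DSet N R r).indicator f) ^ (p+1) = ∫ x in DSet N R r, |f x| ^ (p+1) / (2 * ‖x‖) := by
  haveI := nu_fin (N := N) (r := r) hR
  rw [nq_rpow (by linarith) (hf.memLp _ _), int_nu]
  refine setIntegral_congr_fun (D_open R r).measurableSet fun x hx => ?_
  rw [Set.indicator_of_mem hx]

lemma Neh_iff {R r lam p : ℝ} (hR : 0 < R) (hp : 1 < p) {f : 𝔼 → ℝ}
    (hf : Adm R r ((DSet N R r).indicator f)) :
    NehariId N R r lam p f ↔ Qf R r lam ((DSet N R r).indicator f) =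
      nq R r (p+1) ((DSet N R r).indicator f) ^ (p+1) := by
  rw [ind_Qf, ind_nq hR hp hf]; rfl

lemma int_wt {R r : ℝ} (hR : 0 < R) {g : 𝔼 → ℝ} (hg : Continuous g) {B : ℝ} (hB : ∀ x, ‖g x‖ ≤ B) :
    IntegrableOn (fun x => g x / (2 * ‖x‖)) (DSet N R r) := by
  have hfin : volume (DSet N R r) ≠ ⊤ := (D_bdd (N := N) R r).measure_lt_top.ne
  have hB0 : 0 ≤ B := (norm_nonneg _).trans (hB 0)
  refine Measure.integrableOn_of_bounded (M := B / (2 * R)) hfin ?_ ?_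
  · exact (hg.measurable.div (by fun_prop)).aestronglyMeasurable
  · filter_upwards [ae_restrict_mem (D_open (N := N) R r).measurableSet] with x hx
    have hx1 : R < ‖x‖ := hx.1
    rw [norm_div, Real.norm_of_nonneg (by positivity : (0:ℝ) ≤ 2 * ‖x‖)]
    exact div_le_div₀ hB0 (hB x) (by positivity) (by linarith)

lemma Jfun_eq {R r lam p : ℝ} (hR : 0 < R) (hp : 1 < p) {f : 𝔼 → ℝ}
    (hf : Adm R r ((DSet N R r).indicator f)) :
    Jfun N R r lam p f = Qf R r lam ((DSet N R r).indicator f) / 2 -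
      nq R r (p+1) ((DSet N R r).indicator f) ^ (p+1) / (p+1) := by
  rw [ind_Qf, ind_nq hR hp hf]
  obtain ⟨B, hB⟩ := hf.bdd
  have hB0 : 0 ≤ B := (norm_nonneg _).trans (hB 0)
  have hc := hf.cont
  have hm := (D_open (N := N) R r).measurableSet
  have i1 : IntegrableOn (fun x => ‖fderiv ℝ f x‖ ^ 2) (DSet N R r) := by
    refine hf.sqInt.congr_fun (fun x hx => ?_) hm
    dsimp only
    rw [fderiv_ind f hx]
  have i2 : IntegrableOn (fun x => f x ^ 2 / (2 * ‖x‖)) (DSet N R r) := by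
    refine (int_wt (r := r) hR (g := fun x => (DSet N R r).indicator f x ^ 2) (hc.pow 2) (B := B ^ 2) fun x => ?_).congr_fun (fun x hx => ?_) hm
    · rw [norm_pow]; exact pow_le_pow_left₀ (norm_nonneg _) (hB x) 2
    · dsimp only
      rw [Set.indicator_of_mem hx]
  have i3 : IntegrableOn (fun x => |f x| ^ (p+1) / (2 * ‖x‖)) (DSet N R r) := by
    refine (int_wt (r := r) hR (g := fun x => |(DSet N R r).indicator f x| ^ (p+1))
      (hc.abs.rpow_const fun x => Or.inr (by linarith)) (B := B ^ (p+1)) fun x => ?_).congr_fun (fun x hx => ?_) hm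
    · rw [Real.norm_of_nonneg (by positivity)]
      exact Real.rpow_le_rpow (abs_nonneg _) (hB x) (by linarith)
    · dsimp only
      rw [Set.indicator_of_mem hx]
  have j1 : Integrable (fun x => (1/2:ℝ) * ‖fderiv ℝ f x‖ ^ 2 + lam / 2 * (f x ^ 2 / (2 * ‖x‖)))
    (volume.restrict (DSet N R r)) := (i1.const_mul _).add (i2.const_mul _)
  have key : Jfun N R r lam p f = ∫ x in DSet N R r, (((1/2:ℝ) * ‖fderiv ℝ f x‖ ^ 2 + lam / 2 * (f x ^ 2 / (2 * ‖x‖)))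
      - 1 / (p+1) * (|f x| ^ (p+1) / (2 * ‖x‖))) := by
    unfold Jfun
    refine setIntegral_congr_fun hm fun x hx => ?_
    have hx1 : R < ‖x‖ := hx.1
    have : ‖x‖ ≠ 0 := by linarith
    have : p + 1 ≠ 0 := by linarith
    field_simp
    ring
  rw [key, integral_sub j1 (i3.const_mul _), integral_add (i1.const_mul _) (i2.const_mul _),
    integral_const_mul, integral_const_mul, integral_const_mul]
  ring

theorem main_aux (hN : 3 ≤ N) {t R lam p : ℝ} (ht : 1 < t) (hR : 0 < R) (hl : 0 < lam) (hp : 1 < p)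
    (hp' : p * ((N:ℝ) - 2) < N + 2) :
    ∃ v : 𝔼 → ℝ,
      ContDiffOn ℝ 2 v (DSet N R (t*R)) ∧
      ContDiffOn ℝ 1 v (closure (DSet N R (t*R))) ∧
      (∀ z ∈ DSet N R (t*R), 0 < v z) ∧
      (∀ z ∈ frontier (DSet N R (t*R)), v z = 0) ∧
      (∀ z ∈ DSet N R (t*R), -lapE v z = (v z ^ p - lam * v z) / (2 * ‖z‖)) ∧
      v ∈ Nehari N R (t*R) lam p ∧
      ∀ w ∈ Nehari N R (t*R) lam p, Jfun N R (t*R) lam p v ≤ Jfun N R (t*R) lam p w := by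
  have hr : R < t * R := by nlinarith
  obtain ⟨u, a1, a2, a3, a4, a5, a6⟩ := exists_u1 hN ht hR hl hp hp'
  have hC0 := Clev_nonneg (N := N) (by omega) hR hr (by linarith : 0 < p + 1) hl
  set C := Clev N R (t*R) lam (p+1) with hCdef
  have h : Sol t R lam p C u := ⟨a1, a2, a3, a4, a5, a6⟩
  have hC := h.Cpos hN ht hR hl hp hC0
  have hupos := h.pos hN hR hl hC0
  obtain ⟨τ, hτ, hτC⟩ : ∃ τ : ℝ, 0 < τ ∧ τ ^ (p-1) = C :=
    ⟨C ^ (1/(p-1)), by positivity, by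
      rw [← rpow_mul hC.le, one_div, inv_mul_cancel₀ (by linarith), rpow_one]⟩
  have hτp : τ ^ p = C * τ := by
    rw [← hτC, ← rpow_add_one hτ.ne']; congr 1; ring
  have hτq : τ ^ (p+1) = C * τ ^ 2 := by
    rw [rpow_add_one hτ.ne', hτp]; ring
  have hv1 : ContDiffOn ℝ 1 (fun x => τ * u x) (Unb N t R) := contDiffOn_const.mul h.c1
  have hvf : ∀ z ∈ frontier (DSet N R (t*R)), τ * u z = 0 := fun z hz => by
    rw [h.bdry z (frD _ _ hz), mul_zero]
  obtain ⟨K, hK⟩ := lip_of_Unb ht hR hv1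
  have hA := lip_ind hK hvf
  have hind : (DSet N R (t*R)).indicator (fun x => τ * u x) = fun x => τ * (DSet N R (t*R)).indicator u x := by
    funext x
    by_cases hx : x ∈ DSet N R (t*R)
    · rw [Set.indicator_of_mem hx, Set.indicator_of_mem hx]
    · rw [Set.indicator_of_notMem hx, Set.indicator_of_notMem hx, mul_zero]
  have hQu : Qf R (t*R) lam ((DSet N R (t*R)).indicator u) = C := by
    rw [ind_Qf, ← int_nu R (t*R) (fun x => u x ^ 2)]
    exact h.energy hN ht hR hl hp hC0
  have hnu : nq R (t*R) (p+1) ((DSet N R (t*R)).indicator u) = 1 := by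
    refine Eq.trans ?_ h.nq1
    unfold nq; rw [eLpNorm_congr_ae (ind_ae u)]
  have hQv : Qf R (t*R) lam ((DSet N R (t*R)).indicator (fun x => τ * u x)) = τ ^ (p+1) := by
    rw [hind, Qf_smul (h.adm ht hR), hQu, hτq]; ring
  have hnv : nq R (t*R) (p+1) ((DSet N R (t*R)).indicator (fun x => τ * u x)) = τ := by
    rw [hind, nq_smul, hnu, mul_one, abs_of_pos hτ]
  refine ⟨fun x => τ * u x, contDiffOn_const.mul h.c2, hv1.mono (clD_Unb ht hR),
    fun z hz => mul_pos hτ (hupos z hz), hvf, fun z hz => ?_, ⟨⟨K, hK⟩, hvf, ?_, ?_⟩, ?_⟩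
  · rw [lapE_const_mul τ (h.c2.contDiffAt ((D_open _ _).mem_nhds hz)), ← mul_neg, h.eq z hz]
    dsimp only [nl]
    rw [mul_rpow hτ.le (hupos z hz).le, hτp]
    ring
  · obtain ⟨x, hx, hx'⟩ := h.ne_zero
    exact ⟨x, subset_closure hx, mul_ne_zero hτ.ne' hx'⟩
  · rw [Neh_iff hR hp hA, hQv, hnv]
  · rintro w ⟨⟨L, hL⟩, hwf, ⟨x, hx, hx'⟩, hwN⟩
    have hW := lip_ind hL hwf
    rw [Neh_iff hR hp hW] at hwN
    rw [Jfun_eq hR hp hA, Jfun_eq hR hp hW, hQv, hnv, hwN]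
    have hxD : x ∈ DSet N R (t*R) := by
      by_contra hn
      refine hx' (hwf x ⟨hx, ?_⟩)
      rwa [(D_open _ _).interior_eq]
    have hn0 : 0 < nq R (t*R) (p+1) ((DSet N R (t*R)).indicator w) :=
      nq_pos hR (by linarith) hW (x := x) (by rwa [Set.indicator_of_mem hxD])
    have hin := Clev_ineq (q := p + 1) hl hW
    rw [hwN, ← hCdef] at hin
    set n := nq R (t*R) (p+1) ((DSet N R (t*R)).indicator w) with hn
    have h1 : n ^ (p+1) = n ^ (p-1) * n ^ 2 := by
      rw [← rpow_natCast n 2, ← rpow_add hn0]; congr 1; push_cast; ring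
    rw [h1] at hin
    have h2 : τ ^ (p-1) ≤ n ^ (p-1) := by
      rw [hτC]; exact le_of_mul_le_mul_right hin (by positivity)
    have h3 : τ ≤ n := (rpow_le_rpow_iff hτ.le hn0.le (by linarith)).1 h2
    have h4 : τ ^ (p+1) ≤ n ^ (p+1) := rpow_le_rpow hτ.le h3 (by linarith)
    have h5 : (0:ℝ) ≤ 1/2 - 1/(p+1) := by
      rw [sub_nonneg]; exact one_div_le_one_div_of_le (by norm_num) (by linarith)
    calc τ ^ (p+1) / 2 - τ ^ (p+1) / (p+1) = (1/2 - 1/(p+1)) * τ ^ (p+1) := by ring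
      _ ≤ (1/2 - 1/(p+1)) * n ^ (p+1) := mul_le_mul_of_nonneg_left h4 h5
      _ = _ := by ring

end M24

/-- existence of a positive least-energy solution `v_λ ∈ C²(D) ∩ C¹(D̄)` of
`−Δv = (v^p − λv)/(2|z|)` in `D`, `v = 0` on `∂D`, belonging to the Nehari set and minimizing
`J_λ` there. -/
theorem stmt_8 (N : ℕ) (hN : 3 ≤ N) (R₁ R₂ : ℝ) (hR₁ : 0 < R₁) (hR : R₁ < R₂)
    (p lam : ℝ) (hp : 1 < p) (hp' : p < ((N : ℝ) + 2) / ((N : ℝ) - 2)) (hlam : 0 < lam) :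
    ∃ v : EuclideanSpace ℝ (Fin N) → ℝ,
      ContDiffOn ℝ 2 v (DSet N R₁ R₂) ∧
      ContDiffOn ℝ 1 v (closure (DSet N R₁ R₂)) ∧
      (∀ z ∈ DSet N R₁ R₂, 0 < v z) ∧
      (∀ z ∈ frontier (DSet N R₁ R₂), v z = 0) ∧
      (∀ z ∈ DSet N R₁ R₂, -lapE v z = (v z ^ p - lam * v z) / (2 * ‖z‖)) ∧
      v ∈ Nehari N R₁ R₂ lam p ∧
      ∀ w ∈ Nehari N R₁ R₂ lam p, Jfun N R₁ R₂ lam p v ≤ Jfun N R₁ R₂ lam p w := by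
  obtain ⟨t, rfl⟩ : ∃ t, R₂ = t * R₁ := ⟨R₂ / R₁, by field_simp⟩
  have ht : 1 < t := by
    by_contra hc
    push Not at hc
    nlinarith
  have hN3 : (3:ℝ) ≤ N := by exact_mod_cast hN
  exact main_aux hN ht hR₁ hlam hp ((lt_div_iff₀ (by linarith)).1 hp')
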